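/- arXiv:1701.02827 — 4 statements merged into one kernel-verified Lean document; each statement's English description precedes it below -/
import Mathlib

section
/- Gelfand–Pinsker reduction inequality: let (S,U,Y) be jointly distributed random variables with I(U;S) < ∞. Then there exists a random variable V independent of S such that U is a function of (S,V) and I(V;Y) ≥ I(U;Y) − I(U;S) − log₂(I(U;S)+1) − 4. -/
open MeasureTheory ProbabilityTheory Real
open scoped ENNReal

noncomputable section
open Classical in

/-- Kullback–Leibler divergence in bits (base-2 logarithm). -/
def klBits {α : Type*} [MeasurableSpace α] (P Q : Measure α) : ℝ≥0∞ :=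
  if P ≪ Q ∧ Integrable (fun x => Real.logb 2 (P.rnDeriv Q x).toReal) P
  then ENNReal.ofReal (∫ x, Real.logb 2 (P.rnDeriv Q x).toReal ∂P)
  else ⊤

/-- Mutual information `I(X;Y)` in bits: the KL divergence between the joint law and the
product of the marginal laws. -/
def miBits {Ω 𝒳 𝒴 : Type*} [MeasurableSpace Ω] [MeasurableSpace 𝒳] [MeasurableSpace 𝒴]
    (μ : Measure Ω) (X : Ω → 𝒳) (Y : Ω → 𝒴) : ℝ≥0∞ :=
  klBits (μ.map (fun ω => (X ω, Y ω))) ((μ.map X).prod (μ.map Y))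

/-- Conditional mutual information `I(X;Z|Y)` in bits, defined via the chain rule
`I(X;Z|Y) = I(X;(Z,Y)) - I(X;Y)`. -/
def cmiBits {Ω 𝒳 𝒵 𝒴 : Type*} [MeasurableSpace Ω] [MeasurableSpace 𝒳] [MeasurableSpace 𝒵]
    [MeasurableSpace 𝒴] (μ : Measure Ω) (X : Ω → 𝒳) (Z : Ω → 𝒵) (Y : Ω → 𝒴) : ℝ≥0∞ :=
  miBits μ X (fun ω => (Z ω, Y ω)) - miBits μ X Y

/-- Entropy `H(X)` in bits, as `I(X;X)` (equals the Shannon entropy for discrete `X`,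
and `∞` otherwise). -/
def entBits {Ω 𝒳 : Type*} [MeasurableSpace Ω] [MeasurableSpace 𝒳]
    (μ : Measure Ω) (X : Ω → 𝒳) : ℝ≥0∞ :=
  miBits μ X X

/-- Conditional entropy `H(Y|Z)` in bits, as `I(Y;Y|Z)`. -/
def condEntBits {Ω 𝒴 𝒵 : Type*} [MeasurableSpace Ω] [MeasurableSpace 𝒴] [MeasurableSpace 𝒵]
    (μ : Measure Ω) (Y : Ω → 𝒴) (Z : Ω → 𝒵) : ℝ≥0∞ :=
  cmiBits μ Y Y Z

/-- Mutual information of a joint distribution on a product space. -/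
def miOfJoint {𝒳 𝒴 : Type*} [MeasurableSpace 𝒳] [MeasurableSpace 𝒴]
    (ν : Measure (𝒳 × 𝒴)) : ℝ≥0∞ :=
  miBits ν Prod.fst Prod.snd


lemma gp_lintegral_mul_inv_rnDeriv_le {α : Type*} [MeasurableSpace α] (P Q : Measure α)
    [IsFiniteMeasure P] [IsFiniteMeasure Q] (h : P ≪ Q) (f : α → ℝ≥0∞) (hf : Measurable f) :
    ∫⁻ x, f x * (P.rnDeriv Q x)⁻¹ ∂P ≤ ∫⁻ x, f x ∂Q := by
  have hm : Measurable (fun x => f x * (P.rnDeriv Q x)⁻¹) :=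
    hf.mul (Measure.measurable_rnDeriv P Q).inv
  rw [← lintegral_rnDeriv_mul h hm.aemeasurable]
  refine lintegral_mono fun x => ?_
  calc P.rnDeriv Q x * (f x * (P.rnDeriv Q x)⁻¹)
      = f x * (P.rnDeriv Q x * (P.rnDeriv Q x)⁻¹) := by ring
    _ ≤ f x * 1 := by gcongr; exact ENNReal.mul_inv_le_one _
    _ = f x := mul_one _

/-- The basic information inequality: if `U = Uk K (V)` where `K` is a random index which can be
guessed with sub-probability weights `q k v`. -/
lemma gp_info {Ω 𝒰 𝒱 𝒴 : Type*} [MeasurableSpace Ω] [MeasurableSpace 𝒰] [MeasurableSpace 𝒱]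
    [MeasurableSpace 𝒴] (μ : Measure Ω) [IsProbabilityMeasure μ]
    (U : Ω → 𝒰) (V : Ω → 𝒱) (Y : Ω → 𝒴) (K : Ω → ℕ)
    (hU : Measurable U) (hV : Measurable V) (hY : Measurable Y) (hK : Measurable K)
    (Uk : ℕ → 𝒱 → 𝒰) (hUk : ∀ k, Measurable (Uk k))
    (q : ℕ → 𝒱 → ℝ) (hq : ∀ k, Measurable (q k)) (hqpos : ∀ k v, 0 < q k v)
    (hUK : ∀ᵐ ω ∂μ, U ω = Uk (K ω) (V ω))
    (hac : ∀ k, (μ.map V).map (Uk k) ≪ μ.map U)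
    (c : ℕ → ℝ≥0∞) (hc : ∑' k, c k ≤ 1)
    (hqc : ∀ k, ∀ F : 𝒰 → ℝ≥0∞, Measurable F →
      ∫⁻ v, F (Uk k v) * ENNReal.ofReal (q k v) ∂(μ.map V) ≤ c k * ∫⁻ u, F u ∂(μ.map U))
    (hint : Integrable (fun ω => - Real.log (q (K ω) (V ω))) μ) (C : ℝ)
    (hC : ∫ ω, - Real.log (q (K ω) (V ω)) ∂μ ≤ C * Real.log 2) :
    miBits μ U Y ≤ miBits μ V Y + ENNReal.ofReal C := by
  classical
  by_cases htop : miBits μ V Y = ⊤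
  · simp [htop]
  have hVY : Measurable (fun ω => (V ω, Y ω)) := hV.prodMk hY
  have hUY : Measurable (fun ω => (U ω, Y ω)) := hU.prodMk hY
  have : IsProbabilityMeasure (μ.map V) := Measure.isProbabilityMeasure_map hV.aemeasurable
  have : IsProbabilityMeasure (μ.map U) := Measure.isProbabilityMeasure_map hU.aemeasurable
  have : IsProbabilityMeasure (μ.map Y) := Measure.isProbabilityMeasure_map hY.aemeasurable
  have : IsProbabilityMeasure (μ.map (fun ω => (V ω, Y ω))) :=
    Measure.isProbabilityMeasure_map hVY.aemeasurable
  have : IsProbabilityMeasure (μ.map (fun ω => (U ω, Y ω))) :=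
    Measure.isProbabilityMeasure_map hUY.aemeasurable
  unfold miBits klBits at htop ⊢
  set N := μ.map (fun ω => (V ω, Y ω)) with hN
  set L := μ.map (fun ω => (U ω, Y ω)) with hL
  set NR := (μ.map V).prod (μ.map Y) with hNR
  set LR := (μ.map U).prod (μ.map Y) with hLR
  have hcond : N ≪ NR ∧ Integrable (fun x => Real.logb 2 (N.rnDeriv NR x).toReal) N := by
    by_contra hcon
    exact htop (if_neg hcon)
  obtain ⟨hNac, hNint⟩ := hcond
  have hUkm : ∀ k, Measurable (fun p : 𝒱 × 𝒴 => (Uk k p.1, p.2)) := fun k =>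
    ((hUk k).comp measurable_fst).prodMk measurable_snd
  -- absolute continuity
  have hLac : L ≪ LR := by
    refine Measure.AbsolutelyContinuous.mk fun B hB hB0 => ?_
    rw [hL, Measure.map_apply hUY hB]
    have hk : ∀ k, μ ((fun ω => (Uk k (V ω), Y ω)) ⁻¹' B) = 0 := by
      intro k
      have h1 : NR ((fun p : 𝒱 × 𝒴 => (Uk k p.1, p.2)) ⁻¹' B) = 0 := by
        rw [← Measure.map_apply (hUkm k) hB]
        have : NR.map (fun p : 𝒱 × 𝒴 => (Uk k p.1, p.2))
            = ((μ.map V).map (Uk k)).prod (μ.map Y) := by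
          have := Measure.map_prod_map (μ.map V) (μ.map Y) (hUk k) measurable_id
          rw [Measure.map_id] at this
          rw [this]; rfl
        rw [this]
        exact ((hac k).prod Measure.AbsolutelyContinuous.rfl) hB0
      have h2 := hNac h1
      rw [hN, Measure.map_apply hVY (hUkm k hB)] at h2
      exact h2
    have hun : μ (⋃ k, (fun ω => (Uk k (V ω), Y ω)) ⁻¹' B) = 0 := measure_iUnion_null hk
    refine measure_mono_null_ae ?_ hun
    filter_upwards [hUK] with ω hω hmem
    refine Set.mem_iUnion.2 ⟨K ω, ?_⟩
    change (Uk (K ω) (V ω), Y ω) ∈ B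
    rw [← hω]; exact hmem
  set h := L.rnDeriv LR with hh
  set J := N.rnDeriv NR with hJ
  have hhm : Measurable h := Measure.measurable_rnDeriv _ _
  have hJm : Measurable J := Measure.measurable_rnDeriv _ _
  have hqK : Measurable (fun ω => q (K ω) (V ω)) := by
    have : Measurable (fun p : ℕ × 𝒱 => q p.1 p.2) :=
      measurable_from_prod_countable_right (fun k => hq k)
    exact this.comp (hK.prodMk hV)
  -- key bound
  have hkey : ∫⁻ ω, h (U ω, Y ω) * ENNReal.ofReal (q (K ω) (V ω)) * (J (V ω, Y ω))⁻¹ ∂μ ≤ 1 := by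
    have hmk : ∀ k, Measurable (fun p : 𝒱 × 𝒴 => h (Uk k p.1, p.2) * ENNReal.ofReal (q k p.1)) :=
      fun k => (hhm.comp (hUkm k)).mul (((hq k).comp measurable_fst).ennreal_ofReal)
    calc ∫⁻ ω, h (U ω, Y ω) * ENNReal.ofReal (q (K ω) (V ω)) * (J (V ω, Y ω))⁻¹ ∂μ
        ≤ ∫⁻ ω, ∑' k, h (Uk k (V ω), Y ω) * ENNReal.ofReal (q k (V ω)) * (J (V ω, Y ω))⁻¹ ∂μ := by
          refine lintegral_mono_ae ?_
          filter_upwards [hUK] with ω hω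
          rw [hω]
          exact ENNReal.le_tsum (f := fun k => h (Uk k (V ω), Y ω) *
            ENNReal.ofReal (q k (V ω)) * (J (V ω, Y ω))⁻¹) (K ω)
      _ = ∑' k, ∫⁻ ω, h (Uk k (V ω), Y ω) * ENNReal.ofReal (q k (V ω)) * (J (V ω, Y ω))⁻¹ ∂μ := by
          refine lintegral_tsum fun k => ?_
          exact (((hmk k).mul hJm.inv).comp hVY).aemeasurable
      _ ≤ ∑' k, c k := by
          refine ENNReal.tsum_le_tsum fun k => ?_
          calc ∫⁻ ω, h (Uk k (V ω), Y ω) * ENNReal.ofReal (q k (V ω)) * (J (V ω, Y ω))⁻¹ ∂μ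
              = ∫⁻ p, (h (Uk k p.1, p.2) * ENNReal.ofReal (q k p.1)) * (J p)⁻¹ ∂N := by
                exact (lintegral_map (f := fun p : 𝒱 × 𝒴 =>
                  (h (Uk k p.1, p.2) * ENNReal.ofReal (q k p.1)) * (J p)⁻¹)
                  ((hmk k).mul hJm.inv) hVY).symm
            _ ≤ ∫⁻ p, h (Uk k p.1, p.2) * ENNReal.ofReal (q k p.1) ∂NR :=
                gp_lintegral_mul_inv_rnDeriv_le N NR hNac _ (hmk k)
            _ = ∫⁻ y, ∫⁻ v, h (Uk k v, y) * ENNReal.ofReal (q k v) ∂(μ.map V) ∂(μ.map Y) := by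
                rw [hNR, lintegral_prod_symm _ (hmk k).aemeasurable]
            _ ≤ ∫⁻ y, c k * ∫⁻ u, h (u, y) ∂(μ.map U) ∂(μ.map Y) := by
                refine lintegral_mono fun y => ?_
                exact hqc k (fun u => h (u, y)) (hhm.comp measurable_prodMk_right)
            _ = c k * ∫⁻ y, ∫⁻ u, h (u, y) ∂(μ.map U) ∂(μ.map Y) := by
                rw [lintegral_const_mul]
                exact hhm.lintegral_prod_left'
            _ = c k * ∫⁻ p, h p ∂LR := by
                rw [hLR, lintegral_prod_symm _ hhm.aemeasurable]
            _ ≤ c k * 1 := by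
                gcongr
                refine (Measure.lintegral_rnDeriv_le).trans ?_
                simp
            _ = c k := mul_one _
      _ ≤ 1 := hc
  have hkey2 : ∫⁻ ω, (h (U ω, Y ω))⁻¹ ∂μ ≤ 1 := by
    have := gp_lintegral_mul_inv_rnDeriv_le L LR hLac (fun _ => 1) measurable_const
    simp only [one_mul, lintegral_const, measure_univ] at this
    exact (lintegral_map (f := fun p => (h p)⁻¹) hhm.inv hUY).symm.trans_le this
  -- positivity facts
  have hhpos : ∀ᵐ ω ∂μ, 0 < h (U ω, Y ω) :=
    ae_of_ae_map hUY.aemeasurable (Measure.rnDeriv_pos hLac)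
  have hhfin : ∀ᵐ ω ∂μ, h (U ω, Y ω) < ⊤ :=
    ae_of_ae_map hUY.aemeasurable (hLac.ae_le (Measure.rnDeriv_lt_top L LR))
  have hJpos : ∀ᵐ ω ∂μ, 0 < J (V ω, Y ω) :=
    ae_of_ae_map hVY.aemeasurable (Measure.rnDeriv_pos hNac)
  have hJfin : ∀ᵐ ω ∂μ, J (V ω, Y ω) < ⊤ :=
    ae_of_ae_map hVY.aemeasurable (hNac.ae_le (Measure.rnDeriv_lt_top N NR))
  set Z : Ω → ℝ≥0∞ := fun ω => h (U ω, Y ω) * ENNReal.ofReal (q (K ω) (V ω)) * (J (V ω, Y ω))⁻¹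
    with hZ
  have hZm : Measurable Z := ((hhm.comp hUY).mul hqK.ennreal_ofReal).mul (hJm.comp hVY).inv
  have hZint : Integrable (fun ω => (Z ω).toReal) μ :=
    integrable_toReal_of_lintegral_ne_top hZm.aemeasurable
      (hkey.trans_lt ENNReal.one_lt_top).ne
  have hZle : ∫ ω, (Z ω).toReal ∂μ ≤ 1 := by
    rw [integral_toReal hZm.aemeasurable
      (ae_lt_top hZm (hkey.trans_lt ENNReal.one_lt_top).ne)]
    exact ENNReal.toReal_le_of_le_ofReal zero_le_one (by simpa using hkey)
  have hIint : Integrable (fun ω => ((h (U ω, Y ω))⁻¹).toReal) μ :=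
    integrable_toReal_of_lintegral_ne_top (hhm.comp hUY).inv.aemeasurable
      (hkey2.trans_lt ENNReal.one_lt_top).ne
  -- integrability of log J
  have hlog2 : 0 < Real.log 2 := Real.log_pos one_lt_two
  have hJlogm : Measurable (fun p => Real.logb 2 (J p).toReal) := by
    unfold Real.logb
    exact (Real.measurable_log.comp hJm.ennreal_toReal).div_const _
  have hhlogm : Measurable (fun p => Real.logb 2 (h p).toReal) := by
    unfold Real.logb
    exact (Real.measurable_log.comp hhm.ennreal_toReal).div_const _
  have hJint : Integrable (fun ω => Real.logb 2 (J (V ω, Y ω)).toReal) μ :=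
    (integrable_map_measure hJlogm.aestronglyMeasurable hVY.aemeasurable).1 hNint
  have hJint' : Integrable (fun ω => Real.log (J (V ω, Y ω)).toReal) μ := by
    refine (hJint.const_mul (Real.log 2)).congr (Filter.Eventually.of_forall fun ω => ?_)
    simp only [Real.logb]; field_simp
  have hle : ∀ᵐ ω ∂μ, Real.log (h (U ω, Y ω)).toReal ≤
      Real.log (J (V ω, Y ω)).toReal + (- Real.log (q (K ω) (V ω))) + ((Z ω).toReal - 1) := by
    filter_upwards [hhpos, hhfin, hJpos, hJfin] with ω h1 h2 h3 h4
    have a1 := ENNReal.toReal_pos h1.ne' h2.ne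
    have a3 := ENNReal.toReal_pos h3.ne' h4.ne
    have a5 := hqpos (K ω) (V ω)
    have hz : (Z ω).toReal = (h (U ω, Y ω)).toReal * q (K ω) (V ω) * ((J (V ω, Y ω)).toReal)⁻¹ := by
      simp only [hZ, ENNReal.toReal_mul, ENNReal.toReal_inv, ENNReal.toReal_ofReal a5.le]
    have hzl := Real.log_le_sub_one_of_pos (x := (Z ω).toReal) (by rw [hz]; positivity)
    have : Real.log (Z ω).toReal = Real.log (h (U ω, Y ω)).toReal + Real.log (q (K ω) (V ω))
        - Real.log (J (V ω, Y ω)).toReal := by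
      rw [hz, Real.log_mul (by positivity) (by positivity), Real.log_mul a1.ne' a5.ne',
        Real.log_inv]
      ring
    linarith
  have hge : ∀ᵐ ω ∂μ, 1 - ((h (U ω, Y ω))⁻¹).toReal ≤ Real.log (h (U ω, Y ω)).toReal := by
    filter_upwards [hhpos, hhfin] with ω h1 h2
    have a1 := ENNReal.toReal_pos h1.ne' h2.ne
    rw [ENNReal.toReal_inv]
    exact Real.one_sub_inv_le_log_of_pos a1
  have hBint : Integrable (fun ω => Real.log (J (V ω, Y ω)).toReal +
      (- Real.log (q (K ω) (V ω))) + ((Z ω).toReal - 1)) μ :=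
    (hJint'.add hint).add (hZint.sub (integrable_const 1))
  have hAint : Integrable (fun ω => 1 - ((h (U ω, Y ω))⁻¹).toReal) μ :=
    (integrable_const 1).sub hIint
  have hlogh : Integrable (fun ω => Real.log (h (U ω, Y ω)).toReal) μ := by
    refine (hAint.abs.add hBint.abs).mono'
      (Real.measurable_log.comp (hhm.comp hUY).ennreal_toReal).aestronglyMeasurable ?_
    filter_upwards [hle, hge] with ω h1 h2
    rw [Real.norm_eq_abs, abs_le]
    simp only [Pi.add_apply]
    constructor
    · have := neg_abs_le (1 - ((h (U ω, Y ω))⁻¹).toReal)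
      have := abs_nonneg (Real.log (J (V ω, Y ω)).toReal +
        (- Real.log (q (K ω) (V ω))) + ((Z ω).toReal - 1))
      linarith
    · have := le_abs_self (Real.log (J (V ω, Y ω)).toReal +
        (- Real.log (q (K ω) (V ω))) + ((Z ω).toReal - 1))
      have := abs_nonneg (1 - ((h (U ω, Y ω))⁻¹).toReal)
      linarith
  have hfinal : ∫ ω, Real.log (h (U ω, Y ω)).toReal ∂μ ≤
      ∫ ω, Real.log (J (V ω, Y ω)).toReal ∂μ + C * Real.log 2 := by
    have h1 := integral_mono_ae hlogh hBint hle
    have e1 : ∫ ω, (Real.log (J (V ω, Y ω)).toReal + (- Real.log (q (K ω) (V ω))) +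
        ((Z ω).toReal - 1)) ∂μ = ∫ ω, Real.log (J (V ω, Y ω)).toReal ∂μ
        + ∫ ω, (- Real.log (q (K ω) (V ω))) ∂μ + (∫ ω, (Z ω).toReal ∂μ - 1) := by
      have e2 := integral_add (hJint'.add hint) (hZint.sub (integrable_const 1))
      have e3 := integral_add hJint' hint
      have e4 := integral_sub hZint (integrable_const (1 : ℝ))
      simp only [Pi.add_apply, Pi.sub_apply] at e2
      rw [e2, e3, e4]
      simp
    rw [e1] at h1
    simp only [integral_neg] at h1
    simp only [integral_neg] at hC
    linarith
  have hLint : Integrable (fun p => Real.logb 2 (h p).toReal) L := by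
    rw [hL, integrable_map_measure hhlogm.aestronglyMeasurable hUY.aemeasurable]
    exact hlogh.div_const _
  rw [if_pos ⟨hLac, hLint⟩, if_pos ⟨hNac, hNint⟩]
  rw [hL, integral_map hUY.aemeasurable hhlogm.aestronglyMeasurable, hN,
    integral_map hVY.aemeasurable hJlogm.aestronglyMeasurable]
  refine le_trans ?_ ENNReal.ofReal_add_le
  apply ENNReal.ofReal_le_ofReal
  simp only [Real.logb, integral_div]
  rw [div_le_iff₀ hlog2, add_mul, div_mul_cancel₀ _ hlog2.ne']
  exact hfinal


lemma gp_find_ex {𝒳 : Type*} (A : ℕ → Set 𝒳) (v : ℕ → 𝒳) :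
    ∃ k, v k ∈ A k ∨ ∀ j, v j ∉ A j := by
  by_cases h : ∃ k, v k ∈ A k
  · exact h.imp fun k hk => Or.inl hk
  · push Not at h
    exact ⟨0, Or.inr h⟩

open Classical in
/-- First index `k` such that `v k ∈ A k` (and `0` if there is none). -/
def gpK {𝒳 : Type*} (A : ℕ → Set 𝒳) (v : ℕ → 𝒳) : ℕ := Nat.find (gp_find_ex A v)

lemma gpK_measurable {𝒮 𝒳 : Type*} [MeasurableSpace 𝒮] [MeasurableSpace 𝒳]
    (A : ℕ → Set (𝒮 × 𝒳)) (hA : ∀ k, MeasurableSet (A k)) :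
    Measurable (fun p : 𝒮 × (ℕ → 𝒳) => gpK (fun k => {x | (p.1, x) ∈ A k}) p.2) := by
  classical
  have hm : ∀ k, MeasurableSet {p : 𝒮 × (ℕ → 𝒳) | (p.1, p.2 k) ∈ A k} := fun k => by
    have : Measurable (fun p : 𝒮 × (ℕ → 𝒳) => (p.1, p.2 k)) :=
      measurable_fst.prodMk ((measurable_pi_apply k).comp measurable_snd)
    exact this (hA k)
  refine measurable_find (p := fun (p : 𝒮 × (ℕ → 𝒳)) k =>
    p.2 k ∈ {x | (p.1, x) ∈ A k} ∨ ∀ j, p.2 j ∉ {x | (p.1, x) ∈ A j})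
    (fun p => gp_find_ex (fun k => {x | (p.1, x) ∈ A k}) p.2) fun k => ?_
  have he : {p : 𝒮 × (ℕ → 𝒳) | ∀ j, p.2 j ∉ {x | (p.1, x) ∈ A j}} =
      ⋂ j, {p : 𝒮 × (ℕ → 𝒳) | (p.1, p.2 j) ∈ A j}ᶜ := by
    ext p; simp
  have h3 : MeasurableSet {p : 𝒮 × (ℕ → 𝒳) | ∀ j, p.2 j ∉ {x | (p.1, x) ∈ A j}} := by
    rw [he]
    exact MeasurableSet.iInter fun j => (hm j).compl
  exact (hm k).union h3

lemma gpK_eq {𝒳 : Type*} (A : ℕ → Set 𝒳) (v : ℕ → 𝒳) (k : ℕ)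
    (h1 : ∀ j < k, v j ∉ A j) (h2 : v k ∈ A k) : gpK A v = k := by
  classical
  unfold gpK
  rw [Nat.find_eq_iff]
  refine ⟨Or.inl h2, fun n hn => ?_⟩
  push Not
  exact ⟨h1 n hn, k, h2⟩

lemma gp_seq {𝒳 : Type*} [MeasurableSpace 𝒳] (ρ : Measure 𝒳) [IsProbabilityMeasure ρ]
    (A : ℕ → Set 𝒳) (hA : ∀ k, MeasurableSet (A k))
    (hlim : Filter.Tendsto (fun n => ∏ j ∈ Finset.range n, ρ (A j)ᶜ) Filter.atTop (nhds 0))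
    (F : ℕ → 𝒳 → ℝ≥0∞) (hF : ∀ k, Measurable (F k)) :
    ∫⁻ v, F (gpK A v) (v (gpK A v)) ∂(Measure.infinitePi fun _ : ℕ => ρ) =
      ∑' k, (∏ j ∈ Finset.range k, ρ (A j)ᶜ) * ∫⁻ x in A k, F k x ∂ρ := by
  classical
  set Q := Measure.infinitePi fun _ : ℕ => ρ with hQ
  let E : ℕ → Set (ℕ → 𝒳) := fun k => {v | (∀ j < k, v j ∉ A j) ∧ v k ∈ A k}
  have hpre : ∀ k, ∀ B, MeasurableSet B →
      Q ((fun v : ℕ → 𝒳 => v k) ⁻¹' B ∩ E k) =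
        (∏ j ∈ Finset.range k, ρ (A j)ᶜ) * ρ (B ∩ A k) := by
    intro k B hB
    let t : ℕ → Set 𝒳 := fun j => if j = k then B ∩ A k else (A j)ᶜ
    have ht : ∀ j, MeasurableSet (t j) := by
      intro j
      by_cases hj : j = k
      · simp only [t, hj, if_true]; exact hB.inter (hA k)
      · simp only [t, hj, if_false]; exact (hA j).compl
    have he : (fun v : ℕ → 𝒳 => v k) ⁻¹' B ∩ E k =
        Set.pi (Finset.range (k + 1) : Finset ℕ) t := by
      ext v
      simp only [Set.mem_inter_iff, Set.mem_preimage, E, Set.mem_ofPred_eq, Set.mem_pi,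
        Finset.coe_range, Set.mem_Iio, t]
      constructor
      · rintro ⟨h1, h2, h3⟩ j hj
        by_cases hjk : j = k
        · subst hjk; simp [h1, h3]
        · simp only [hjk, if_false]; exact h2 j (by omega)
      · intro h
        have hk := h k (by omega)
        simp only [if_true] at hk
        refine ⟨hk.1, fun j hj => ?_, hk.2⟩
        have := h j (by omega)
        simpa [hj.ne] using this
    rw [he, hQ, Measure.infinitePi_pi _ (fun i _ => ht i), Finset.prod_range_succ]
    congr 1
    · refine Finset.prod_congr rfl fun j hj => ?_
      have : j ≠ k := (Finset.mem_range.1 hj).ne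
      simp [t, this]
    · simp [t]
  have hEm : ∀ k, MeasurableSet (E k) := by
    intro k
    have : E k = (⋂ j, ⋂ (_ : j < k), (fun v : ℕ → 𝒳 => v j) ⁻¹' (A j)ᶜ) ∩
        (fun v : ℕ → 𝒳 => v k) ⁻¹' A k := by
      ext v; simp [E]
    rw [this]
    refine MeasurableSet.inter ?_ (measurable_pi_apply k (hA k))
    exact MeasurableSet.iInter fun j => MeasurableSet.iInter fun _ =>
      measurable_pi_apply j (hA j).compl
  have hdisj : Pairwise (Function.onFun Disjoint E) := by
    intro i j hij
    refine Set.disjoint_left.2 fun v hi hj => ?_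
    rcases lt_or_gt_of_ne hij with h | h
    · exact hj.1 i h hi.2
    · exact hi.1 j h hj.2
  have hnull : Q (⋃ k, E k)ᶜ = 0 := by
    have hle : ∀ n, Q (⋃ k, E k)ᶜ ≤ ∏ j ∈ Finset.range n, ρ (A j)ᶜ := by
      intro n
      have hs : (⋃ k, E k)ᶜ ⊆ Set.pi (Finset.range n : Finset ℕ) (fun j => (A j)ᶜ) := by
        intro v hv j _
        by_contra hcon
        have hcon : v j ∈ A j := by simpa using hcon
        have hex : ∃ k, v k ∈ A k := ⟨j, hcon⟩
        apply hv
        refine Set.mem_iUnion.2 ⟨Nat.find hex, fun i hi => Nat.find_min hex hi, Nat.find_spec hex⟩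
      refine (measure_mono hs).trans ?_
      rw [hQ, Measure.infinitePi_pi _ (fun i _ => (hA i).compl)]
    exact le_antisymm (ge_of_tendsto' hlim hle) bot_le
  have hae : (⋃ k, E k) =ᵐ[Q] Set.univ := by
    rw [ae_eq_univ]; exact hnull
  rw [← setLIntegral_univ, ← setLIntegral_congr hae, lintegral_iUnion hEm hdisj]
  refine tsum_congr fun k => ?_
  have h1 : ∫⁻ v in E k, F (gpK A v) (v (gpK A v)) ∂Q = ∫⁻ v in E k, F k (v k) ∂Q := by
    refine setLIntegral_congr_fun (hEm k) fun v hv => ?_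
    simp only [gpK_eq A v k hv.1 hv.2]
  have h2 : (Q.restrict (E k)).map (fun v : ℕ → 𝒳 => v k) =
      (∏ j ∈ Finset.range k, ρ (A j)ᶜ) • ρ.restrict (A k) := by
    ext B hB
    rw [Measure.map_apply (measurable_pi_apply k) hB,
      Measure.restrict_apply (measurable_pi_apply k hB), hpre k B hB]
    simp [Measure.restrict_apply hB]
  rw [h1, ← lintegral_map (hF k) (measurable_pi_apply k), h2, lintegral_smul_measure, smul_eq_mul]


/-- Residual mass above level `x`. -/
def gpW {𝒳 : Type*} [MeasurableSpace 𝒳] (P : Measure 𝒳) (r : 𝒳 → ℝ) (x : ℝ) : ℝ≥0∞ :=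
  ∫⁻ u, ENNReal.ofReal (r u - x) ∂P

/-- Levels of the greedy rejection sampler. -/
def gpL {𝒳 : Type*} [MeasurableSpace 𝒳] (P : Measure 𝒳) (r : 𝒳 → ℝ) : ℕ → ℝ
  | 0 => 0
  | k + 1 => gpL P r k + (gpW P r (gpL P r k)).toReal

/-- Acceptance regions of the greedy rejection sampler. -/
def gpA {𝒳 : Type*} [MeasurableSpace 𝒳] (P : Measure 𝒳) (r : 𝒳 → ℝ) (k : ℕ) : Set (𝒳 × ℝ) :=
  {p | gpL P r k + p.2 * (gpW P r (gpL P r k)).toReal < r p.1}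

/-- The uniform law on `(0,1]`. -/
def gpT : Measure ℝ := (volume : Measure ℝ).restrict (Set.Ioc 0 1)

instance gpT_prob : IsProbabilityMeasure gpT := ⟨by simp [gpT]⟩

lemma gp_cov (a w : ℝ) (hw : 0 ≤ w) (F : ℝ → ℝ≥0∞) :
    ENNReal.ofReal w * ∫⁻ t, F (a + t * w) ∂gpT = ∫⁻ y in Set.Ioc a (a + w), F y := by
  rcases hw.eq_or_lt with h | h
  · subst h; simp
  have himg : (fun t : ℝ => a + t * w) '' Set.Ioc 0 1 = Set.Ioc a (a + w) := by
    ext y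
    simp only [Set.mem_image, Set.mem_Ioc]
    constructor
    · rintro ⟨t, ⟨h1, h2⟩, rfl⟩
      constructor <;> nlinarith
    · rintro ⟨h1, h2⟩
      refine ⟨(y - a) / w, ⟨by apply div_pos <;> linarith, ?_⟩, by field_simp; ring⟩
      rw [div_le_one h]; linarith
  rw [← himg, lintegral_image_eq_lintegral_abs_deriv_mul measurableSet_Ioc
    (f' := fun _ => w) (fun x _ => ?_) (fun x _ y _ hxy => ?_)]
  · rw [abs_of_pos h, lintegral_const_mul' _ _ ENNReal.ofReal_ne_top]; rfl
  · have := ((hasDerivAt_id x).mul_const w).const_add a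
    simpa using this.hasDerivWithinAt
  · simp at hxy
    rcases hxy with h' | h'
    · exact h'
    · exact absurd h' h.ne'

lemma gp_vol (a b c : ℝ) (hab : a ≤ b) :
    (∫⁻ y in Set.Ioc a b, (Set.Iio c).indicator (fun _ => (1 : ℝ≥0∞)) y) + ENNReal.ofReal (c - b)
      = ENNReal.ofReal (c - a) := by
  rw [lintegral_indicator measurableSet_Iio, lintegral_const, one_mul,
    Measure.restrict_apply MeasurableSet.univ, Set.univ_inter,
    Measure.restrict_apply measurableSet_Iio]
  rcases le_total c a with h | h
  · have : Set.Iio c ∩ Set.Ioc a b = ∅ := by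
      ext y; simp only [Set.mem_inter_iff, Set.mem_Iio, Set.mem_Ioc, Set.mem_empty_iff_false,
        iff_false]
      intro hy; linarith [hy.1, hy.2.1]
    rw [this, ENNReal.ofReal_of_nonpos (by linarith : c - b ≤ 0),
      ENNReal.ofReal_of_nonpos (by linarith : c - a ≤ 0)]
    simp
  · rcases le_or_gt c b with h2 | h2
    · have : Set.Iio c ∩ Set.Ioc a b = Set.Ioo a c := by
        ext y; simp only [Set.mem_inter_iff, Set.mem_Iio, Set.mem_Ioc, Set.mem_Ioo]
        constructor
        · intro hy; exact ⟨hy.2.1, hy.1⟩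
        · intro hy; exact ⟨hy.2, hy.1, by linarith [hy.2]⟩
      rw [this, Real.volume_Ioo, ENNReal.ofReal_of_nonpos (by linarith : c - b ≤ 0), add_zero]
    · have : Set.Iio c ∩ Set.Ioc a b = Set.Ioc a b := by
        apply Set.inter_eq_right.2
        intro y hy; exact lt_of_le_of_lt hy.2 h2
      rw [this, Real.volume_Ioc, ← ENNReal.ofReal_add (by linarith) (by linarith)]
      congr 1; ring

set_option linter.unusedSectionVars false

section sampler
variable {𝒳 : Type*} [MeasurableSpace 𝒳] (P : Measure 𝒳) [IsProbabilityMeasure P] (r : 𝒳 → ℝ)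

lemma gpA_meas (hr : Measurable r) (k : ℕ) : MeasurableSet (gpA P r k) := by
  unfold gpA
  exact measurableSet_lt (by fun_prop) (by fun_prop)

lemma gpL_mono (k : ℕ) : gpL P r k ≤ gpL P r (k + 1) := by
  simp only [gpL]; linarith [ENNReal.toReal_nonneg (a := gpW P r (gpL P r k))]

lemma gpL_monotone : Monotone (gpL P r) := monotone_nat_of_le_succ (gpL_mono P r)

lemma gpL_nonneg (k : ℕ) : 0 ≤ gpL P r k := gpL_monotone P r (Nat.zero_le k)

lemma gpW_anti {x y : ℝ} (h : x ≤ y) : gpW P r y ≤ gpW P r x :=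
  lintegral_mono fun _ => ENNReal.ofReal_le_ofReal (by linarith)


lemma gpW_zero (h1 : ∫⁻ u, ENNReal.ofReal (r u) ∂P = 1)
    : gpW P r 0 = 1 := by simp [gpW, h1]

lemma gpW_le (h1 : ∫⁻ u, ENNReal.ofReal (r u) ∂P = 1)
    (k : ℕ) : gpW P r (gpL P r k) ≤ 1 :=
  (gpW_anti P r (gpL_nonneg P r k)).trans_eq (gpW_zero P r h1)

lemma gpW_ne_top (h1 : ∫⁻ u, ENNReal.ofReal (r u) ∂P = 1)
    (k : ℕ) : gpW P r (gpL P r k) ≠ ⊤ :=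
  ((gpW_le P r h1 k).trans_lt ENNReal.one_lt_top).ne

lemma gp_accept_integral (h1 : ∫⁻ u, ENNReal.ofReal (r u) ∂P = 1)
    (hr : Measurable r) (k : ℕ) (G : 𝒳 → ℝ → ℝ≥0∞)
    (hG : Measurable (Function.uncurry G)) :
    gpW P r (gpL P r k) * ∫⁻ p in gpA P r k,
        G p.1 (gpL P r k + p.2 * (gpW P r (gpL P r k)).toReal) ∂(P.prod gpT) =
      ∫⁻ u, ∫⁻ y in Set.Ioc (gpL P r k) (gpL P r (k + 1)),
        (Set.Iio (r u)).indicator (G u) y ∂volume ∂P := by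
  set a := gpL P r k with ha
  set w := (gpW P r a).toReal with hw
  have hwE : gpW P r a = ENNReal.ofReal w :=
    (ENNReal.ofReal_toReal (gpW_ne_top P r h1 k)).symm
  have hstep : gpL P r (k + 1) = a + w := rfl
  have hind : Measurable (fun p : 𝒳 × ℝ => (gpA P r k).indicator
      (fun p => G p.1 (a + p.2 * w)) p) := by
    refine Measurable.indicator ?_ (gpA_meas P r hr k)
    have hm2 : Measurable (fun p : 𝒳 × ℝ => (p.1, a + p.2 * w)) := by fun_prop
    exact hG.comp hm2
  rw [← lintegral_indicator (gpA_meas P r hr k), lintegral_prod _ hind.aemeasurable, hstep, hwE,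
    ← lintegral_const_mul' _ _ ENNReal.ofReal_ne_top]
  refine lintegral_congr fun u => ?_
  rw [← gp_cov a w ENNReal.toReal_nonneg]
  congr 1

lemma gp_accept_prob (h1 : ∫⁻ u, ENNReal.ofReal (r u) ∂P = 1)
    (hr : Measurable r) (k : ℕ) :
    gpW P r (gpL P r k) * (P.prod gpT) (gpA P r k) + gpW P r (gpL P r (k + 1))
      = gpW P r (gpL P r k) := by
  have h := gp_accept_integral P r h1 hr k (fun _ _ => 1) measurable_const
  simp only [lintegral_const, one_mul, Measure.restrict_apply MeasurableSet.univ,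
    Set.univ_inter] at h
  rw [h]
  conv_lhs => rw [gpW.eq_def _ _ (gpL P r (k + 1))]
  rw [← lintegral_add_right _ (by fun_prop)]
  conv_rhs => rw [gpW.eq_def]
  refine lintegral_congr fun u => ?_
  exact gp_vol _ _ _ (gpL_mono P r k)

lemma gp_reject_prob (h1 : ∫⁻ u, ENNReal.ofReal (r u) ∂P = 1)
    (hr : Measurable r) (k : ℕ) :
    gpW P r (gpL P r k) * (P.prod gpT) (gpA P r k)ᶜ = gpW P r (gpL P r (k + 1)) := by
  have h := gp_accept_prob P r h1 hr k
  have h2 : gpW P r (gpL P r k) * (P.prod gpT) (gpA P r k) +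
      gpW P r (gpL P r k) * (P.prod gpT) (gpA P r k)ᶜ = gpW P r (gpL P r k) := by
    rw [← mul_add, measure_add_measure_compl (gpA_meas P r hr k), measure_univ, mul_one]
  have h3 := h2.trans h.symm
  refine (ENNReal.add_right_inj ?_).1 h3
  exact ENNReal.mul_ne_top (gpW_ne_top P r h1 k) (measure_ne_top _ _)

lemma gp_prod_eq (h1 : ∫⁻ u, ENNReal.ofReal (r u) ∂P = 1)
    (hr : Measurable r) (k : ℕ) :
    ∏ j ∈ Finset.range k, (P.prod gpT) (gpA P r j)ᶜ = gpW P r (gpL P r k) := by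
  induction k with
  | zero => simp [gpL, gpW_zero P r h1]
  | succ k ih => rw [Finset.prod_range_succ, ih, gp_reject_prob P r h1 hr]

lemma gpL_ge (h1 : ∫⁻ u, ENNReal.ofReal (r u) ∂P = 1)
    (k : ℕ) : k * (gpW P r (gpL P r k)).toReal ≤ gpL P r k := by
  induction k with
  | zero => simp [gpL]
  | succ k ih =>
    have h2 : (gpW P r (gpL P r (k + 1))).toReal ≤ (gpW P r (gpL P r k)).toReal :=
      ENNReal.toReal_mono (gpW_ne_top P r h1 k) (gpW_anti P r (gpL_mono P r k))
    have h3 : gpL P r (k + 1) = gpL P r k + (gpW P r (gpL P r k)).toReal := rfl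
    rw [h3]
    push_cast
    have : (k : ℝ) * (gpW P r (gpL P r (k + 1))).toReal ≤ k * (gpW P r (gpL P r k)).toReal := by
      gcongr
    rw [h3] at this h2
    linarith

lemma gpW_tendsto (h1 : ∫⁻ u, ENNReal.ofReal (r u) ∂P = 1)
    (hr : Measurable r) :
    Filter.Tendsto (fun k => gpW P r (gpL P r k)) Filter.atTop (nhds 0) := by
  have hanti : Antitone (fun k => gpW P r (gpL P r k)) := fun i j hij =>
    gpW_anti P r (gpL_monotone P r hij)
  have hlim := tendsto_atTop_iInf hanti
  by_contra hcon
  have hpos : (⨅ k, gpW P r (gpL P r k)) ≠ 0 := fun h => hcon (h ▸ hlim)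
  set ℓ := (⨅ k, gpW P r (gpL P r k)) with hℓ
  have hℓtop : ℓ ≠ ⊤ := ((iInf_le (fun k => gpW P r (gpL P r k)) 0).trans_lt (gpW_ne_top P r h1 0).lt_top).ne
  have hge : ∀ k : ℕ, k * ℓ.toReal ≤ gpL P r k := fun k =>
    le_trans (mul_le_mul_of_nonneg_left
      (ENNReal.toReal_mono (gpW_ne_top P r h1 k) (iInf_le _ k)) (Nat.cast_nonneg k))
      (gpL_ge P r h1 k)
  have hinf : Filter.Tendsto (gpL P r) Filter.atTop Filter.atTop := by
    refine Filter.tendsto_atTop_mono hge ?_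
    exact tendsto_natCast_atTop_atTop.atTop_mul_const (ENNReal.toReal_pos hpos hℓtop)
  apply hcon
  have := tendsto_lintegral_of_dominated_convergence (μ := P)
    (F := fun k u => ENNReal.ofReal (r u - gpL P r k)) (f := fun _ => 0)
    (fun u => ENNReal.ofReal (r u)) (fun n => by fun_prop)
    (fun n => Filter.Eventually.of_forall fun u =>
      ENNReal.ofReal_le_ofReal (by linarith [gpL_nonneg P r n])) (by simp [h1])
    (Filter.Eventually.of_forall fun u => ?_)
  · simpa [gpW] using this
  · refine tendsto_const_nhds.congr' ?_
    filter_upwards [hinf.eventually_ge_atTop (r u)] with n hn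
    rw [ENNReal.ofReal_of_nonpos (by linarith)]

lemma gp_exhaust (h1 : ∫⁻ u, ENNReal.ofReal (r u) ∂P = 1)
    (hr : Measurable r) : ∀ᵐ u ∂P, ∀ y < r u, ∃ k, y < gpL P r k := by
  have h0 : ∫⁻ u, ⨅ k, ENNReal.ofReal (r u - gpL P r k) ∂P = 0 := by
    refine le_antisymm (ge_of_tendsto' (gpW_tendsto P r h1 hr) fun k => ?_) bot_le
    exact lintegral_mono fun u => iInf_le _ k
  rw [lintegral_eq_zero_iff (Measurable.iInf fun k => by fun_prop)] at h0
  filter_upwards [h0] with u hu y hy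
  by_contra hcon
  push Not at hcon
  have : ENNReal.ofReal (r u - y) ≤ ⨅ k, ENNReal.ofReal (r u - gpL P r k) :=
    le_iInf fun k => ENNReal.ofReal_le_ofReal (by linarith [hcon k])
  rw [hu] at this
  simp only [Pi.zero_apply, nonpos_iff_eq_zero, ENNReal.ofReal_eq_zero] at this
  linarith

lemma gp_sum_integral (h1 : ∫⁻ u, ENNReal.ofReal (r u) ∂P = 1)
    (hr : Measurable r) (G : 𝒳 → ℝ → ℝ≥0∞)
    (hG : Measurable (Function.uncurry G)) :
    ∑' k, gpW P r (gpL P r k) * ∫⁻ p in gpA P r k,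
        G p.1 (gpL P r k + p.2 * (gpW P r (gpL P r k)).toReal) ∂(P.prod gpT) =
      ∫⁻ u, ∫⁻ y in Set.Ioo 0 (r u), G u y ∂volume ∂P := by
  have hGu : ∀ u, Measurable (G u) := fun u => hG.comp measurable_prodMk_left
  simp_rw [gp_accept_integral P r h1 hr _ G hG]
  have hmeas : Measurable (fun p : 𝒳 × ℝ => (Set.Iio (r p.1)).indicator (G p.1) p.2) := by
    have : (fun p : 𝒳 × ℝ => (Set.Iio (r p.1)).indicator (G p.1) p.2) =
        {p : 𝒳 × ℝ | p.2 < r p.1}.indicator (fun p => G p.1 p.2) := by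
      ext p
      by_cases hp : p.2 < r p.1
      · rw [Set.indicator_of_mem (by exact hp), Set.indicator_of_mem (by exact hp)]
      · rw [Set.indicator_of_notMem (by exact hp), Set.indicator_of_notMem (by exact hp)]
    rw [this]
    exact Measurable.indicator hG (measurableSet_lt (by fun_prop) (by fun_prop))
  rw [← lintegral_tsum fun k => (Measurable.lintegral_prod_right' hmeas).aemeasurable]
  refine lintegral_congr_ae ?_
  filter_upwards [gp_exhaust P r h1 hr] with u hu
  rw [← lintegral_iUnion (fun k => measurableSet_Ioc)]
  · rw [lintegral_indicator measurableSet_Iio, Measure.restrict_restrict measurableSet_Iio]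
    congr 2
    ext y
    simp only [Set.mem_inter_iff, Set.mem_Iio, Set.mem_iUnion, Set.mem_Ioc, Set.mem_Ioo]
    constructor
    · rintro ⟨h2, k, h3, _⟩
      exact ⟨lt_of_le_of_lt (gpL_nonneg P r k) h3, h2⟩
    · rintro ⟨h2, h3⟩
      refine ⟨h3, ?_⟩
      classical
      have hex : ∃ k, y ≤ gpL P r k := (hu y h3).imp fun k hk => hk.le
      have hne : Nat.find hex ≠ 0 := by
        intro h
        have := Nat.find_spec hex
        rw [h] at this
        simp only [gpL] at this
        linarith
      obtain ⟨m, hm⟩ := Nat.exists_eq_succ_of_ne_zero hne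
      refine ⟨m, ?_, ?_⟩
      · have := Nat.find_min hex (m := m) (by omega)
        linarith [not_le.1 this]
      · have := Nat.find_spec hex
        rwa [hm] at this
  · exact (gpL_monotone P r).pairwise_disjoint_on_Ioc_succ

lemma gp_sampler (h1 : ∫⁻ u, ENNReal.ofReal (r u) ∂P = 1)
    (hr : Measurable r) (F : ℕ → 𝒳 × ℝ → ℝ≥0∞) (hF : ∀ k, Measurable (F k)) :
    ∫⁻ v, F (gpK (gpA P r) v) (v (gpK (gpA P r) v))
        ∂(Measure.infinitePi fun _ : ℕ => P.prod gpT) =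
      ∑' k, gpW P r (gpL P r k) * ∫⁻ x in gpA P r k, F k x ∂(P.prod gpT) := by
  rw [gp_seq (P.prod gpT) (gpA P r) (gpA_meas P r hr) _ F hF]
  · simp_rw [gp_prod_eq P r h1 hr]
  · simp_rw [gp_prod_eq P r h1 hr]
    exact gpW_tendsto P r h1 hr

lemma gp_sampler_law (h1 : ∫⁻ u, ENNReal.ofReal (r u) ∂P = 1)
    (hr : Measurable r) (f : 𝒳 → ℝ≥0∞) (hf : Measurable f) :
    ∫⁻ v, f (v (gpK (gpA P r) v)).1 ∂(Measure.infinitePi fun _ : ℕ => P.prod gpT) =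
      ∫⁻ u, f u * ENNReal.ofReal (r u) ∂P := by
  rw [gp_sampler P r h1 hr (fun _ p => f p.1) (fun _ => hf.comp measurable_fst)]
  rw [gp_sum_integral P r h1 hr (fun u _ => f u) (hf.comp measurable_fst)]
  simp

end sampler


lemma gp_int_log (c : ℝ) (hc : 0 ≤ c) :
    ∫⁻ y in Set.Ioo 0 c, ENNReal.ofReal (Real.log (1 + y)) =
      ENNReal.ofReal ((1 + c) * Real.log (1 + c) - c) := by
  have hcont : ContinuousOn (fun y : ℝ => Real.log (1 + y)) (Set.uIcc 0 c) := by
    refine ContinuousOn.log (by fun_prop) fun x hx => ?_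
    rw [Set.uIcc_of_le hc] at hx
    linarith [hx.1]
  have hint : IntervalIntegrable (fun y : ℝ => Real.log (1 + y)) volume 0 c :=
    hcont.intervalIntegrable
  have h2 : ∫ y in (0 : ℝ)..c, Real.log (1 + y) = (1 + c) * Real.log (1 + c) - c := by
    rw [intervalIntegral.integral_eq_sub_of_hasDerivAt
      (f := fun y => (1 + y) * Real.log (1 + y) - y) (fun x hx => ?_) hint]
    · simp
    · rw [Set.uIcc_of_le hc] at hx
      have hx1 : (1 : ℝ) + x ≠ 0 := by linarith [hx.1]
      have ha : HasDerivAt (fun y : ℝ => 1 + y) 1 x := by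
        simpa using (hasDerivAt_id x).const_add (1 : ℝ)
      have hb := (ha.mul (ha.log hx1)).sub (hasDerivAt_id x)
      exact hb.congr_deriv (by field_simp; ring)
  rw [← h2, intervalIntegral.integral_of_le hc, ← restrict_Ioo_eq_restrict_Ioc,
    ofReal_integral_eq_lintegral_ofReal]
  · exact ((intervalIntegrable_iff_integrableOn_Ioc_of_le hc).1 hint).mono_set
      Set.Ioo_subset_Ioc_self
  · refine (ae_restrict_iff' measurableSet_Ioo).2 (Filter.Eventually.of_forall fun y hy => ?_)
    exact Real.log_nonneg (by linarith [hy.1])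

/-- `x - x log x` -/
lemma gp_tele (a b : ℝ) (hb : 0 ≤ b) (hab : b ≤ a) :
    (a - b) * (-Real.log a) ≤ (a - a * Real.log a) - (b - b * Real.log b) := by
  rcases hb.eq_or_lt with h | h
  · subst h; simp; linarith
  · have ha : 0 < a := lt_of_lt_of_le h hab
    have h1 := Real.log_le_sub_one_of_pos (div_pos ha h)
    rw [Real.log_div ha.ne' h.ne'] at h1
    have h2 : b * (Real.log a - Real.log b) ≤ b * (a / b - 1) :=
      mul_le_mul_of_nonneg_left h1 h.le
    have h3 : b * (a / b - 1) = a - b := by field_simp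
    linarith

section sampler2
variable {𝒳 : Type*} [MeasurableSpace 𝒳] (P : Measure 𝒳) [IsProbabilityMeasure P] (r : 𝒳 → ℝ)

lemma gp_sum_w (h1 : ∫⁻ u, ENNReal.ofReal (r u) ∂P = 1) (hr : Measurable r) :
    ∑' k, gpW P r (gpL P r k) * ((P.prod gpT) (gpA P r k) *
      ENNReal.ofReal (-Real.log (gpW P r (gpL P r k)).toReal)) ≤ 1 := by
  set w : ℕ → ℝ := fun k => (gpW P r (gpL P r k)).toReal with hw
  have hw0 : ∀ k, 0 ≤ w k := fun k => ENNReal.toReal_nonneg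
  have hw1 : ∀ k, w k ≤ 1 := fun k =>
    ENNReal.toReal_le_of_le_ofReal zero_le_one (by simpa using gpW_le P r h1 k)
  have hwanti : ∀ k, w (k + 1) ≤ w k := fun k =>
    ENNReal.toReal_mono (gpW_ne_top P r h1 k) (gpW_anti P r (gpL_mono P r k))
  have hterm : ∀ k, gpW P r (gpL P r k) * ((P.prod gpT) (gpA P r k) *
      ENNReal.ofReal (-Real.log (gpW P r (gpL P r k)).toReal)) =
      ENNReal.ofReal ((w k - w (k + 1)) * (-Real.log (w k))) := by
    intro k
    have ha := gp_accept_prob P r h1 hr k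
    have : gpW P r (gpL P r k) * (P.prod gpT) (gpA P r k) = ENNReal.ofReal (w k - w (k + 1)) := by
      rw [ENNReal.ofReal_sub _ (hw0 _), ENNReal.ofReal_toReal (gpW_ne_top P r h1 k),
        ENNReal.ofReal_toReal (gpW_ne_top P r h1 (k + 1))]
      exact ENNReal.eq_sub_of_add_eq (gpW_ne_top P r h1 (k + 1)) ha
    rw [← mul_assoc, this, ENNReal.ofReal_mul (by linarith [hwanti k])]
  simp_rw [hterm]
  refine ENNReal.tsum_le_of_sum_range_le fun n => ?_
  have hnn : ∀ k, 0 ≤ (w k - w (k + 1)) * (-Real.log (w k)) := fun k =>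
    mul_nonneg (by linarith [hwanti k]) (by linarith [Real.log_nonpos (hw0 k) (hw1 k)])
  rw [← ENNReal.ofReal_sum_of_nonneg (fun k _ => hnn k)]
  refine ENNReal.ofReal_le_one.2 ?_
  have hs : ∑ k ∈ Finset.range n, (w k - w (k + 1)) * (-Real.log (w k)) ≤
      (w 0 - w 0 * Real.log (w 0)) - (w n - w n * Real.log (w n)) := by
    rw [← Finset.sum_range_sub' (fun k => w k - w k * Real.log (w k))]
    exact Finset.sum_le_sum fun k _ => gp_tele _ _ (hw0 _) (hwanti k)
  have hw00 : w 0 = 1 := by simp [hw, gpL, gpW_zero P r h1]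
  rw [hw00] at hs
  simp only [Real.log_one, mul_zero, sub_zero] at hs
  have : w n * Real.log (w n) ≤ 0 :=
    mul_nonpos_of_nonneg_of_nonpos (hw0 n) (Real.log_nonpos (hw0 n) (hw1 n))
  linarith [hw0 n]

lemma gp_sampler_cost (h1 : ∫⁻ u, ENNReal.ofReal (r u) ∂P = 1) (hr : Measurable r)
    (hr0 : ∀ u, 0 ≤ r u) :
    ∫⁻ v, ENNReal.ofReal (Real.log (1 + (gpK (gpA P r) v : ℝ) + |(v (gpK (gpA P r) v)).2|))
        ∂(Measure.infinitePi fun _ : ℕ => P.prod gpT) ≤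
      ∫⁻ u, ENNReal.ofReal ((1 + r u) * Real.log (1 + r u)) ∂P := by
  have hm : ∀ k : ℕ, Measurable (fun p : 𝒳 × ℝ => ENNReal.ofReal (Real.log (1 + (k : ℝ) + |p.2|))) :=
    fun k => by fun_prop
  rw [gp_sampler P r h1 hr
    (fun k p => ENNReal.ofReal (Real.log (1 + (k : ℝ) + |p.2|))) hm]
  set w : ℕ → ℝ := fun k => (gpW P r (gpL P r k)).toReal with hw
  have hw0 : ∀ k, 0 ≤ w k := fun k => ENNReal.toReal_nonneg
  have hw1 : ∀ k, w k ≤ 1 := fun k =>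
    ENNReal.toReal_le_of_le_ofReal zero_le_one (by simpa using gpW_le P r h1 k)
  have hterm : ∀ k, gpW P r (gpL P r k) * ∫⁻ p in gpA P r k,
      ENNReal.ofReal (Real.log (1 + (k : ℝ) + |p.2|)) ∂(P.prod gpT) ≤
      gpW P r (gpL P r k) * ∫⁻ p in gpA P r k,
        ENNReal.ofReal (Real.log (1 + (gpL P r k + p.2 * (gpW P r (gpL P r k)).toReal)))
          ∂(P.prod gpT) +
      gpW P r (gpL P r k) * ((P.prod gpT) (gpA P r k) *
        ENNReal.ofReal (-Real.log (gpW P r (gpL P r k)).toReal)) := by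
    intro k
    by_cases hz : gpW P r (gpL P r k) = 0
    · simp [hz]
    have hwpos : 0 < w k := ENNReal.toReal_pos hz (gpW_ne_top P r h1 k)
    rw [← mul_add]
    gcongr
    rw [mul_comm ((P.prod gpT) (gpA P r k)), ← setLIntegral_const,
      ← lintegral_add_right _ measurable_const]
    refine lintegral_mono_ae (ae_restrict_of_ae ?_)
    have hT : ∀ᵐ p ∂(P.prod gpT), p.2 ∈ Set.Ioc (0 : ℝ) 1 := by
      have h2 : ∀ᵐ t ∂gpT, t ∈ Set.Ioc (0 : ℝ) 1 := ae_restrict_mem measurableSet_Ioc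
      exact Measure.quasiMeasurePreserving_snd.ae h2
    filter_upwards [hT] with p hp
    have hge := gpL_ge P r h1 k
    have hL0 := gpL_nonneg P r k
    have hk0 : (0 : ℝ) ≤ k := Nat.cast_nonneg k
    have hlogw : Real.log (w k) ≤ 0 := Real.log_nonpos (hw0 k) (hw1 k)
    have htw : 0 ≤ p.2 * w k := mul_nonneg hp.1.le (hw0 k)
    change ENNReal.ofReal _ ≤ ENNReal.ofReal (Real.log (1 + (gpL P r k + p.2 * w k))) +
      ENNReal.ofReal (-Real.log (w k))
    change k * w k ≤ gpL P r k at hge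
    rw [← ENNReal.ofReal_add (Real.log_nonneg (by linarith)) (by linarith)]
    apply ENNReal.ofReal_le_ofReal
    rw [abs_of_pos hp.1]
    have hpos : 0 < 1 + (k : ℝ) + p.2 := by linarith [hp.1]
    have h3 : Real.log (w k * (1 + (k : ℝ) + p.2)) ≤ Real.log (1 + (gpL P r k + p.2 * w k)) := by
      apply Real.log_le_log (mul_pos hwpos hpos)
      have := hw1 k
      nlinarith
    rw [Real.log_mul hwpos.ne' hpos.ne'] at h3
    linarith
  refine (ENNReal.tsum_le_tsum hterm).trans ?_
  rw [ENNReal.tsum_add]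
  rw [gp_sum_integral P r h1 hr (fun _ y => ENNReal.ofReal (Real.log (1 + y)))
    (by unfold Function.uncurry; fun_prop)]
  refine (add_le_add_right (gp_sum_w P r h1 hr) _).trans ?_
  rw [← h1, ← lintegral_add_right _ (by fun_prop)]
  refine lintegral_mono fun u => ?_
  rw [gp_int_log (r u) (hr0 u), ← ENNReal.ofReal_add _ (hr0 u)]
  · apply ENNReal.ofReal_le_ofReal; linarith
  · have h4 := Real.one_sub_inv_le_log_of_pos (x := 1 + r u) (by linarith [hr0 u])
    have h5 : 0 < 1 + r u := by linarith [hr0 u]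
    have h6 := mul_le_mul_of_nonneg_left h4 h5.le
    have h7 : (1 + r u) * (1 - (1 + r u)⁻¹) = r u := by field_simp; ring
    linarith

end sampler2

lemma gp_logsum (r : ℝ) (hr : 0 ≤ r) :
    (1 + r) * Real.log (1 + r) ≤ r * Real.log r + Real.log 2 * (1 + r) := by
  have hconv := Real.convexOn_mul_log.2
  have h := hconv (show (1 : ℝ) ∈ Set.Ici 0 by simp) (show r ∈ Set.Ici 0 from hr)
    (show (0 : ℝ) ≤ 1 / 2 by norm_num) (show (0 : ℝ) ≤ 1 / 2 by norm_num) (by norm_num)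
  simp only [smul_eq_mul, Real.log_one, mul_zero, zero_add] at h
  have e : (1 / 2 * 1 + 1 / 2 * r : ℝ) = (1 + r) / 2 := by ring
  rw [e, Real.log_div (by linarith) (by norm_num)] at h
  linarith

lemma gp_density_sum (ε : ℝ) (hε : 0 < ε) :
    ∑' k : ℕ, ∫⁻ t, ENNReal.ofReal (ε * (1 + (k : ℝ) + |t|) ^ (-1 - ε)) ∂gpT ≤ 1 := by
  have hterm : ∀ k : ℕ, ∫⁻ t, ENNReal.ofReal (ε * (1 + (k : ℝ) + |t|) ^ (-1 - ε)) ∂gpT =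
      ENNReal.ofReal ((1 + (k : ℝ)) ^ (-ε) - (1 + ((k + 1 : ℕ) : ℝ)) ^ (-ε)) := by
    intro k
    have hk : (0 : ℝ) ≤ k := Nat.cast_nonneg k
    have hcongr : ∫⁻ t, ENNReal.ofReal (ε * (1 + (k : ℝ) + |t|) ^ (-1 - ε)) ∂gpT =
        ∫⁻ t, ENNReal.ofReal (ε * (1 + (k : ℝ) + t) ^ (-1 - ε)) ∂gpT := by
      refine setLIntegral_congr_fun measurableSet_Ioc fun t ht => ?_
      simp only [abs_of_pos ht.1]
    have hcont : ContinuousOn (fun t : ℝ => ε * (1 + (k : ℝ) + t) ^ (-1 - ε)) (Set.uIcc 0 1) := by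
      refine ContinuousOn.mul continuousOn_const (ContinuousOn.rpow_const (by fun_prop) ?_)
      intro x hx
      rw [Set.uIcc_of_le zero_le_one] at hx
      left; linarith [hx.1]
    have hint : IntervalIntegrable (fun t : ℝ => ε * (1 + (k : ℝ) + t) ^ (-1 - ε)) volume 0 1 :=
      hcont.intervalIntegrable
    have h2 : ∫ t in (0 : ℝ)..1, ε * (1 + (k : ℝ) + t) ^ (-1 - ε) =
        (1 + (k : ℝ)) ^ (-ε) - (1 + ((k + 1 : ℕ) : ℝ)) ^ (-ε) := by
      rw [intervalIntegral.integral_eq_sub_of_hasDerivAt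
        (f := fun t => - (1 + (k : ℝ) + t) ^ (-ε)) (fun x hx => ?_) hint]
      · push_cast; simp; ring_nf
      · rw [Set.uIcc_of_le zero_le_one] at hx
        have ha : HasDerivAt (fun y : ℝ => 1 + (k : ℝ) + y) 1 x := by
          simpa using (hasDerivAt_id x).const_add (1 + (k : ℝ))
        have hb := (ha.rpow_const (p := -ε) (Or.inl (by linarith [hx.1]))).neg
        exact hb.congr_deriv (by rw [show -1 - ε = -ε - 1 by ring]; ring)
    rw [hcongr, ← h2, intervalIntegral.integral_of_le zero_le_one,
      ofReal_integral_eq_lintegral_ofReal]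
    · rfl
    · exact (intervalIntegrable_iff_integrableOn_Ioc_of_le zero_le_one).1 hint
    · refine (ae_restrict_iff' measurableSet_Ioc).2 (Filter.Eventually.of_forall fun y hy => ?_)
      have := hy.1
      simp only [Pi.zero_apply]
      positivity
  simp_rw [hterm]
  refine ENNReal.tsum_le_of_sum_range_le fun n => ?_
  rw [← ENNReal.ofReal_sum_of_nonneg]
  · refine ENNReal.ofReal_le_one.2 ?_
    rw [Finset.sum_range_sub' (fun k : ℕ => (1 + (k : ℝ)) ^ (-ε))]
    simp
    positivity
  · intro k _
    have : (1 + ((k + 1 : ℕ) : ℝ)) ^ (-ε) ≤ (1 + (k : ℝ)) ^ (-ε) := by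
      apply Real.rpow_le_rpow_of_nonpos (by positivity) (by push_cast; linarith) (by linarith)
    linarith


lemma gp_rn {Ω 𝒮 𝒰 : Type*} [MeasurableSpace Ω] [MeasurableSpace 𝒮] [MeasurableSpace 𝒰]
    (μ : Measure Ω) [IsProbabilityMeasure μ] (S : Ω → 𝒮) (U : Ω → 𝒰)
    (hS : Measurable S) (hU : Measurable U) (hfin : miBits μ U S ≠ ⊤) :
    ∃ r : 𝒮 × 𝒰 → ℝ, Measurable r ∧ (∀ p, 0 ≤ r p) ∧
      (∀ᵐ s ∂(μ.map S), ∫⁻ u, ENNReal.ofReal (r (s, u)) ∂(μ.map U) = 1) ∧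
      (∀ F : 𝒮 × 𝒰 → ℝ≥0∞, Measurable F → ∫⁻ ω, F (S ω, U ω) ∂μ =
        ∫⁻ s, ∫⁻ u, F (s, u) * ENNReal.ofReal (r (s, u)) ∂(μ.map U) ∂(μ.map S)) ∧
      ∫⁻ s, ∫⁻ u, ENNReal.ofReal ((1 + r (s, u)) * Real.log (1 + r (s, u))) ∂(μ.map U) ∂(μ.map S)
        ≤ ENNReal.ofReal (((miBits μ U S).toReal + 2) * Real.log 2) := by
  have hUS : Measurable (fun ω => (U ω, S ω)) := hU.prodMk hS
  have : IsProbabilityMeasure (μ.map S) := Measure.isProbabilityMeasure_map hS.aemeasurable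
  have : IsProbabilityMeasure (μ.map U) := Measure.isProbabilityMeasure_map hU.aemeasurable
  have : IsProbabilityMeasure (μ.map (fun ω => (U ω, S ω))) :=
    Measure.isProbabilityMeasure_map hUS.aemeasurable
  have hlog2 : 0 < Real.log 2 := Real.log_pos (by norm_num)
  unfold miBits klBits at hfin ⊢
  set N := μ.map (fun ω => (U ω, S ω)) with hN
  set Q := (μ.map U).prod (μ.map S) with hQ
  have hcond : N ≪ Q ∧ Integrable (fun x => Real.logb 2 (N.rnDeriv Q x).toReal) N := by
    by_contra hcon
    exact hfin (if_neg hcon)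
  rw [if_pos hcond]
  obtain ⟨hac, hint⟩ := hcond
  set R : 𝒰 × 𝒮 → ℝ := fun p => (N.rnDeriv Q p).toReal with hR
  have hRm : Measurable R := (Measure.measurable_rnDeriv N Q).ennreal_toReal
  have hR0 : ∀ p, 0 ≤ R p := fun p => ENNReal.toReal_nonneg
  have hRint : Integrable R Q := Measure.integrable_toReal_rnDeriv
  have hR1 : ∫ p, R p ∂Q = 1 := by
    rw [Measure.integral_toReal_rnDeriv hac]; simp
  have hF : ∀ F : 𝒮 × 𝒰 → ℝ≥0∞, Measurable F → ∫⁻ ω, F (S ω, U ω) ∂μ =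
        ∫⁻ s, ∫⁻ u, F (s, u) * ENNReal.ofReal (R (u, s)) ∂(μ.map U) ∂(μ.map S) := by
    intro F hF
    have hFs : Measurable (fun p : 𝒰 × 𝒮 => F (p.2, p.1)) :=
      hF.comp (measurable_snd.prodMk measurable_fst)
    have e1 : ∫⁻ ω, F (S ω, U ω) ∂μ = ∫⁻ p, F (p.2, p.1) ∂N := by
      rw [hN, lintegral_map hFs hUS]
    rw [e1, ← lintegral_rnDeriv_mul hac hFs.aemeasurable]
    have e2 : ∫⁻ p, N.rnDeriv Q p * F (p.2, p.1) ∂Q =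
        ∫⁻ p, F (p.2, p.1) * ENNReal.ofReal (R p) ∂Q := by
      refine lintegral_congr_ae ?_
      filter_upwards [Measure.rnDeriv_lt_top N Q] with p hp
      rw [hR, ENNReal.ofReal_toReal hp.ne, mul_comm]
    have hm : Measurable (fun p : 𝒰 × 𝒮 => F (p.2, p.1) * ENNReal.ofReal (R p)) :=
      hFs.mul hRm.ennreal_ofReal
    rw [e2, hQ, lintegral_prod_symm' _ hm]
  refine ⟨fun p => R (p.2, p.1), hRm.comp (measurable_snd.prodMk measurable_fst),
    fun p => hR0 _, ?_, hF, ?_⟩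
  · have hm : Measurable (fun s => ∫⁻ u, ENNReal.ofReal (R (u, s)) ∂(μ.map U)) :=
      Measurable.lintegral_prod_left' (f := fun p : 𝒰 × 𝒮 => ENNReal.ofReal (R p))
        hRm.ennreal_ofReal
    refine ae_eq_of_forall_setLIntegral_eq_of_sigmaFinite (g := fun _ => (1 : ℝ≥0∞)) hm
      measurable_const fun A hA _ => ?_
    have h := hF (fun p => A.indicator (fun _ => (1 : ℝ≥0∞)) p.1)
      ((measurable_const.indicator hA).comp measurable_fst)
    have e1 : ∫⁻ ω, A.indicator (fun _ => (1 : ℝ≥0∞)) (S ω) ∂μ = μ.map S A := by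
      rw [← lintegral_map (measurable_const.indicator hA) hS, lintegral_indicator hA]; simp
    simp only at h
    rw [e1] at h
    rw [setLIntegral_const, one_mul, h, ← lintegral_indicator hA]
    refine lintegral_congr fun s => ?_
    by_cases hs : s ∈ A <;> simp [hs]
  · have e0 : ∫⁻ s, ∫⁻ u, ENNReal.ofReal ((1 + R (u, s)) * Real.log (1 + R (u, s)))
        ∂(μ.map U) ∂(μ.map S) = ∫⁻ p, ENNReal.ofReal ((1 + R p) * Real.log (1 + R p)) ∂Q := by
      rw [hQ, lintegral_prod_symm' _ (by fun_prop)]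
    refine e0.le.trans ?_
    have hlint : Integrable (fun p => Real.log (R p)) N := by
      have := hint.mul_const (Real.log 2)
      refine this.congr (Filter.Eventually.of_forall fun p => ?_)
      simp only [Real.logb]; field_simp; rfl
    have hRl : Integrable (fun p => R p * Real.log (R p)) Q :=
      (integrable_rnDeriv_smul_iff hac).2 hlint
    have hRlv : ∫ p, R p * Real.log (R p) ∂Q = ∫ p, Real.log (R p) ∂N :=
      integral_rnDeriv_smul hac
    have hJ : ∫ p, Real.log (R p) ∂N = (∫ p, Real.logb 2 (N.rnDeriv Q p).toReal ∂N) * Real.log 2 := by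
      rw [← integral_mul_const]
      refine integral_congr_ae (Filter.Eventually.of_forall fun p => ?_)
      simp only [Real.logb]; field_simp; rfl
    have hb2 : Integrable (fun p => Real.log 2 * (1 + R p)) Q :=
      ((integrable_const 1).add hRint).const_mul _
    have hbd : Integrable (fun p => R p * Real.log (R p) + Real.log 2 * (1 + R p)) Q :=
      hRl.add hb2
    have hnn : ∀ p, 0 ≤ (1 + R p) * Real.log (1 + R p) := fun p =>
      mul_nonneg (by linarith [hR0 p]) (Real.log_nonneg (by linarith [hR0 p]))
    calc ∫⁻ p, ENNReal.ofReal ((1 + R p) * Real.log (1 + R p)) ∂Q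
        ≤ ∫⁻ p, ENNReal.ofReal (R p * Real.log (R p) + Real.log 2 * (1 + R p)) ∂Q :=
          lintegral_mono fun p => ENNReal.ofReal_le_ofReal (gp_logsum _ (hR0 p))
      _ = ENNReal.ofReal (∫ p, (R p * Real.log (R p) + Real.log 2 * (1 + R p)) ∂Q) :=
          (ofReal_integral_eq_lintegral_ofReal hbd (Filter.Eventually.of_forall fun p =>
            (hnn p).trans (gp_logsum _ (hR0 p)))).symm
      _ ≤ _ := by
          apply ENNReal.ofReal_le_ofReal
          rw [integral_add hRl hb2, hRlv, hJ,
            integral_const_mul, integral_add (integrable_const 1) hRint, hR1]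
          have : ∫ p, Real.logb 2 (N.rnDeriv Q p).toReal ∂N ≤
              (ENNReal.ofReal (∫ p, Real.logb 2 (N.rnDeriv Q p).toReal ∂N)).toReal := by
            rw [ENNReal.toReal_ofReal']; exact le_max_left _ _
          simp only [integral_const, probReal_univ, smul_eq_mul]
          nlinarith

lemma gpL_measurable {𝒮 𝒳 : Type*} [MeasurableSpace 𝒮] [MeasurableSpace 𝒳] (P : Measure 𝒳)
    [IsProbabilityMeasure P] (r : 𝒮 → 𝒳 → ℝ) (hr : Measurable (Function.uncurry r)) :
    (∀ f : 𝒮 → ℝ, Measurable f → Measurable fun s => gpW P (r s) (f s)) ∧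
    ∀ k, Measurable fun s => gpL P (r s) k := by
  have hW : ∀ f : 𝒮 → ℝ, Measurable f → Measurable fun s => gpW P (r s) (f s) := by
    intro f hf
    unfold gpW
    exact Measurable.lintegral_prod_right'
      (f := fun p : 𝒮 × 𝒳 => ENNReal.ofReal (Function.uncurry r p - f p.1))
      (hr.sub (hf.comp measurable_fst)).ennreal_ofReal
  refine ⟨hW, fun k => ?_⟩
  induction k with
  | zero => exact measurable_const
  | succ k ih => exact ih.add (hW _ ih).ennreal_toReal

lemma gpKA_measurable {𝒮 𝒳 : Type*} [MeasurableSpace 𝒮] [MeasurableSpace 𝒳] (P : Measure 𝒳)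
    [IsProbabilityMeasure P] (r : 𝒮 → 𝒳 → ℝ) (hr : Measurable (Function.uncurry r)) :
    Measurable (fun p : 𝒮 × (ℕ → 𝒳 × ℝ) => gpK (gpA P (r p.1)) p.2) := by
  obtain ⟨hW, hL⟩ := gpL_measurable P r hr
  have h1 : ∀ k, Measurable fun q : 𝒮 × (𝒳 × ℝ) => gpL P (r q.1) k := fun k =>
    (hL k).comp measurable_fst
  have h2 : ∀ k, Measurable fun q : 𝒮 × (𝒳 × ℝ) => (gpW P (r q.1) (gpL P (r q.1) k)).toReal :=
    fun k => ((hW _ (hL k)).comp measurable_fst).ennreal_toReal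
  have h3 : Measurable fun q : 𝒮 × (𝒳 × ℝ) => r q.1 q.2.1 :=
    hr.comp (measurable_fst.prodMk (measurable_fst.comp measurable_snd))
  have h4 : Measurable fun q : 𝒮 × (𝒳 × ℝ) => q.2.2 := by fun_prop
  exact gpK_measurable (fun k => {q : 𝒮 × (𝒳 × ℝ) | q.2 ∈ gpA P (r q.1) k})
    (fun k => measurableSet_lt ((h1 k).add (h4.mul (h2 k))) h3)


lemma gp_mi_congr {Ω Ω' 𝒰 𝒴 : Type*} [MeasurableSpace Ω] [MeasurableSpace Ω'] [MeasurableSpace 𝒰]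
    [MeasurableSpace 𝒴] (μ : Measure Ω) (μ' : Measure Ω') (U : Ω → 𝒰) (Y : Ω → 𝒴) (U' : Ω' → 𝒰)
    (Y' : Ω' → 𝒴) (hU : Measurable U) (hY : Measurable Y) (hU' : Measurable U')
    (hY' : Measurable Y')
    (h : μ.map (fun ω => (U ω, Y ω)) = μ'.map (fun ω => (U' ω, Y' ω))) :
    miBits μ U Y = miBits μ' U' Y' := by
  have h1 := congrArg (Measure.map Prod.fst) h
  have h2 := congrArg (Measure.map Prod.snd) h
  rw [Measure.map_map measurable_fst (hU.prodMk hY),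
    Measure.map_map measurable_fst (hU'.prodMk hY')] at h1
  rw [Measure.map_map measurable_snd (hU.prodMk hY),
    Measure.map_map measurable_snd (hU'.prodMk hY')] at h2
  change μ.map U = μ'.map U' at h1
  change μ.map Y = μ'.map Y' at h2
  unfold miBits
  rw [h, h1, h2]

lemma gp_compProd_comap {α β γ : Type*} [MeasurableSpace α] [MeasurableSpace β] [MeasurableSpace γ]
    (ρ : Measure α) [IsProbabilityMeasure ρ] (κ : Kernel β γ) [IsMarkovKernel κ] (h : α → β)
    (hh : Measurable h) :
    (ρ ⊗ₘ κ.comap h hh).map (fun p => (h p.1, p.2)) = (ρ.map h) ⊗ₘ κ := by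
  have : IsProbabilityMeasure (ρ.map h) := Measure.isProbabilityMeasure_map hh.aemeasurable
  have hm : Measurable (fun p : α × γ => (h p.1, p.2)) := by fun_prop
  refine Measure.ext_of_lintegral _ fun f hf => ?_
  have hfm : Measurable (fun p : α × γ => f (h p.1, p.2)) := hf.comp hm
  rw [lintegral_map hf hm, Measure.lintegral_compProd hfm, Measure.lintegral_compProd hf,
    lintegral_map _ hh]
  · rfl
  · exact Measurable.lintegral_kernel_prod_right' hf

/-- The final numerical estimate. -/
lemma gp_numeric (J : ℝ) (hJ : 0 ≤ J) :
    - Real.log (1 / (J + 2)) + (1 + 1 / (J + 2)) * ((J + 2) * Real.log 2) ≤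
      (J + (Real.logb 2 (J + 1) + 4)) * Real.log 2 := by
  have hlog2 : 0 < Real.log 2 := Real.log_pos (by norm_num)
  have e1 : (1 + 1 / (J + 2)) * ((J + 2) * Real.log 2) = (J + 3) * Real.log 2 := by
    field_simp; ring
  have e2 : (J + (Real.logb 2 (J + 1) + 4)) * Real.log 2 =
      (J + 4) * Real.log 2 + Real.log (J + 1) := by
    rw [Real.logb]; field_simp; ring
  have e3 : Real.log (J + 2) ≤ Real.log 2 + Real.log (J + 1) := by
    rw [← Real.log_mul (by norm_num) (by linarith)]
    exact Real.log_le_log (by linarith) (by linarith)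
  rw [e1, e2, one_div, Real.log_inv]
  linarith

lemma gp_int_of_lint {Ω : Type*} [MeasurableSpace Ω] (M : Measure Ω) (f : Ω → ℝ)
    (hf : Measurable f) (h0 : ∀ ω, 0 ≤ f ω) (B : ℝ) (hB : 0 ≤ B)
    (h : ∫⁻ ω, ENNReal.ofReal (f ω) ∂M ≤ ENNReal.ofReal B) :
    Integrable f M ∧ ∫ ω, f ω ∂M ≤ B := by
  have h1 : 0 ≤ᵐ[M] f := Filter.Eventually.of_forall h0
  refine ⟨⟨hf.aestronglyMeasurable, ?_⟩, ?_⟩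
  · rw [hasFiniteIntegral_iff_ofReal h1]
    exact h.trans_lt ENNReal.ofReal_lt_top
  · rw [integral_eq_lintegral_of_nonneg_ae h1 hf.aestronglyMeasurable]
    exact ENNReal.toReal_le_of_le_ofReal hB h

set_option maxHeartbeats 1600000 in
lemma gp_core {Ω 𝒮 𝒰 𝒴 𝒳 : Type*} [MeasurableSpace Ω] [MeasurableSpace 𝒮] [MeasurableSpace 𝒰]
    [MeasurableSpace 𝒴] [StandardBorelSpace 𝒴] [Nonempty 𝒴] [MeasurableSpace 𝒳]
    (μ : Measure Ω) [IsProbabilityMeasure μ] (S : Ω → 𝒮) (U : Ω → 𝒰) (Y : Ω → 𝒴)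
    (hS : Measurable S) (hU : Measurable U) (hY : Measurable Y) (hfin : miBits μ U S ≠ ⊤)
    (P : Measure 𝒳) [IsProbabilityMeasure P] (D : 𝒳 → 𝒰) (hD : Measurable D)
    (hPD : P.map D = μ.map U) :
    ∃ (M : Measure ((𝒮 × (ℕ → 𝒳 × ℝ)) × 𝒴)) (_ : IsProbabilityMeasure M)
      (g : 𝒮 × (ℕ → 𝒳 × ℝ) → 𝒰), Measurable g ∧
      M.map (fun ω => (ω.1.1, g ω.1, ω.2)) = μ.map (fun ω => (S ω, U ω, Y ω)) ∧
      IndepFun (fun ω => ω.1.1) (fun ω => ω.1.2) M ∧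
      miBits μ U Y ≤ miBits M (fun ω => ω.1.2) (fun ω => ω.2) +
        ENNReal.ofReal ((miBits μ U S).toReal +
          (Real.logb 2 ((miBits μ U S).toReal + 1) + 4)) := by
  obtain ⟨r, hrm, hr0, hr1, hrF, hrc⟩ := gp_rn μ S U hS hU hfin
  have hJ : 0 ≤ (miBits μ U S).toReal := ENNReal.toReal_nonneg
  set J := (miBits μ U S).toReal with hJdef
  have hSU : Measurable (fun ω => (S ω, U ω)) := hS.prodMk hU
  have hPS : IsProbabilityMeasure (μ.map S) := Measure.isProbabilityMeasure_map hS.aemeasurable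
  have hPU : IsProbabilityMeasure (μ.map U) := Measure.isProbabilityMeasure_map hU.aemeasurable
  set Pi : Measure (ℕ → 𝒳 × ℝ) := Measure.infinitePi fun _ : ℕ => P.prod gpT with hPi
  set rr : 𝒮 → 𝒳 → ℝ := fun s x => r (s, D x) with hrr
  have hrrm : Measurable (Function.uncurry rr) :=
    hrm.comp (measurable_fst.prodMk (hD.comp measurable_snd))
  have hrrs : ∀ s, Measurable (rr s) := fun s => hrm.comp (measurable_const.prodMk hD)
  have hrr1 : ∀ᵐ s ∂(μ.map S), ∫⁻ x, ENNReal.ofReal (rr s x) ∂P = 1 := by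
    filter_upwards [hr1] with s hs
    have hrs : Measurable (fun u => ENNReal.ofReal (r (s, u))) :=
      (hrm.comp (measurable_const.prodMk measurable_id)).ennreal_ofReal
    rw [← hPD, lintegral_map hrs hD] at hs
    exact hs
  set K : 𝒮 × (ℕ → 𝒳 × ℝ) → ℕ := fun p => gpK (gpA P (rr p.1)) p.2 with hKdef
  have hK : Measurable K := gpKA_measurable P rr hrrm
  have hev : Measurable (fun p : 𝒮 × (ℕ → 𝒳 × ℝ) => p.2 (K p)) := by
    have h1 : Measurable (fun q : (ℕ → 𝒳 × ℝ) × ℕ => q.1 q.2) :=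
      measurable_from_prod_countable_left fun k => measurable_pi_apply k
    exact h1.comp (measurable_snd.prodMk hK)
  set g : 𝒮 × (ℕ → 𝒳 × ℝ) → 𝒰 := fun p => D (p.2 (K p)).1 with hgdef
  have hg : Measurable g := hD.comp (measurable_fst.comp hev)
  set ρ := (μ.map S).prod Pi with hρ
  set h : 𝒮 × (ℕ → 𝒳 × ℝ) → 𝒮 × 𝒰 := fun p => (p.1, g p) with hhdef
  have hh : Measurable h := measurable_fst.prodMk hg
  -- the law of `(S, g(S,V))`
  have hlaw : ρ.map h = μ.map (fun ω => (S ω, U ω)) := by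
    refine Measure.ext_of_lintegral _ fun f hf => ?_
    rw [lintegral_map hf hh, lintegral_map hf hSU, hrF f hf, hρ, lintegral_prod _ (by fun_prop)]
    refine lintegral_congr_ae ?_
    filter_upwards [hrr1] with s hs
    have hfs : Measurable (fun u => f (s, u)) := hf.comp (measurable_const.prodMk measurable_id)
    have h2 := gp_sampler_law P (rr s) hs (hrrs s) (fun x => f (s, D x)) (hfs.comp hD)
    refine Eq.trans h2 ?_
    have hfr : Measurable (fun u => f (s, u) * ENNReal.ofReal (r (s, u))) :=
      hfs.mul (hrm.comp (measurable_const.prodMk measurable_id)).ennreal_ofReal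
    rw [← hPD, lintegral_map hfr hD]
  set κ := condDistrib Y (fun ω => (S ω, U ω)) μ with hκ
  set M := ρ ⊗ₘ κ.comap h hh with hM
  have hMlaw : M.map (fun p => (h p.1, p.2)) = μ.map (fun ω => ((S ω, U ω), Y ω)) := by
    rw [hM, gp_compProd_comap, hlaw, hκ, compProd_map_condDistrib hY.aemeasurable]
  have hMfst : M.map Prod.fst = ρ := Measure.fst_compProd ρ (κ.comap h hh)
  have hS' : Measurable (fun ω : (𝒮 × (ℕ → 𝒳 × ℝ)) × 𝒴 => ω.1.1) := by fun_prop
  have hV' : Measurable (fun ω : (𝒮 × (ℕ → 𝒳 × ℝ)) × 𝒴 => ω.1.2) := by fun_prop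
  have hU' : Measurable (fun ω : (𝒮 × (ℕ → 𝒳 × ℝ)) × 𝒴 => g ω.1) := hg.comp measurable_fst
  have hY' : Measurable (fun ω : (𝒮 × (ℕ → 𝒳 × ℝ)) × 𝒴 => ω.2) := measurable_snd
  have hMS : M.map (fun ω => ω.1.1) = μ.map S := by
    have : M.map (fun ω => ω.1.1) = (M.map Prod.fst).map Prod.fst := by
      rw [Measure.map_map measurable_fst measurable_fst]; rfl
    rw [this, hMfst, hρ]
    exact Measure.fst_prod
  have hMV : M.map (fun ω => ω.1.2) = Pi := by
    have : M.map (fun ω => ω.1.2) = (M.map Prod.fst).map Prod.snd := by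
      rw [Measure.map_map measurable_snd measurable_fst]; rfl
    rw [this, hMfst, hρ]
    exact Measure.snd_prod
  have hMUY : M.map (fun ω => (g ω.1, ω.2)) = μ.map (fun ω => (U ω, Y ω)) := by
    have h3 := congrArg (Measure.map (fun q : (𝒮 × 𝒰) × 𝒴 => (q.1.2, q.2))) hMlaw
    rw [Measure.map_map (by fun_prop) (by fun_prop),
      Measure.map_map (by fun_prop) (by fun_prop)] at h3
    exact h3
  have hMU : M.map (fun ω => g ω.1) = μ.map U := by
    have h3 := congrArg (Measure.map (fun q : (𝒮 × 𝒰) × 𝒴 => q.1.2)) hMlaw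
    rw [Measure.map_map (by fun_prop) (by fun_prop),
      Measure.map_map (by fun_prop) (by fun_prop)] at h3
    exact h3
  refine ⟨M, inferInstance, g, hg, ?_, ?_, ?_⟩
  · have h3 := congrArg (Measure.map (fun q : (𝒮 × 𝒰) × 𝒴 => (q.1.1, q.1.2, q.2))) hMlaw
    rw [Measure.map_map (by fun_prop) (by fun_prop),
      Measure.map_map (by fun_prop) (by fun_prop)] at h3
    exact h3
  · rw [indepFun_iff_map_prod_eq_prod_map_map hS'.aemeasurable hV'.aemeasurable, hMS, hMV]
    exact hMfst
  · rw [gp_mi_congr μ M U Y (fun ω => g ω.1) (fun ω => ω.2) hU hY hU' hY' hMUY.symm]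
    set ε : ℝ := 1 / (J + 2) with hε
    have hε0 : 0 < ε := by positivity
    set q : ℕ → (ℕ → 𝒳 × ℝ) → ℝ := fun k v => ε * (1 + (k : ℝ) + |(v k).2|) ^ (-1 - ε) with hq
    have hbase : ∀ (k : ℕ) (t : ℝ), 0 < 1 + (k : ℝ) + |t| := fun k t => by positivity
    have hevk : ∀ k : ℕ, Pi.map (fun v => v k) = P.prod gpT := fun k =>
      Measure.infinitePi_map_eval _ k
    have hlogq : ∀ k v, - Real.log (q k v) =
        - Real.log ε + (1 + ε) * Real.log (1 + (k : ℝ) + |(v k).2|) := by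
      intro k v
      simp only [hq]
      rw [Real.log_mul hε0.ne' (Real.rpow_pos_of_pos (hbase _ _) _).ne',
        Real.log_rpow (hbase _ _)]
      ring
    -- the cost
    have hcm : Measurable (fun p : 𝒮 × (ℕ → 𝒳 × ℝ) =>
        Real.log (1 + (K p : ℝ) + |(p.2 (K p)).2|)) := by
      have hK' : Measurable (fun p => (K p : ℝ)) := measurable_from_nat.comp hK
      have hT' : Measurable (fun p : 𝒮 × (ℕ → 𝒳 × ℝ) => (p.2 (K p)).2) := measurable_snd.comp hev
      exact Real.measurable_log.comp ((measurable_const.add hK').add hT'.abs)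
    have hc0 : ∀ p : 𝒮 × (ℕ → 𝒳 × ℝ), 0 ≤ Real.log (1 + (K p : ℝ) + |(p.2 (K p)).2|) := by
      intro p
      refine Real.log_nonneg ?_
      have h3 : (0 : ℝ) ≤ K p := Nat.cast_nonneg _
      linarith [abs_nonneg (p.2 (K p)).2]
    have hcost : ∫⁻ ω, ENNReal.ofReal (Real.log (1 + (K ω.1 : ℝ) + |(ω.1.2 (K ω.1)).2|)) ∂M ≤
        ENNReal.ofReal ((J + 2) * Real.log 2) := by
      have e1 : ∫⁻ ω, ENNReal.ofReal (Real.log (1 + (K ω.1 : ℝ) + |(ω.1.2 (K ω.1)).2|)) ∂M =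
          ∫⁻ p, ENNReal.ofReal (Real.log (1 + (K p : ℝ) + |(p.2 (K p)).2|)) ∂ρ := by
        rw [← hMfst, lintegral_map hcm.ennreal_ofReal measurable_fst]
      rw [e1, hρ, lintegral_prod _ hcm.ennreal_ofReal.aemeasurable]
      refine le_trans (lintegral_mono_ae ?_) hrc
      filter_upwards [hrr1] with s hs
      have h2 := gp_sampler_cost P (rr s) hs (hrrs s) (fun x => hr0 _)
      refine h2.trans (le_of_eq ?_)
      have hrs : Measurable (fun u => r (s, u)) := hrm.comp (measurable_const.prodMk measurable_id)
      rw [← hPD, lintegral_map (by fun_prop) hD]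
    have hB0 : 0 ≤ (J + 2) * Real.log 2 :=
      mul_nonneg (by linarith) (Real.log_nonneg (by norm_num))
    have hcint : Integrable (fun ω : (𝒮 × (ℕ → 𝒳 × ℝ)) × 𝒴 =>
        Real.log (1 + (K ω.1 : ℝ) + |(ω.1.2 (K ω.1)).2|)) M := by
      exact (gp_int_of_lint M _ (hcm.comp measurable_fst) (fun ω => hc0 ω.1) _ hB0 hcost).1
    have hcval : ∫ ω, Real.log (1 + (K ω.1 : ℝ) + |(ω.1.2 (K ω.1)).2|) ∂M ≤
        (J + 2) * Real.log 2 :=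
      (gp_int_of_lint M _ (hcm.comp measurable_fst) (fun ω => hc0 ω.1) _ hB0 hcost).2
    have hDk : ∀ k : ℕ, Measurable (fun v : ℕ → 𝒳 × ℝ => D (v k).1) := fun k =>
      hD.comp (measurable_fst.comp (measurable_pi_apply k))
    refine gp_info M (fun ω => g ω.1) (fun ω => ω.1.2) (fun ω => ω.2) (fun ω => K ω.1)
      hU' hV' hY' (hK.comp measurable_fst) (fun k v => D (v k).1) hDk q ?_ ?_
      (Filter.Eventually.of_forall fun ω => rfl) ?_
      (fun k => ∫⁻ t, ENNReal.ofReal (ε * (1 + (k : ℝ) + |t|) ^ (-1 - ε)) ∂gpT)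
      (gp_density_sum ε hε0) ?_ ?_ _ ?_
    · intro k
      simp only [hq]
      fun_prop
    · intro k v
      exact mul_pos hε0 (Real.rpow_pos_of_pos (hbase _ _) _)
    · intro k
      have e1 : Pi.map (fun v => D (v k).1) = μ.map U := by
        have e2 : Pi.map (fun v => D (v k).1) = ((Pi.map (fun v => v k)).map Prod.fst).map D := by
          rw [Measure.map_map measurable_fst (measurable_pi_apply k),
            Measure.map_map hD (measurable_fst.comp (measurable_pi_apply k))]
          rfl
        have e3 : (P.prod gpT).map Prod.fst = P := Measure.fst_prod
        rw [e2, hevk, e3, hPD]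
      rw [hMV, hMU, e1]
    · intro k F hF
      rw [hMV, hMU]
      have hqm : Measurable (fun t : ℝ => ENNReal.ofReal (ε * (1 + (k : ℝ) + |t|) ^ (-1 - ε))) := by
        fun_prop
      have hFm : Measurable (fun p : 𝒳 × ℝ =>
          F (D p.1) * ENNReal.ofReal (ε * (1 + (k : ℝ) + |p.2|) ^ (-1 - ε))) := by fun_prop
      have e1 := lintegral_map (μ := Pi) hFm (measurable_pi_apply k)
      have e0 : Pi.map (fun v : ℕ → 𝒳 × ℝ => v k) = P.prod gpT := hevk k
      rw [e0] at e1
      rw [← hPD, lintegral_map hF hD, mul_comm,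
        ← lintegral_prod_mul (f := fun x => F (D x)) (hF.comp hD).aemeasurable hqm.aemeasurable]
      exact e1.symm.le
    · simp_rw [hlogq]
      exact (integrable_const _).add (hcint.const_mul _)
    · simp_rw [hlogq]
      rw [integral_add (integrable_const _) (hcint.const_mul _), integral_const_mul]
      simp only [integral_const, probReal_univ, smul_eq_mul, one_mul]
      refine le_trans ?_ (gp_numeric J hJ)
      have : 0 < 1 + ε := by linarith
      have := mul_le_mul_of_nonneg_left hcval this.le
      linarith


lemma gp_encode (α : Type*) [MeasurableSpace α] [StandardBorelSpace α] [Nonempty α] :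
    ∃ (e : α → ℝ) (d : ℝ → α), Measurable e ∧ Measurable d ∧ ∀ x, d (e x) = x := by
  have he := measurableEmbedding_embeddingReal α
  obtain ⟨d, hd, hde⟩ := he.exists_measurable_extend (g := fun x : α => x) measurable_id
    (fun _ => inferInstance)
  exact ⟨embeddingReal α, d, he.measurable, hd, fun x => congrFun hde x⟩

lemma gp_transport {α β : Type*} [MeasurableSpace α] [MeasurableSpace β] (M : Measure α)
    (e : α → ℝ) (d : ℝ → α) (hd : Measurable d) (hMd : (M.map e).map d = M) (f : α → β)
    (hf : Measurable f) : (M.map e).map (fun x => f (d x)) = M.map f := by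
  conv_rhs => rw [← hMd]
  rw [Measure.map_map hf hd]
  rfl


/-- **Gelfand–Pinsker reduction inequality** (Section V).
For jointly distributed `(S,U,Y)` with `I(U;S) < ∞` there exists (on an extension preserving
the joint law of `(S,U,Y)`) a random variable `V` independent of `S` with `U` a.s. a
measurable function of `(S,V)`, such that
`I(V;Y) ≥ I(U;Y) − I(U;S) − log₂(I(U;S)+1) − 4`
(stated additively in `ℝ≥0∞` as `I(U;Y) ≤ I(V;Y) + I(U;S) + log₂(I(U;S)+1) + 4`). -/
theorem gelfand_pinsker_reduction
    {Ω 𝒮 𝒰 𝒴 : Type*} [MeasurableSpace Ω]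
    [TopologicalSpace 𝒮] [PolishSpace 𝒮] [MeasurableSpace 𝒮] [BorelSpace 𝒮]
    [TopologicalSpace 𝒰] [PolishSpace 𝒰] [MeasurableSpace 𝒰] [BorelSpace 𝒰]
    [TopologicalSpace 𝒴] [PolishSpace 𝒴] [MeasurableSpace 𝒴] [BorelSpace 𝒴]
    (μ : Measure Ω) [IsProbabilityMeasure μ]
    (S : Ω → 𝒮) (U : Ω → 𝒰) (Y : Ω → 𝒴)
    (hS : Measurable S) (hU : Measurable U) (hY : Measurable Y)
    (hfin : miBits μ U S ≠ ⊤) :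
    ∃ (Ω' : Type) (_ : MeasurableSpace Ω') (μ' : Measure Ω') (_ : IsProbabilityMeasure μ')
      (𝒱 : Type) (_ : MeasurableSpace 𝒱)
      (S' : Ω' → 𝒮) (U' : Ω' → 𝒰) (Y' : Ω' → 𝒴) (V : Ω' → 𝒱),
      Measurable S' ∧ Measurable U' ∧ Measurable Y' ∧ Measurable V ∧
      μ'.map (fun ω => (S' ω, U' ω, Y' ω)) = μ.map (fun ω => (S ω, U ω, Y ω)) ∧
      IndepFun S' V μ' ∧
      (∃ g : 𝒮 × 𝒱 → 𝒰, Measurable g ∧ U' =ᵐ[μ'] fun ω => g (S' ω, V ω)) ∧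
      miBits μ U Y ≤
        miBits μ' V Y' + miBits μ U S +
          ENNReal.ofReal (Real.logb 2 ((miBits μ U S).toReal + 1) + 4) := by
  obtain ⟨ω₀⟩ : Nonempty Ω := nonempty_of_isProbabilityMeasure μ
  have hn𝒮 : Nonempty 𝒮 := ⟨S ω₀⟩
  have hn𝒰 : Nonempty 𝒰 := ⟨U ω₀⟩
  have hn𝒴 : Nonempty 𝒴 := ⟨Y ω₀⟩
  obtain ⟨e, D, he, hD, hDe⟩ := gp_encode 𝒰
  have hPU : IsProbabilityMeasure (μ.map U) := Measure.isProbabilityMeasure_map hU.aemeasurable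
  have hP : IsProbabilityMeasure ((μ.map U).map e) :=
    Measure.isProbabilityMeasure_map he.aemeasurable
  have hPD : ((μ.map U).map e).map D = μ.map U := by
    rw [Measure.map_map hD he]
    have : D ∘ e = id := funext hDe
    rw [this, Measure.map_id]
  obtain ⟨M, hM, g, hg, hlaw, hind, hmi⟩ :=
    gp_core μ S U Y hS hU hY hfin ((μ.map U).map e) D hD hPD
  -- transport the sample space to `ℝ`
  obtain ⟨e', d, he', hd, hde⟩ := gp_encode ((𝒮 × (ℕ → ℝ × ℝ)) × 𝒴)
  have hMd : (M.map e').map d = M := by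
    rw [Measure.map_map hd he']
    have : d ∘ e' = id := funext hde
    rw [this, Measure.map_id]
  have hM' : IsProbabilityMeasure (M.map e') := Measure.isProbabilityMeasure_map he'.aemeasurable
  have hS' : Measurable (fun x : ℝ => (d x).1.1) := by fun_prop
  have hV' : Measurable (fun x : ℝ => (d x).1.2) := by fun_prop
  have hU' : Measurable (fun x : ℝ => g (d x).1) := by fun_prop
  have hY' : Measurable (fun x : ℝ => (d x).2) := by fun_prop
  refine ⟨ℝ, inferInstance, M.map e', hM', ℕ → ℝ × ℝ, inferInstance, fun x => (d x).1.1,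
    fun x => g (d x).1, fun x => (d x).2, fun x => (d x).1.2, hS', hU', hY', hV', ?_, ?_,
    ⟨g, hg, Filter.Eventually.of_forall fun x => rfl⟩, ?_⟩
  · rw [← hlaw]
    exact gp_transport M e' d hd hMd (fun ω => (ω.1.1, g ω.1, ω.2)) (by fun_prop)
  · rw [indepFun_iff_map_prod_eq_prod_map_map (by fun_prop) (by fun_prop)] at hind
    rw [indepFun_iff_map_prod_eq_prod_map_map hS'.aemeasurable hV'.aemeasurable,
      gp_transport M e' d hd hMd (fun ω => ω.1.1) (by fun_prop),
      gp_transport M e' d hd hMd (fun ω => ω.1.2) (by fun_prop), ← hind]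
    exact gp_transport M e' d hd hMd (fun ω => (ω.1.1, ω.1.2)) (by fun_prop)
  · have hmi2 : miBits (M.map e') (fun x => (d x).1.2) (fun x => (d x).2) =
        miBits M (fun ω => ω.1.2) (fun ω => ω.2) := by
      refine gp_mi_congr _ _ _ _ _ _ hV' hY' (by fun_prop) (by fun_prop) ?_
      exact gp_transport M e' d hd hMd (fun ω => (ω.1.2, ω.2)) (by fun_prop)
    rw [hmi2, add_assoc]
    refine hmi.trans (le_of_eq ?_)
    have h1 : (0 : ℝ) ≤ (miBits μ U S).toReal := ENNReal.toReal_nonneg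
    have h2 : 0 ≤ Real.logb 2 ((miBits μ U S).toReal + 1) :=
      Real.logb_nonneg (by norm_num) (by linarith)
    rw [ENNReal.ofReal_add h1 (by linarith), ENNReal.ofReal_toReal hfin]
end
end

section
/- Lower bound on the excess functional information: for jointly distributed random variables X and Y with Y discrete, Ψ(X→Y) ≥ −Σ_{y∈𝒴} ∫₀¹ P_X{ p_{Y|X}(y|X) ≥ t } · log₂( P_X{ p_{Y|X}(y|X) ≥ t } ) dt − I(X;Y). -/
open MeasureTheory ProbabilityTheory Real
open scoped ENNReal

noncomputable section
/-- **Excess functional information** `Ψ(X→Y)` of a joint law `ν` on `𝒳 × 𝒴`: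
the infimum of `I(X;Z|Y)` over all random variables `Z` independent of `X` such that `Y` is
a.s. a measurable function of `(X,Z)`.  `Z` is realized on the canonical extension
`𝒳 × 𝒴 × ℝ` of the joint law, `ℝ` serving as a universal standard Borel value space. -/
def excessFI {𝒳 𝒴 : Type*} [MeasurableSpace 𝒳] [MeasurableSpace 𝒴]
    (ν : Measure (𝒳 × 𝒴)) : ℝ≥0∞ :=
  sInf { r : ℝ≥0∞ |
    ∃ ρ : Measure (𝒳 × 𝒴 × ℝ), IsProbabilityMeasure ρ ∧
      ρ.map (fun p => (p.1, p.2.1)) = ν ∧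
      IndepFun (fun p : 𝒳 × 𝒴 × ℝ => p.1) (fun p => p.2.2) ρ ∧
      (∃ g : 𝒳 × ℝ → 𝒴, Measurable g ∧
        (fun p : 𝒳 × 𝒴 × ℝ => p.2.1) =ᵐ[ρ] fun p => g (p.1, p.2.2)) ∧
      r = cmiBits ρ (fun p : 𝒳 × 𝒴 × ℝ => p.1) (fun p => p.2.2) (fun p => p.2.1) }

/-- Excess functional information `Ψ(X→Y)` of a pair of random variables. -/
def excessFIRV {Ω 𝒳 𝒴 : Type*} [MeasurableSpace Ω] [MeasurableSpace 𝒳] [MeasurableSpace 𝒴]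
    (μ : Measure Ω) (X : Ω → 𝒳) (Y : Ω → 𝒴) : ℝ≥0∞ :=
  excessFI (μ.map (fun ω => (X ω, Y ω)))

lemma aux_min_le {𝒳 𝒵 : Type*} [MeasurableSpace 𝒳] [MeasurableSpace 𝒵]
    (μ : Measure 𝒳) [IsProbabilityMeasure μ] (κ : Measure 𝒵) [IsProbabilityMeasure κ]
    (A : Set (𝒳 × 𝒵)) (hA : MeasurableSet A) (c : ℝ≥0∞) :
    ∫⁻ t in Set.Ioc (0 : ℝ) 1, min (μ {x | (κ (Prod.mk x ⁻¹' A)).toReal ≥ t}) c ≤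
      ∫⁻ z, min (μ ((fun x => (x, z)) ⁻¹' A)) c ∂κ := by
  set q : 𝒵 → ℝ≥0∞ := fun z => μ ((fun x => (x, z)) ⁻¹' A) with hq
  have hqm : Measurable q := measurable_measure_prodMk_right hA
  set p : 𝒳 → ℝ≥0∞ := fun x => κ (Prod.mk x ⁻¹' A) with hp
  have hpm : Measurable p := measurable_measure_prodMk_left hA
  set B : Set 𝒵 := {z | c < q z} with hB
  have hBm : MeasurableSet B := measurableSet_lt measurable_const hqm
  set b : ℝ := (κ B).toReal with hb
  have hb0 : 0 ≤ b := ENNReal.toReal_nonneg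
  have hb1 : b ≤ 1 := by
    rw [hb]; exact measureReal_le_one
  have hκB : κ B = ENNReal.ofReal b := (ENNReal.ofReal_toReal (measure_ne_top _ _)).symm
  have hsplit : Set.Ioc (0:ℝ) 1 = Set.Ioc 0 b ∪ Set.Ioc b 1 := (Set.Ioc_union_Ioc_eq_Ioc hb0 hb1).symm
  -- the right side
  have hR : ∫⁻ z, min (q z) c ∂κ = ENNReal.ofReal b * c + ∫⁻ z in Bᶜ, q z ∂κ := by
    rw [← lintegral_add_compl _ hBm]
    congr 1
    · rw [setLIntegral_congr_fun (g := fun _ => c) hBm (fun z hz => min_eq_right (le_of_lt hz))]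
      simp [hκB, mul_comm]
    · exact setLIntegral_congr_fun hBm.compl (fun z hz => min_eq_left (not_lt.mp hz))
  have hswap : ∫⁻ z in Bᶜ, q z ∂κ = ∫⁻ x, κ ((Prod.mk x ⁻¹' A) ∩ Bᶜ) ∂μ := by
    have hA' : MeasurableSet (A ∩ (Prod.snd ⁻¹' Bᶜ)) := hA.inter (measurable_snd hBm.compl)
    have h1 := Measure.prod_apply (μ := μ) (ν := κ) hA'
    have h2 := Measure.prod_apply_symm (μ := μ) (ν := κ) hA'
    rw [h1] at h2
    have e : ∀ x, Prod.mk x ⁻¹' (A ∩ (Prod.snd ⁻¹' Bᶜ)) = (Prod.mk x ⁻¹' A) ∩ Bᶜ := by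
      intro x; rfl
    simp only [e] at h2
    rw [h2, ← lintegral_indicator hBm.compl]
    refine lintegral_congr fun z => ?_
    by_cases hz : z ∈ Bᶜ
    · rw [Set.indicator_of_mem hz]
      refine congrArg μ ?_
      ext x; simp only [Set.mem_preimage, Set.mem_inter_iff]; tauto
    · rw [Set.indicator_of_notMem hz]
      symm
      convert measure_empty (μ := μ)
      ext x; simp only [Set.mem_preimage, Set.mem_inter_iff, Set.mem_empty_iff_false]; tauto
  have hge : ∫⁻ t in Set.Ioc b 1, μ {x | (p x).toReal ≥ t} ≤ ∫⁻ z in Bᶜ, q z ∂κ := by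
    rw [hswap]
    have hS : MeasurableSet {r : ℝ × 𝒳 | (p r.2).toReal ≥ r.1} :=
      measurableSet_le measurable_fst (hpm.comp measurable_snd).ennreal_toReal
    have h1 := Measure.prod_apply (μ := volume.restrict (Set.Ioc b 1)) (ν := μ) hS
    have h2 := Measure.prod_apply_symm (μ := volume.restrict (Set.Ioc b 1)) (ν := μ) hS
    rw [h1] at h2
    refine (le_of_eq h2).trans (lintegral_mono fun x => ?_)
    rw [Measure.restrict_apply (measurable_prodMk_right hS)]
    calc volume _ ≤ volume (Set.Icc b (p x).toReal) := by
          apply measure_mono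
          rintro t ⟨ht, ht2⟩
          exact ⟨ht2.1.le, ht⟩
      _ = ENNReal.ofReal ((p x).toReal - b) := by simp
      _ = p x - κ B := by
          rw [ENNReal.ofReal_sub _ hb0, ← hκB, ENNReal.ofReal_toReal (measure_ne_top _ _)]
      _ ≤ κ ((Prod.mk x ⁻¹' A) ∩ Bᶜ) := by
          rw [← Set.sdiff_eq]; exact le_measure_sdiff
  rw [hR, hsplit, lintegral_union measurableSet_Ioc (Set.Ioc_disjoint_Ioc_of_le le_rfl)]
  gcongr
  · calc _ ≤ ∫⁻ t in Set.Ioc (0:ℝ) b, c := lintegral_mono fun t => min_le_right _ _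
      _ = _ := by simp [mul_comm]
  · exact (lintegral_mono fun t => min_le_left _ _).trans hge

lemma aux_mean {𝒳 𝒵 : Type*} [MeasurableSpace 𝒳] [MeasurableSpace 𝒵]
    (μ : Measure 𝒳) [IsProbabilityMeasure μ] (κ : Measure 𝒵) [IsProbabilityMeasure κ]
    (A : Set (𝒳 × 𝒵)) (hA : MeasurableSet A) :
    ∫⁻ t in Set.Ioc (0 : ℝ) 1, μ {x | (κ (Prod.mk x ⁻¹' A)).toReal ≥ t} =
      ∫⁻ z, (μ ((fun x => (x, z)) ⁻¹' A)) ∂κ := by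
  set p : 𝒳 → ℝ≥0∞ := fun x => κ (Prod.mk x ⁻¹' A) with hp
  have hpm : Measurable p := measurable_measure_prodMk_left hA
  rw [← Measure.prod_apply_symm hA, Measure.prod_apply hA]
  have hS : MeasurableSet {r : ℝ × 𝒳 | (p r.2).toReal ≥ r.1} :=
    measurableSet_le measurable_fst (hpm.comp measurable_snd).ennreal_toReal
  have h1 := Measure.prod_apply (μ := volume.restrict (Set.Ioc 0 1)) (ν := μ) hS
  have h2 := Measure.prod_apply_symm (μ := volume.restrict (Set.Ioc 0 1)) (ν := μ) hS
  rw [h1] at h2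
  refine (Eq.trans h2 ?_)
  refine lintegral_congr fun x => ?_
  rw [Measure.restrict_apply (measurable_prodMk_right hS)]
  have : (p x).toReal ≤ 1 := measureReal_le_one
  have e : (fun t : ℝ => (t, x)) ⁻¹' {r : ℝ × 𝒳 | (p r.2).toReal ≥ r.1} ∩ Set.Ioc 0 1
      = Set.Ioc 0 (p x).toReal := by
    ext t
    simp only [Set.mem_inter_iff, Set.mem_preimage, Set.mem_ofPred_eq, Set.mem_Ioc]
    constructor
    · rintro ⟨a, b, c⟩; exact ⟨b, a⟩
    · rintro ⟨a, b⟩; exact ⟨b, a, b.trans this⟩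
  rw [e]
  simp [ENNReal.ofReal_toReal (measure_ne_top _ _), hp]

lemma aux_repr (u : ℝ≥0∞) (hu : u ≤ 1) :
    ENNReal.ofReal (-(u.toReal * Real.log u.toReal)) + u =
      ∫⁻ c in Set.Ioc (0 : ℝ) 1, min u (ENNReal.ofReal c) / ENNReal.ofReal c := by
  lift u to NNReal using (hu.trans_lt ENNReal.one_lt_top).ne
  have hu1 : (u : ℝ) ≤ 1 := by exact_mod_cast hu
  rcases eq_or_ne u 0 with rfl | h0
  · simp
  have hpos : (0:ℝ) < u := by positivity
  rw [← Set.Ioc_union_Ioc_eq_Ioc hpos.le hu1, lintegral_union measurableSet_Ioc (Set.Ioc_disjoint_Ioc_of_le le_rfl), add_comm]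
  congr 1
  · rw [setLIntegral_congr_fun (g := fun _ => 1) measurableSet_Ioc]
    · simp
    · intro c hc
      have h1 : ENNReal.ofReal c ≤ u := by
        rw [← ENNReal.ofReal_coe_nnreal]; exact ENNReal.ofReal_le_ofReal hc.2
      simp only [min_eq_right h1]
      exact ENNReal.div_self (by simpa using hc.1) ENNReal.ofReal_ne_top
  · rw [setLIntegral_congr_fun (g := fun c => ENNReal.ofReal (u * c⁻¹)) measurableSet_Ioc]
    · have hint : IntervalIntegrable (fun c : ℝ => (u:ℝ) * c⁻¹) volume u 1 := by
        apply ContinuousOn.intervalIntegrable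
        rw [Set.uIcc_of_le hu1]
        intro c hc
        have : c ≠ 0 := (hpos.trans_le hc.1).ne'
        exact (continuousAt_const.mul (continuousAt_inv₀ this)).continuousWithinAt
      rw [← ofReal_integral_eq_lintegral_ofReal]
      · rw [← intervalIntegral.integral_of_le hu1, intervalIntegral.integral_const_mul,
          integral_inv_of_pos hpos one_pos]
        simp
      · exact (intervalIntegrable_iff_integrableOn_Ioc_of_le hu1).1 hint
      · filter_upwards [ae_restrict_mem measurableSet_Ioc] with c hc
        have : 0 < c := hpos.trans hc.1
        simp only [Pi.zero_apply]; positivity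
    · intro c hc
      have hc0 : 0 < c := hpos.trans hc.1
      have h1 : (u : ℝ≥0∞) ≤ ENNReal.ofReal c := by
        rw [← ENNReal.ofReal_coe_nnreal]; exact ENNReal.ofReal_le_ofReal hc.1.le
      simp only [min_eq_left h1]
      rw [← ENNReal.ofReal_coe_nnreal, ← ENNReal.ofReal_div_of_pos hc0, div_eq_mul_inv]

lemma aux_key {α : Type*} [MeasurableSpace α] (m : Measure α) [SFinite m] (f : α → ℝ≥0∞)
    (hf : Measurable f) (hf1 : ∀ a, f a ≤ 1) :
    (∫⁻ a, ENNReal.ofReal (-((f a).toReal * Real.log (f a).toReal)) ∂m) + ∫⁻ a, f a ∂m =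
      ∫⁻ c in Set.Ioc (0 : ℝ) 1, (∫⁻ a, min (f a) (ENNReal.ofReal c) ∂m) / ENNReal.ofReal c := by
  rw [← lintegral_add_right _ hf]
  simp_rw [fun a => aux_repr (f a) (hf1 a)]
  rw [lintegral_lintegral_swap]
  · refine lintegral_congr fun c => ?_
    simp_rw [div_eq_mul_inv]
    rw [lintegral_mul_const _ (hf.min measurable_const)]
  · apply Measurable.aemeasurable
    unfold Function.uncurry
    dsimp only
    fun_prop

lemma aux_phi_le {𝒳 𝒵 : Type*} [MeasurableSpace 𝒳] [MeasurableSpace 𝒵]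
    (μ : Measure 𝒳) [IsProbabilityMeasure μ] (κ : Measure 𝒵) [IsProbabilityMeasure κ]
    (A : Set (𝒳 × 𝒵)) (hA : MeasurableSet A) :
    ∫⁻ t in Set.Ioc (0 : ℝ) 1, ENNReal.ofReal (-(
        (μ {x | (κ (Prod.mk x ⁻¹' A)).toReal ≥ t}).toReal *
        Real.log (μ {x | (κ (Prod.mk x ⁻¹' A)).toReal ≥ t}).toReal)) ≤
      ∫⁻ z, ENNReal.ofReal (-((μ ((fun x => (x, z)) ⁻¹' A)).toReal *
        Real.log (μ ((fun x => (x, z)) ⁻¹' A)).toReal)) ∂κ := by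
  have hmean := aux_mean μ κ A hA
  have hmin := fun c => aux_min_le μ κ A hA c
  set q : 𝒵 → ℝ≥0∞ := fun z => μ ((fun x => (x, z)) ⁻¹' A) with hq
  have hqm : Measurable q := measurable_measure_prodMk_right hA
  set F : ℝ → ℝ≥0∞ := fun t => μ {x | (κ (Prod.mk x ⁻¹' A)).toReal ≥ t} with hF
  have hFm : Measurable F := by
    apply Antitone.measurable
    intro s t hst
    exact measure_mono fun x hx => le_trans hst hx
  have h1 := aux_key (volume.restrict (Set.Ioc (0:ℝ) 1)) F hFm (fun a => prob_le_one)
  have h2 := aux_key κ q hqm (fun a => prob_le_one)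
  have h3 : (∫⁻ t in Set.Ioc (0 : ℝ) 1, ENNReal.ofReal (-((F t).toReal * Real.log (F t).toReal)))
      + ∫⁻ z, q z ∂κ ≤ (∫⁻ z, ENNReal.ofReal (-((q z).toReal * Real.log (q z).toReal)) ∂κ)
      + ∫⁻ z, q z ∂κ := by
    rw [h2, ← hmean, h1]
    refine lintegral_mono fun c => ?_
    dsimp only
    gcongr
    exact hmin _
  have hfin : ∫⁻ z, q z ∂κ ≠ ⊤ := by
    refine ((lintegral_mono (g := fun _ => 1) fun z => prob_le_one).trans_lt ?_).ne
    simp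
  exact (ENNReal.add_le_add_iff_right hfin).1 h3

lemma aux_sum {𝒳 𝒴 : Type*} [MeasurableSpace 𝒳] [MeasurableSpace 𝒴] [Countable 𝒴]
    [MeasurableSingletonClass 𝒴] (μ : Measure 𝒳) (g : 𝒳 → 𝒴) (hg : Measurable g)
    (k : 𝒴 → ℝ≥0∞) : ∫⁻ x, k (g x) ∂μ = ∑' y, k y * μ (g ⁻¹' {y}) := by
  rw [← lintegral_map (measurable_of_countable k) hg, lintegral_countable']
  refine tsum_congr fun y => ?_
  rw [Measure.map_apply hg (measurableSet_singleton y)]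

lemma aux_kl {𝒳 𝒵 𝒴 : Type*} [MeasurableSpace 𝒳] [MeasurableSpace 𝒵]
    [MeasurableSpace 𝒴] [Countable 𝒴] [MeasurableSingletonClass 𝒴]
    (μ : Measure 𝒳) [IsProbabilityMeasure μ] (κ : Measure 𝒵) [IsProbabilityMeasure κ]
    (g : 𝒳 × 𝒵 → 𝒴) (hg : Measurable g) :
    ∑' y, ∫⁻ z, ENNReal.ofReal (-((μ ((fun x => (x, z)) ⁻¹' (g ⁻¹' {y}))).toReal *
        Real.logb 2 (μ ((fun x => (x, z)) ⁻¹' (g ⁻¹' {y}))).toReal)) ∂κ ≤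
      klBits ((μ.prod κ).map (fun r => (r.1, (r.2, g r))))
        (μ.prod ((μ.prod κ).map (fun r => (r.2, g r)))) := by
  set q : 𝒵 × 𝒴 → ℝ≥0∞ := fun w => μ ((fun x => (x, w.1)) ⁻¹' (g ⁻¹' {w.2})) with hq
  have hqm : Measurable q := by
    refine measurable_from_prod_countable_left fun y => ?_
    exact measurable_measure_prodMk_right (hg (measurableSet_singleton y))
  have hq1 : ∀ w, q w ≤ 1 := fun w => prob_le_one
  have hgz : ∀ z, Measurable fun x => g (x, z) := fun z => hg.comp measurable_prodMk_right
  have hsum : ∀ (z : 𝒵) (k : 𝒴 → ℝ≥0∞), ∫⁻ x, k (g (x, z)) ∂μ = ∑' y, k y * q (z, y) :=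
    fun z k => aux_sum μ (fun x => g (x, z)) (hgz z) k
  have hT : Measurable (fun r : 𝒳 × 𝒵 => (r.1, (r.2, g r))) := by fun_prop
  have hU : Measurable (fun r : 𝒳 × 𝒵 => (r.2, g r)) := by fun_prop
  set P := (μ.prod κ).map (fun r => (r.1, (r.2, g r))) with hP
  set L := (μ.prod κ).map (fun r => (r.2, g r)) with hR
  have : IsProbabilityMeasure P := Measure.isProbabilityMeasure_map hT.aemeasurable
  have : IsProbabilityMeasure L := Measure.isProbabilityMeasure_map hU.aemeasurable
  have hRint : ∀ h : 𝒵 × 𝒴 → ℝ≥0∞, Measurable h →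
      ∫⁻ w, h w ∂L = ∫⁻ z, ∑' y, h (z, y) * q (z, y) ∂κ := by
    intro h hh
    rw [hR, lintegral_map hh hU, lintegral_prod_symm (fun a => h (a.2, g a)) (hh.comp hU).aemeasurable]
    exact lintegral_congr fun z => hsum z fun y => h (z, y)
  have hS : MeasurableSet {w : 𝒳 × 𝒵 × 𝒴 | g (w.1, w.2.1) = w.2.2} :=
    measurableSet_eq_fun (by fun_prop) (by fun_prop)
  set f : 𝒳 × 𝒵 × 𝒴 → ℝ≥0∞ :=
    {w : 𝒳 × 𝒵 × 𝒴 | g (w.1, w.2.1) = w.2.2}.indicator (fun w => (q w.2)⁻¹) with hf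
  have hfm : Measurable f := (hqm.comp measurable_snd).inv.indicator hS
  have hfT : ∀ r : 𝒳 × 𝒵, f (r.1, (r.2, g r)) = (q (r.2, g r))⁻¹ := by
    intro r
    rw [hf, Set.indicator_of_mem]
    rfl
  have hpos : ∀ᵐ r ∂(μ.prod κ), q (r.2, g r) ≠ 0 := by
    have hm : MeasurableSet {r : 𝒳 × 𝒵 | q (r.2, g r) = 0} :=
      (hqm.comp hU) (measurableSet_singleton 0)
    rw [ae_iff]
    simp only [ne_eq, not_not]
    rw [Measure.prod_apply_symm hm, lintegral_eq_zero_iff (measurable_measure_prodMk_right hm)]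
    refine Filter.Eventually.of_forall fun z => ?_
    have h0 := hsum z (fun y => {y | q (z, y) = 0}.indicator 1 y)
    have e : ∑' y, {y | q (z, y) = 0}.indicator (1 : 𝒴 → ℝ≥0∞) y * q (z, y) = 0 := by
      rw [ENNReal.tsum_eq_zero]
      intro y
      by_cases hy : q (z, y) = 0
      · simp [hy]
      · rw [Set.indicator_of_notMem (s := {y | q (z, y) = 0}) hy, zero_mul]
    rw [e] at h0
    have e2 : (fun x => {y | q (z, y) = 0}.indicator (1 : 𝒴 → ℝ≥0∞) (g (x, z))) =
        ((fun x => (x, z)) ⁻¹' {r : 𝒳 × 𝒵 | q (r.2, g r) = 0}).indicator 1 := by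
      ext x; rfl
    rw [e2, lintegral_indicator_one (measurable_prodMk_right hm)] at h0
    exact h0
  have hPQ : P = (μ.prod L).withDensity f := by
    ext s hs
    rw [withDensity_apply _ hs, ← lintegral_indicator hs,
      lintegral_prod _ (hfm.indicator hs).aemeasurable]
    have e1 : ∀ x, ∫⁻ w, s.indicator f (x, w) ∂L =
        ∫⁻ z, s.indicator 1 (x, z, g (x, z)) * ((q (z, g (x, z)))⁻¹ * q (z, g (x, z))) ∂κ := by
      intro x
      rw [hRint (fun w => s.indicator f (x, w)) ((hfm.indicator hs).comp measurable_prodMk_left)]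
      refine lintegral_congr fun z => ?_
      rw [tsum_eq_single (g (x, z))]
      · have := hfT (x, z)
        by_cases hm : (x, z, g (x, z)) ∈ s
        · simp [hm, this]
        · simp [hm]
      · intro y hy
        have : f (x, z, y) = 0 := by
          rw [hf, Set.indicator_of_notMem]
          exact fun h => hy h.symm
        by_cases hm : (x, z, y) ∈ s
        · simp [hm, this]
        · simp [hm]
    simp_rw [e1]
    rw [← lintegral_prod (f := fun r : 𝒳 × 𝒵 => s.indicator 1 (r.1, r.2, g (r.1, r.2)) *
      ((q (r.2, g (r.1, r.2)))⁻¹ * q (r.2, g (r.1, r.2))))]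
    · rw [hP, ← lintegral_indicator_one hs, lintegral_map (measurable_one.indicator hs) hT]
      refine lintegral_congr_ae ?_
      filter_upwards [hpos] with r hr
      have : (q (r.2, g r))⁻¹ * q (r.2, g r) = 1 :=
        ENNReal.inv_mul_cancel hr ((hq1 _).trans_lt ENNReal.one_lt_top).ne
      simp only [Prod.mk.eta, this, mul_one]
    · have h1 : Measurable (fun r : 𝒳 × 𝒵 => s.indicator (1 : 𝒳 × 𝒵 × 𝒴 → ℝ≥0∞) (r.1, r.2, g r)) :=
        (measurable_one.indicator hs).comp hT
      have h2 := hqm.comp hU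
      exact (h1.mul (h2.inv.mul h2)).aemeasurable
  have hac : P ≪ μ.prod L := by rw [hPQ]; exact withDensity_absolutelyContinuous _ _
  have hrn : P.rnDeriv (μ.prod L) =ᵐ[P] f := by
    apply hac.ae_eq
    have := Measure.rnDeriv_withDensity (μ.prod L) hfm
    rwa [← hPQ] at this
  have hlog : (fun w => Real.logb 2 (P.rnDeriv (μ.prod L) w).toReal) =ᵐ[P]
      fun w => Real.logb 2 (f w).toReal := by
    filter_upwards [hrn] with w hw
    rw [hw]
  unfold klBits
  split_ifs with hc
  · rw [integral_congr_ae hlog, ofReal_integral_eq_lintegral_ofReal (hc.2.congr hlog)]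
    · have hml : Measurable fun w => ENNReal.ofReal (Real.logb 2 (f w).toReal) := by
        unfold Real.logb; fun_prop
      rw [hP, lintegral_map hml hT]
      simp_rw [hfT]
      rw [lintegral_prod_symm]
      · have e : ∀ z, ∫⁻ x, ENNReal.ofReal (Real.logb 2 ((q (z, g (x, z)))⁻¹).toReal) ∂μ =
            ∑' y, ENNReal.ofReal (-((q (z, y)).toReal * Real.logb 2 (q (z, y)).toReal)) := by
          intro z
          rw [hsum z fun y => ENNReal.ofReal (Real.logb 2 ((q (z, y))⁻¹).toReal)]
          refine tsum_congr fun y => ?_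
          rw [ENNReal.toReal_inv, Real.logb_inv]
          have : q (z, y) = ENNReal.ofReal (q (z, y)).toReal :=
            (ENNReal.ofReal_toReal ((hq1 _).trans_lt ENNReal.one_lt_top).ne).symm
          conv_lhs => rw [mul_comm]; enter [1]; rw [this]
          rw [← ENNReal.ofReal_mul ENNReal.toReal_nonneg, mul_neg]
        simp_rw [e]
        rw [lintegral_tsum]
        intro y
        have := hqm.comp (measurable_prodMk_right (y := y))
        have : Measurable fun z => q (z, y) := this
        unfold Real.logb
        fun_prop
      · have := hqm.comp hU
        have : Measurable fun r : 𝒳 × 𝒵 => q (r.2, g r) := this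
        unfold Real.logb
        fun_prop
    · rw [hP]
      refine (ae_map_iff hT.aemeasurable ?_).2 (Filter.Eventually.of_forall fun r => ?_)
      · apply measurableSet_le measurable_zero
        unfold Real.logb; fun_prop
      · simp only [Pi.zero_apply]
        rw [hfT, ENNReal.toReal_inv, Real.logb_inv, neg_nonneg]
        apply Real.logb_nonpos (by norm_num) ENNReal.toReal_nonneg
        exact ENNReal.toReal_le_of_le_ofReal zero_le_one (by simpa using hq1 _)
  · exact le_top

/-- **Lower bound on the excess functional information** (Proposition 1).
For a joint law `ν` of `(X,Y)` with `Y` discrete,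
`Ψ(X→Y) ≥ −Σ_y ∫₀¹ P_X{p_{Y|X}(y|X) ≥ t} log₂ P_X{p_{Y|X}(y|X) ≥ t} dt − I(X;Y)`,
stated additively in `ℝ≥0∞` as `Ψ(X→Y) + I(X;Y) ≥ −Σ_y ∫₀¹ …`.
Here `p_{Y|X}(y|x)` is the conditional pmf given by the disintegration `ν.condKernel`. -/
theorem excessFI_lower_bound
    {𝒳 𝒴 : Type*} [MeasurableSpace 𝒳]
    [MeasurableSpace 𝒴] [Countable 𝒴] [MeasurableSingletonClass 𝒴]
    [StandardBorelSpace 𝒴] [Nonempty 𝒴]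
    (ν : Measure (𝒳 × 𝒴)) [IsProbabilityMeasure ν] :
    excessFI ν + miOfJoint ν ≥
      ∑' y : 𝒴, ∫⁻ t in Set.Ioc (0 : ℝ) 1,
        ENNReal.ofReal
          (-((ν.fst {x | (ν.condKernel x {y}).toReal ≥ t}).toReal *
            Real.logb 2 (ν.fst {x | (ν.condKernel x {y}).toReal ≥ t}).toReal)) := by
  unfold excessFI
  rw [ge_iff_le, ENNReal.sInf_add]
  refine le_iInf₂ fun r hr => ?_
  obtain ⟨ρ, hρ, hmap, hind, ⟨g, hg, hgY⟩, rfl⟩ := hr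
  have hXm : Measurable (fun p : 𝒳 × 𝒴 × ℝ => p.1) := by fun_prop
  have hZm : Measurable (fun p : 𝒳 × 𝒴 × ℝ => p.2.2) := by fun_prop
  have hYm : Measurable (fun p : 𝒳 × 𝒴 × ℝ => p.2.1) := by fun_prop
  have hmi : miOfJoint ν = miBits ρ (fun p : 𝒳 × 𝒴 × ℝ => p.1) (fun p => p.2.1) := by
    unfold miOfJoint miBits
    rw [← hmap, Measure.map_map (by fun_prop) (by fun_prop),
      Measure.map_map (by fun_prop) (by fun_prop), Measure.map_map (by fun_prop) (by fun_prop)]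
    rfl
  rw [hmi]
  unfold cmiBits
  refine le_trans ?_ le_tsub_add
  unfold miBits
  set μ := ρ.map (fun p : 𝒳 × 𝒴 × ℝ => p.1) with hμ
  set κ := ρ.map (fun p : 𝒳 × 𝒴 × ℝ => p.2.2) with hκ
  have : IsProbabilityMeasure μ := Measure.isProbabilityMeasure_map hXm.aemeasurable
  have : IsProbabilityMeasure κ := Measure.isProbabilityMeasure_map hZm.aemeasurable
  have hprod : ρ.map (fun p : 𝒳 × 𝒴 × ℝ => (p.1, p.2.2)) = μ.prod κ :=
    (indepFun_iff_map_prod_eq_prod_map_map hXm.aemeasurable hZm.aemeasurable).1 hind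
  have hP : ρ.map (fun p : 𝒳 × 𝒴 × ℝ => (p.1, (p.2.2, p.2.1))) =
      (μ.prod κ).map (fun r => (r.1, (r.2, g r))) := by
    rw [← hprod, Measure.map_map (by fun_prop) (by fun_prop)]
    refine Measure.map_congr ?_
    filter_upwards [hgY] with p hp
    simp only [Function.comp, hp]
  have hR : ρ.map (fun p : 𝒳 × 𝒴 × ℝ => (p.2.2, p.2.1)) =
      (μ.prod κ).map (fun r => (r.2, g r)) := by
    rw [← hprod, Measure.map_map (by fun_prop) (by fun_prop)]
    refine Measure.map_congr ?_
    filter_upwards [hgY] with p hp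
    simp only [Function.comp, hp]
  have hν : ν = (μ.prod κ).map (fun r => (r.1, g r)) := by
    rw [← hmap, ← hprod, Measure.map_map (by fun_prop) (by fun_prop)]
    refine Measure.map_congr ?_
    filter_upwards [hgY] with p hp
    simp only [Function.comp, hp]
  have hfst : ν.fst = μ := by
    rw [← hmap, Measure.fst, Measure.map_map (by fun_prop) (by fun_prop)]
    rfl
  rw [hP, hR]
  refine le_trans ?_ (aux_kl μ κ g hg)
  refine ENNReal.tsum_le_tsum fun y => ?_
  have hA : MeasurableSet (g ⁻¹' {y}) := hg (measurableSet_singleton y)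
  have hck : ∀ᵐ x ∂μ, ν.condKernel x {y} = κ (Prod.mk x ⁻¹' (g ⁻¹' {y})) := by
    refine ae_eq_of_forall_setLIntegral_eq_of_sigmaFinite
      (Kernel.measurable_coe ν.condKernel (measurableSet_singleton y))
      (measurable_measure_prodMk_left hA) (fun t ht _ => ?_)
    have h1 : ∫⁻ x in t, ν.condKernel x {y} ∂ν.fst = ν (t ×ˢ {y}) :=
      Measure.setLIntegral_condKernel_eq_measure_prod ht (measurableSet_singleton y)
    rw [hfst] at h1
    rw [h1]
    have hm : Measurable (fun r : 𝒳 × ℝ => (r.1, g r)) := by fun_prop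
    rw [hν, Measure.map_apply hm (ht.prod (measurableSet_singleton y)),
      Measure.prod_apply (hm (ht.prod (measurableSet_singleton y))), ← lintegral_indicator ht]
    refine lintegral_congr fun x => ?_
    by_cases hx : x ∈ t
    · rw [Set.indicator_of_mem hx]
      refine congrArg κ ?_
      ext z; simp [hx]
    · rw [Set.indicator_of_notMem hx]
      convert measure_empty (μ := κ)
      ext z; simp [hx]
  have hF : ∀ t : ℝ, ν.fst {x | (ν.condKernel x {y}).toReal ≥ t} =
      μ {x | (κ (Prod.mk x ⁻¹' (g ⁻¹' {y}))).toReal ≥ t} := by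
    intro t
    rw [hfst]
    refine measure_congr ?_
    filter_upwards [hck] with x hx
    exact propext (by
      change (ν.condKernel x {y}).toReal ≥ t ↔ (κ (Prod.mk x ⁻¹' (g ⁻¹' {y}))).toReal ≥ t
      rw [hx])
  simp_rw [hF]
  have hlb : ∀ u : ℝ, ENNReal.ofReal (-(u * Real.logb 2 u)) =
      ENNReal.ofReal (Real.log 2)⁻¹ * ENNReal.ofReal (-(u * Real.log u)) := by
    intro u
    rw [← ENNReal.ofReal_mul (inv_nonneg.2 (Real.log_nonneg (by norm_num)))]
    congr 1
    rw [Real.logb]; ring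
  simp_rw [hlb]
  rw [lintegral_const_mul' _ _ ENNReal.ofReal_ne_top,
    lintegral_const_mul' _ _ ENNReal.ofReal_ne_top]
  exact mul_le_mul' le_rfl (aux_phi_le μ κ _ hA)
end
end

section
/- Near-tightness of the strong functional representation lemma: for every α ≥ 0, there exist jointly distributed discrete random variables X and Y such that I(X;Y) ≥ α and Ψ(X→Y) ≥ log₂(I(X;Y)+1) − 1. -/
open MeasureTheory ProbabilityTheory Real
open scoped ENNReal

noncomputable section
/-! ### Arithmetic part -/

/-- `t log₂ t`. -/
def phiB (n : ℕ) : ℝ := n * Real.logb 2 n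

def delB (n : ℕ) : ℝ := phiB (n + 1) - phiB n

lemma delB_mono : Monotone delB := by
  apply monotone_nat_of_le_succ
  intro n
  have hc := Real.convexOn_mul_log
  have h := hc.2 (show (n : ℝ) ∈ Set.Ici 0 by simp)
    (show (n : ℝ) + 2 ∈ Set.Ici 0 by simp only [Set.mem_Ici]; positivity)
    (show (0 : ℝ) ≤ 1/2 by norm_num) (show (0 : ℝ) ≤ 1/2 by norm_num) (by norm_num)
  simp only [smul_eq_mul] at h
  have e : (1/2 : ℝ) * n + 1/2 * (n + 2) = n + 1 := by ring
  rw [e] at h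
  have hl : 0 < Real.log 2 := Real.log_pos (by norm_num)
  unfold delB phiB Real.logb
  push_cast
  have e2 : (n : ℝ) + 1 + 1 = n + 2 := by ring
  rw [e2, ← sub_nonneg]
  have : ((n : ℝ) + 2) * (Real.log (n + 2) / Real.log 2) - (n + 1) * (Real.log (n + 1) / Real.log 2)
      - ((n + 1) * (Real.log (n + 1) / Real.log 2) - n * (Real.log n / Real.log 2))
      = (2 * (1 / 2 * (n * Real.log n) + 1 / 2 * ((n + 2) * Real.log (n + 2))
        - (n + 1) * Real.log (n + 1))) / Real.log 2 := by
    field_simp; ring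
  rw [this]
  apply div_nonneg _ hl.le
  linarith

lemma phiB_eq_sum (n : ℕ) : phiB n = ∑ i ∈ Finset.range n, delB i := by
  unfold delB
  rw [Finset.sum_range_sub]
  simp [phiB]

lemma sum_range_le_of_mono (f : ℕ → ℝ) (hf : Monotone f) (B : Finset ℕ) :
    ∑ i ∈ Finset.range B.card, f i ≤ ∑ b ∈ B, f b := by
  induction B using Finset.induction_on_max with
  | empty => simp
  | insert a s ha ih =>
    have hn : a ∉ s := fun h => lt_irrefl _ (ha a h)
    rw [Finset.card_insert_of_notMem hn, Finset.sum_range_succ, Finset.sum_insert hn, add_comm]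
    have : s.card ≤ a := by
      have : s ⊆ Finset.range a := fun x hx => Finset.mem_range.2 (ha x hx)
      simpa using Finset.card_le_card this
    exact add_le_add (hf this) ih

lemma sub_mod_injOn (N y : ℕ) : Set.InjOn (fun x => (y + N - x) % N) (Finset.range N) := by
  intro a ha b hb h
  simp only [Finset.coe_range, Set.mem_Iio] at ha hb
  simp only at h
  have h1 : (y + N - a) ≡ (y + N - b) [MOD N] := h
  have h2 : (y + N - a) + (a + b) ≡ (y + N - b) + (a + b) [MOD N] := h1.add_right _
  have e1 : (y + N - a) + (a + b) = (y + N) + b := by omega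
  have e2 : (y + N - b) + (a + b) = (y + N) + a := by omega
  rw [e1, e2] at h2
  have h3 := Nat.ModEq.add_left_cancel' _ h2
  exact (Nat.ModEq.eq_of_lt_of_lt h3 hb ha).symm

lemma sub_mod_injOn' (N x : ℕ) (hx : x < N) :
    Set.InjOn (fun y => (y + N - x) % N) (Finset.range N) := by
  intro a ha b hb h
  simp only [Finset.coe_range, Set.mem_Iio] at ha hb
  have h1 : (a + (N - x)) ≡ (b + (N - x)) [MOD N] := by
    have e1 : a + (N - x) = a + N - x := by omega
    have e2 : b + (N - x) = b + N - x := by omega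
    rw [e1, e2]; exact h
  exact Nat.ModEq.eq_of_lt_of_lt (Nat.ModEq.add_right_cancel' _ h1) ha hb

lemma sum_of_injOn {M : Type*} [AddCommMonoid M] (N : ℕ) (e : ℕ → ℕ)
    (he : Set.InjOn e (Finset.range N)) (hm : ∀ x, e x < N) (F : ℕ → M) :
    ∑ x ∈ Finset.range N, F (e x) = ∑ v ∈ Finset.range N, F v := by
  have : (Finset.range N).image e = Finset.range N := by
    apply Finset.eq_of_subset_of_card_le
    · intro a ha
      obtain ⟨x, -, rfl⟩ := Finset.mem_image.1 ha
      exact Finset.mem_range.2 (hm x)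
    · rw [Finset.card_image_of_injOn he]
  conv_rhs => rw [← this, Finset.sum_image he]

lemma sum_shift_left {M : Type*} [AddCommMonoid M] (N y : ℕ) (hN : 0 < N) (F : ℕ → M) :
    ∑ x ∈ Finset.range N, F ((y + N - x) % N) = ∑ v ∈ Finset.range N, F v :=
  sum_of_injOn N _ (sub_mod_injOn N y) (fun _ => Nat.mod_lt _ hN) F

lemma sum_shift_right {M : Type*} [AddCommMonoid M] (N x : ℕ) (hx : x < N) (F : ℕ → M) :
    ∑ y ∈ Finset.range N, F ((y + N - x) % N) = ∑ v ∈ Finset.range N, F v :=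
  sum_of_injOn N _ (sub_mod_injOn' N x hx) (fun _ => Nat.mod_lt _ (by omega)) F

/-- number of preimages of `y` -/
def cntB (N : ℕ) (g : ℕ → ℕ) (y : ℕ) : ℕ := ((Finset.range N).filter (fun x => g x = y)).card

lemma sum_log_cnt_le (N : ℕ) (g : ℕ → ℕ) :
    ∑ x ∈ Finset.range N, Real.logb 2 (cntB N g (g x))
      ≤ ∑ x ∈ Finset.range N, delB ((g x + N - x) % N) := by
  have hmap : ∀ x ∈ Finset.range N, g x ∈ (Finset.range N).image g :=
    fun x hx => Finset.mem_image_of_mem g hx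
  rw [← Finset.sum_fiberwise_of_maps_to hmap, ← Finset.sum_fiberwise_of_maps_to hmap]
  apply Finset.sum_le_sum
  intro y _
  have h1 : ∑ x ∈ Finset.range N with g x = y, Real.logb 2 (cntB N g (g x)) = phiB (cntB N g y) := by
    rw [Finset.sum_congr rfl (g := fun _ => Real.logb 2 (cntB N g y))]
    · rw [Finset.sum_const, nsmul_eq_mul]; rfl
    · intro x hx
      rw [(Finset.mem_filter.1 hx).2]
  have h2 : ∑ x ∈ Finset.range N with g x = y, delB ((g x + N - x) % N)
      = ∑ x ∈ Finset.range N with g x = y, delB ((y + N - x) % N) := by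
    apply Finset.sum_congr rfl
    intro x hx
    rw [(Finset.mem_filter.1 hx).2]
  have hinj : Set.InjOn (fun x => (y + N - x) % N) ((Finset.range N).filter (fun x => g x = y)) :=
    (sub_mod_injOn N y).mono (by intro x hx; exact (Finset.mem_filter.1 hx).1)
  rw [h1, h2, phiB_eq_sum, ← Finset.sum_image (f := delB) hinj]
  unfold cntB
  rw [← Finset.card_image_of_injOn hinj]
  exact sum_range_le_of_mono _ delB_mono _

/-- unnormalized pmf sums -/
lemma dyadic_sum_succ (k : ℕ) (f : ℕ → ℝ) :
    ∑ v ∈ Finset.range (2 ^ (k + 1)), (1 / 2 : ℝ) ^ (Nat.size v) * f v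
      = ∑ v ∈ Finset.range (2 ^ k), (1 / 2 : ℝ) ^ (Nat.size v) * f v
        + (1 / 2 : ℝ) ^ (k + 1) * ∑ v ∈ Finset.Ico (2 ^ k) (2 ^ (k + 1)), f v := by
  rw [← Finset.sum_range_add_sum_Ico _ (Nat.pow_le_pow_right (by norm_num : 0 < 2) (Nat.le_succ k)),
    Finset.mul_sum]
  congr 1
  apply Finset.sum_congr rfl
  intro v hv
  rw [Finset.mem_Ico] at hv
  have h1 : Nat.size v ≤ k + 1 := Nat.size_le.2 hv.2
  have h2 : k < Nat.size v := Nat.lt_size.2 hv.1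
  have : Nat.size v = k + 1 := by omega
  rw [this]

lemma size_eq_of_mem_Ico {k v : ℕ} (hv : v ∈ Finset.Ico (2 ^ k) (2 ^ (k + 1))) :
    Nat.size v = k + 1 := by
  rw [Finset.mem_Ico] at hv
  have h1 : Nat.size v ≤ k + 1 := Nat.size_le.2 hv.2
  have h2 : k < Nat.size v := Nat.lt_size.2 hv.1
  omega

lemma half_pow_mul (k : ℕ) : (1 / 2 : ℝ) ^ (k + 1) * 2 ^ k = 1 / 2 := by
  rw [pow_succ, mul_right_comm, ← mul_pow]; norm_num

lemma dyadic_S1 (k : ℕ) :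
    ∑ v ∈ Finset.range (2 ^ k), (1 / 2 : ℝ) ^ (Nat.size v) * 1 = (k + 2) / 2 := by
  induction k with
  | zero => simp
  | succ k ih =>
    rw [dyadic_sum_succ, ih]
    have : (2 : ℕ) ^ (k + 1) - 2 ^ k = 2 ^ k := by rw [pow_succ]; omega
    simp only [Finset.sum_const, Nat.card_Ico, this, nsmul_eq_mul, mul_one]
    push_cast
    rw [half_pow_mul]; ring

lemma dyadic_S2 (k : ℕ) :
    ∑ v ∈ Finset.range (2 ^ k), (1 / 2 : ℝ) ^ (Nat.size v) * (Nat.size v : ℝ)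
      = k * (k + 1) / 4 := by
  induction k with
  | zero => simp
  | succ k ih =>
    rw [dyadic_sum_succ, ih]
    have : (2 : ℕ) ^ (k + 1) - 2 ^ k = 2 ^ k := by rw [pow_succ]; omega
    rw [Finset.sum_congr rfl (g := fun _ => (k + 1 : ℝ))
      (fun v hv => by rw [size_eq_of_mem_Ico hv]; push_cast; ring)]
    simp only [Finset.sum_const, Nat.card_Ico, this, nsmul_eq_mul]
    push_cast
    rw [← mul_assoc, half_pow_mul]; ring

lemma phiB_two_pow (k : ℕ) : phiB (2 ^ k) = 2 ^ k * k := by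
  unfold phiB
  push_cast
  rw [Real.logb_pow, Real.logb_self_eq_one (by norm_num), mul_one]

lemma dyadic_S3 (k : ℕ) :
    ∑ v ∈ Finset.range (2 ^ k), (1 / 2 : ℝ) ^ (Nat.size v) * delB v = k * (k + 3) / 4 := by
  induction k with
  | zero => simp [delB, phiB]
  | succ k ih =>
    rw [dyadic_sum_succ, ih]
    rw [Finset.sum_Ico_eq_sub _ (Nat.pow_le_pow_right (by norm_num : 0 < 2) (Nat.le_succ k)),
      ← phiB_eq_sum, ← phiB_eq_sum, phiB_two_pow, phiB_two_pow]
    have e : (1 / 2 : ℝ) ^ (k + 1) * (2 ^ (k + 1) * ((k + 1 : ℕ) : ℝ) - 2 ^ k * k)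
       = ((1 / 2 : ℝ) ^ (k + 1) * 2 ^ k) * (2 * (k + 1) - k) := by
      push_cast; ring
    rw [e, half_pow_mul]
    push_cast; ring

/-- the pmf of `V` -/
def pmfV (k v : ℕ) : ℝ := 2 / (k + 2) * (1 / 2 : ℝ) ^ (Nat.size v)

lemma pmfV_pos (k v : ℕ) : 0 < pmfV k v := by unfold pmfV; positivity

lemma pmfV_sum (k : ℕ) : ∑ v ∈ Finset.range (2 ^ k), pmfV k v = 1 := by
  unfold pmfV
  have := dyadic_S1 k
  simp only [mul_one] at this
  rw [← Finset.mul_sum, this]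
  field_simp

lemma pmfV_del (k : ℕ) :
    ∑ v ∈ Finset.range (2 ^ k), pmfV k v * delB v = k * (k + 3) / (2 * (k + 2)) := by
  unfold pmfV
  simp only [mul_assoc]
  rw [← Finset.mul_sum, dyadic_S3]
  field_simp; ring

lemma pmfV_log (k : ℕ) :
    ∑ v ∈ Finset.range (2 ^ k), pmfV k v * Real.logb 2 ((2 ^ k : ℕ) * pmfV k v)
      = k + 1 - Real.logb 2 (k + 2) - k * (k + 1) / (2 * (k + 2)) := by
  have h : ∀ v, Real.logb 2 ((2 ^ k : ℕ) * pmfV k v)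
      = (k + 1 - Real.logb 2 (k + 2)) - Nat.size v := by
    intro v
    have hk : (k : ℝ) + 2 ≠ 0 := by positivity
    have h2 : (2 : ℝ) / (k + 2) ≠ 0 := by positivity
    unfold pmfV
    push_cast
    rw [Real.logb_mul (by positivity) (by positivity), Real.logb_mul h2 (by positivity),
      Real.logb_div (by norm_num) hk, Real.logb_pow, Real.logb_pow, one_div, Real.logb_inv,
      Real.logb_self_eq_one (by norm_num)]
    ring
  simp only [h, mul_sub]
  simp only [Finset.sum_sub_distrib, ← Finset.sum_mul, pmfV_sum]
  have : ∑ v ∈ Finset.range (2 ^ k), pmfV k v * (Nat.size v : ℝ) = k * (k + 1) / (2 * (k + 2)) := by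
    unfold pmfV
    simp only [mul_assoc]
    rw [← Finset.mul_sum, dyadic_S2]
    field_simp; ring
  rw [this]
  ring

/-! ### Measure part -/

lemma klBits_withDensity {α : Type*} [MeasurableSpace α] (P Q : Measure α) [SigmaFinite Q]
    (h : α → ℝ≥0∞) (hm : Measurable h) (hP : P = Q.withDensity h) :
    (Integrable (fun x => Real.logb 2 (h x).toReal) P →
      klBits P Q = ENNReal.ofReal (∫ x, Real.logb 2 (h x).toReal ∂P)) ∧
    (¬ Integrable (fun x => Real.logb 2 (h x).toReal) P → klBits P Q = ⊤) := by
  have hac : P ≪ Q := by rw [hP]; exact withDensity_absolutelyContinuous _ _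
  have hae : (fun x => Real.logb 2 (P.rnDeriv Q x).toReal)
      =ᵐ[P] (fun x => Real.logb 2 (h x).toReal) := by
    have h1 : P.rnDeriv Q =ᵐ[Q] h := by rw [hP]; exact Measure.rnDeriv_withDensity Q hm
    filter_upwards [hac.ae_eq h1] with x hx
    rw [hx]
  unfold klBits
  rw [integrable_congr hae, integral_congr_ae hae]
  constructor
  · intro hi; rw [if_pos ⟨hac, hi⟩]
  · intro hi; rw [if_neg (fun h => hi h.2)]

def unifB (N : ℕ) : Measure ℕ := (N : ℝ≥0∞)⁻¹ • ∑ x ∈ Finset.range N, Measure.dirac x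

lemma lintegral_unifB (N : ℕ) (f : ℕ → ℝ≥0∞) :
    ∫⁻ x, f x ∂(unifB N) = (N : ℝ≥0∞)⁻¹ * ∑ x ∈ Finset.range N, f x := by
  unfold unifB
  rw [lintegral_smul_measure, lintegral_finsetSum_measure]
  simp [lintegral_dirac]

lemma isProb_unifB (N : ℕ) (hN : 0 < N) : IsProbabilityMeasure (unifB N) := by
  constructor
  rw [← lintegral_one, lintegral_unifB]
  simp only [Finset.sum_const, Finset.card_range, nsmul_eq_mul, mul_one]
  exact ENNReal.inv_mul_cancel (by exact_mod_cast hN.ne') (ENNReal.natCast_ne_top N)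

lemma integral_unifB (N : ℕ) (f : ℕ → ℝ) :
    ∫ x, f x ∂(unifB N) = (N : ℝ)⁻¹ * ∑ x ∈ Finset.range N, f x := by
  unfold unifB
  rw [integral_smul_measure, integral_finsetSum_measure]
  · simp [integral_dirac]
  · intro i _
    exact integrable_dirac (by simp)

/-- the joint law of `(X, Y)` -/
def nuB (k : ℕ) : Measure (ℕ × ℕ) :=
  ∑ x ∈ Finset.range (2 ^ k), ∑ y ∈ Finset.range (2 ^ k),
    ENNReal.ofReal (((2 ^ k : ℕ) : ℝ)⁻¹ * pmfV k ((y + 2 ^ k - x) % 2 ^ k)) • Measure.dirac (x, y)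

lemma lintegral_nuB (k : ℕ) (f : ℕ × ℕ → ℝ≥0∞) :
    ∫⁻ q, f q ∂(nuB k) = ∑ x ∈ Finset.range (2 ^ k), ∑ y ∈ Finset.range (2 ^ k),
      ENNReal.ofReal (((2 ^ k : ℕ) : ℝ)⁻¹ * pmfV k ((y + 2 ^ k - x) % 2 ^ k)) * f (x, y) := by
  unfold nuB
  simp only [lintegral_finsetSum_measure, lintegral_smul_measure, lintegral_dirac, smul_eq_mul]

lemma integrable_nuB (k : ℕ) (f : ℕ × ℕ → ℝ) : Integrable f (nuB k) := by
  unfold nuB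
  simp only [integrable_finsetSum_measure]
  intro x _ y _
  exact (integrable_dirac (by simp)).smul_measure ENNReal.ofReal_ne_top

lemma integral_nuB (k : ℕ) (f : ℕ → ℝ) :
    ∫ q, f ((q.2 + 2 ^ k - q.1) % 2 ^ k) ∂(nuB k)
      = ∑ v ∈ Finset.range (2 ^ k), pmfV k v * f v := by
  have hd : ∀ x y : ℕ, Integrable (fun q : ℕ × ℕ => f ((q.2 + 2 ^ k - q.1) % 2 ^ k))
      (ENNReal.ofReal (((2 ^ k : ℕ) : ℝ)⁻¹ * pmfV k ((y + 2 ^ k - x) % 2 ^ k))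
        • Measure.dirac (x, y)) := fun x y =>
    (integrable_dirac (by simp)).smul_measure ENNReal.ofReal_ne_top
  unfold nuB
  rw [integral_finsetSum_measure
    (fun x _ => integrable_finsetSum_measure.2 (fun y _ => hd x y))]
  have : ∀ x ∈ Finset.range (2 ^ k),
      ∫ q, f ((q.2 + 2 ^ k - q.1) % 2 ^ k) ∂(∑ y ∈ Finset.range (2 ^ k),
    ENNReal.ofReal (((2 ^ k : ℕ) : ℝ)⁻¹ * pmfV k ((y + 2 ^ k - x) % 2 ^ k)) • Measure.dirac (x, y))
      = ((2 ^ k : ℕ) : ℝ)⁻¹ * ∑ v ∈ Finset.range (2 ^ k), pmfV k v * f v := by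
    intro x hx
    rw [integral_finsetSum_measure (fun y _ => hd x y),
      ← sum_shift_right (2 ^ k) x (Finset.mem_range.1 hx) (fun v => pmfV k v * f v), Finset.mul_sum]
    apply Finset.sum_congr rfl
    intro y _
    rw [integral_smul_measure, integral_dirac, ENNReal.toReal_ofReal, smul_eq_mul, mul_assoc]
    exact mul_nonneg (by positivity) (pmfV_pos k ((y + 2 ^ k - x) % 2 ^ k)).le
  rw [Finset.sum_congr rfl this, Finset.sum_const, Finset.card_range, nsmul_eq_mul, ← mul_assoc,
    mul_inv_cancel₀ (by positivity), one_mul]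

lemma ofReal_inv_pow (k : ℕ) (a : ℝ) :
    ENNReal.ofReal (((2 ^ k : ℕ) : ℝ)⁻¹ * a) = ((2 ^ k : ℕ) : ℝ≥0∞)⁻¹ * ENNReal.ofReal a := by
  rw [ENNReal.ofReal_mul (by positivity), ENNReal.ofReal_inv_of_pos (by positivity),
    ENNReal.ofReal_natCast]

lemma sum_ofReal_pmfV (k : ℕ) :
    ∑ v ∈ Finset.range (2 ^ k), ENNReal.ofReal (pmfV k v) = 1 := by
  rw [← ENNReal.ofReal_sum_of_nonneg (fun v _ => (pmfV_pos k v).le), pmfV_sum, ENNReal.ofReal_one]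

lemma nuB_fst (k : ℕ) : (nuB k).map Prod.fst = unifB (2 ^ k) := by
  apply Measure.ext_of_lintegral
  intro f hf
  rw [lintegral_map hf measurable_fst, lintegral_nuB, lintegral_unifB, Finset.mul_sum]
  apply Finset.sum_congr rfl
  intro x hx
  simp only [ofReal_inv_pow]
  rw [← Finset.sum_mul, ← Finset.mul_sum,
    sum_shift_right (2 ^ k) x (Finset.mem_range.1 hx) (fun v => ENNReal.ofReal (pmfV k v)),
    sum_ofReal_pmfV, mul_one]

lemma nuB_snd (k : ℕ) : (nuB k).map Prod.snd = unifB (2 ^ k) := by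
  apply Measure.ext_of_lintegral
  intro f hf
  rw [lintegral_map hf measurable_snd, lintegral_nuB, lintegral_unifB, Finset.mul_sum,
    Finset.sum_comm]
  apply Finset.sum_congr rfl
  intro y hy
  simp only [ofReal_inv_pow]
  rw [← Finset.sum_mul, ← Finset.mul_sum,
    sum_shift_left (2 ^ k) y (by positivity) (fun v => ENNReal.ofReal (pmfV k v)),
    sum_ofReal_pmfV, mul_one]

lemma isProb_nuB (k : ℕ) : IsProbabilityMeasure (nuB k) := by
  have := isProb_unifB (2 ^ k) (by positivity)
  rw [← nuB_fst k] at this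
  exact (Measure.isProbabilityMeasure_map_iff measurable_fst.aemeasurable).1 this

lemma nuB_withDensity (k : ℕ) : nuB k = ((unifB (2 ^ k)).prod (unifB (2 ^ k))).withDensity
    (fun q => ENNReal.ofReal ((2 ^ k : ℕ) * pmfV k ((q.2 + 2 ^ k - q.1) % 2 ^ k))) := by
  have := isProb_unifB (2 ^ k) (by positivity)
  have hm : ∀ f : ℕ × ℕ → ℝ≥0∞, Measurable f := fun f => measurable_of_countable f
  apply Measure.ext_of_lintegral
  intro f hf
  rw [lintegral_withDensity_eq_lintegral_mul _ (hm _) hf, lintegral_prod _ (hm _).aemeasurable,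
    lintegral_nuB, lintegral_unifB, Finset.mul_sum]
  apply Finset.sum_congr rfl
  intro x _
  rw [lintegral_unifB, ← mul_assoc, Finset.mul_sum]
  apply Finset.sum_congr rfl
  intro y _
  simp only [Pi.mul_apply]
  rw [ofReal_inv_pow, ENNReal.ofReal_mul (by positivity), ENNReal.ofReal_natCast]
  have h0 : ((2 ^ k : ℕ) : ℝ≥0∞) ≠ 0 := by simp
  have ht : ((2 ^ k : ℕ) : ℝ≥0∞) ≠ ⊤ := ENNReal.natCast_ne_top _
  generalize ((2 ^ k : ℕ) : ℝ≥0∞) = c at *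
  have : c⁻¹ * c = 1 := ENNReal.inv_mul_cancel h0 ht
  calc _ = (c⁻¹ * 1) * ENNReal.ofReal (pmfV k ((y + 2 ^ k - x) % 2 ^ k)) * f (x, y) := by ring
    _ = _ := by rw [← this]; ring

lemma miOfJoint_nuB (k : ℕ) : miOfJoint (nuB k) = ENNReal.ofReal
    (k + 1 - Real.logb 2 (k + 2) - k * (k + 1) / (2 * (k + 2))) := by
  have := isProb_unifB (2 ^ k) (by positivity)
  have h := (klBits_withDensity _ _ _ (measurable_of_countable _) (nuB_withDensity k)).1
    (integrable_nuB k _)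
  unfold miOfJoint miBits
  rw [nuB_fst, nuB_snd]
  have e : (fun ω : ℕ × ℕ => (ω.1, ω.2)) = id := rfl
  rw [e, Measure.map_id, h, ← pmfV_log]
  congr 1
  rw [← integral_nuB k (fun v => Real.logb 2 ((2 ^ k : ℕ) * pmfV k v))]
  congr 1
  ext q
  rw [ENNReal.toReal_ofReal]
  exact mul_nonneg (by positivity) (pmfV_pos _ _).le

/-- the density of `(X,(Z,Y))` with respect to the product of the marginals -/
def densB (N : ℕ) (g : ℕ × ℝ → ℕ) (q : ℕ × (ℝ × ℕ)) : ℝ≥0∞ :=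
  if g (q.1, q.2.1) = q.2.2 then (N : ℝ≥0∞) / (cntB N (fun x => g (x, q.2.1)) q.2.2 : ℝ≥0∞) else 0

lemma measurable_densB (N : ℕ) (g : ℕ × ℝ → ℕ) (hg : Measurable g) : Measurable (densB N g) := by
  unfold densB
  have hc : Measurable (fun q : ℕ × (ℝ × ℕ) =>
      (cntB N (fun x => g (x, q.2.1)) q.2.2 : ℝ≥0∞)) := by
    unfold cntB
    simp only [Finset.card_filter, Nat.cast_sum]
    apply Finset.measurable_sum
    intro x _
    apply Measurable.comp (g := fun n : ℕ => (n : ℝ≥0∞)) (measurable_of_countable _)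
    apply Measurable.ite _ measurable_const measurable_const
    exact measurableSet_eq_fun (hg.comp (by fun_prop)) (by fun_prop)
  apply Measurable.ite _ (measurable_const.div hc) measurable_const
  exact measurableSet_eq_fun (hg.comp (by fun_prop)) (by fun_prop)

lemma cntB_pos (N : ℕ) (g : ℕ → ℕ) (x : ℕ) (hx : x < N) : 0 < cntB N g (g x) :=
  Finset.card_pos.2 ⟨x, Finset.mem_filter.2 ⟨Finset.mem_range.2 hx, rfl⟩⟩

lemma dens_sum (N : ℕ) (hN : 0 < N) (g : ℕ × ℝ → ℕ) (f : ℕ × (ℝ × ℕ) → ℝ≥0∞) (x : ℕ) (hx : x < N)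
    (z : ℝ) :
    (N : ℝ≥0∞)⁻¹ * ∑ x' ∈ Finset.range N, densB N g (x, (z, g (x', z))) * f (x, (z, g (x', z)))
      = f (x, (z, g (x, z))) := by
  have h1 : ∀ x' ∈ Finset.range N, densB N g (x, (z, g (x', z))) * f (x, (z, g (x', z)))
      = if g (x', z) = g (x, z) then (N : ℝ≥0∞) / (cntB N (fun x => g (x, z)) (g (x, z)) : ℝ≥0∞)
          * f (x, (z, g (x, z))) else 0 := by
    intro x' _
    unfold densB
    by_cases h : g (x', z) = g (x, z)
    · simp [h]
    · simp [h, Ne.symm h]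
  rw [Finset.sum_congr rfl h1, ← Finset.sum_filter, Finset.sum_const, nsmul_eq_mul]
  have hc := cntB_pos N (fun x => g (x, z)) x hx
  have hcd : (((Finset.range N).filter (fun x' => g (x', z) = g (x, z))).card : ℝ≥0∞)
      = (cntB N (fun x => g (x, z)) (g (x, z)) : ℝ≥0∞) := rfl
  rw [hcd]
  have hc0 : (cntB N (fun x => g (x, z)) (g (x, z)) : ℝ≥0∞) ≠ 0 := by exact_mod_cast hc.ne'
  have hct : (cntB N (fun x => g (x, z)) (g (x, z)) : ℝ≥0∞) ≠ ⊤ := ENNReal.natCast_ne_top _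
  have hN0 : (N : ℝ≥0∞) ≠ 0 := by exact_mod_cast hN.ne'
  have hNt : (N : ℝ≥0∞) ≠ ⊤ := ENNReal.natCast_ne_top _
  generalize (cntB N (fun x => g (x, z)) (g (x, z)) : ℝ≥0∞) = c at *
  generalize (N : ℝ≥0∞) = n at *
  rw [ENNReal.div_eq_inv_mul]
  calc _ = (n⁻¹ * n) * (c⁻¹ * c) * f (x, (z, g (x, z))) := by ring
    _ = _ := by rw [ENNReal.inv_mul_cancel hN0 hNt, ENNReal.inv_mul_cancel hc0 hct]; simp

lemma main_withDensity (N : ℕ) (hN : 0 < N) (ζ : Measure ℝ) [IsProbabilityMeasure ζ]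
    (g : ℕ × ℝ → ℕ) (hg : Measurable g) :
    ((unifB N).prod ζ).map (fun p => (p.1, (p.2, g p)))
      = ((unifB N).prod (((unifB N).prod ζ).map (fun p => (p.2, g p)))).withDensity
          (densB N g) := by
  have := isProb_unifB N hN
  have hT : Measurable (fun p : ℕ × ℝ => (p.1, (p.2, g p))) := by fun_prop
  have hS : Measurable (fun p : ℕ × ℝ => (p.2, g p)) := by fun_prop
  have hd := measurable_densB N g hg
  apply Measure.ext_of_lintegral
  intro f hf
  rw [lintegral_map hf hT, lintegral_prod (fun p : ℕ × ℝ => f (p.1, (p.2, g p))) (hf.comp hT).aemeasurable,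
    lintegral_unifB,
    lintegral_withDensity_eq_lintegral_mul _ hd hf,
    lintegral_prod _ (hd.mul hf).aemeasurable, lintegral_unifB]
  congr 1
  apply Finset.sum_congr rfl
  intro x hx
  have hdf : Measurable (densB N g * f) := hd.mul hf
  have hdx : Measurable (fun q : ℝ × ℕ => (densB N g * f) (x, q)) := hdf.comp (by fun_prop)
  rw [lintegral_map hdx hS, lintegral_prod (fun p : ℕ × ℝ => (densB N g * f) (x, (p.2, g p)))
    (hdx.comp hS).aemeasurable, lintegral_unifB,
    ← lintegral_finsetSum, ← lintegral_const_mul]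
  · apply lintegral_congr
    intro z
    exact (dens_sum N hN g f x (Finset.mem_range.1 hx) z).symm
  · apply Finset.measurable_sum
    intro x' _
    exact (hdx.comp hS).comp (by fun_prop)
  · intro x' _
    exact (hdx.comp hS).comp (by fun_prop)

lemma measurable_comp_two (F : ℕ → ℕ → ℝ) (g : ℕ × ℝ → ℕ) (hg : Measurable g) :
    Measurable (fun p : ℕ × ℝ => F (g p) p.1) := by
  have h1 : Measurable (fun q : ℕ × ℕ => F q.1 q.2) := measurable_of_countable _
  have h2 : Measurable (fun p : ℕ × ℝ => (g p, p.1)) := hg.prodMk measurable_fst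
  exact Measurable.comp h1 h2

lemma measurable_delB_comp (N : ℕ) (g : ℕ × ℝ → ℕ) (hg : Measurable g) :
    Measurable (fun p : ℕ × ℝ => delB ((g p + N - p.1) % N)) := by
  exact measurable_comp_two (fun y x => delB ((y + N - x) % N)) g hg

set_option maxHeartbeats 1000000 in
lemma main_lower (k : ℕ) (ρ : Measure (ℕ × ℕ × ℝ)) [IsProbabilityMeasure ρ]
    (hν : ρ.map (fun p => (p.1, p.2.1)) = nuB k)
    (hind : IndepFun (fun p : ℕ × ℕ × ℝ => p.1) (fun p => p.2.2) ρ)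
    (g : ℕ × ℝ → ℕ) (hg : Measurable g)
    (hY : (fun p : ℕ × ℕ × ℝ => p.2.1) =ᵐ[ρ] fun p => g (p.1, p.2.2)) :
    ENNReal.ofReal (k - k * (k + 3) / (2 * (k + 2)))
      ≤ miBits ρ (fun p : ℕ × ℕ × ℝ => p.1) (fun p => (p.2.2, p.2.1)) := by
  obtain ⟨N, hNdef⟩ : ∃ N, N = 2 ^ k := ⟨_, rfl⟩
  have hN : 0 < N := by rw [hNdef]; positivity
  have hU := isProb_unifB N hN
  have hX : ρ.map (fun p : ℕ × ℕ × ℝ => p.1) = unifB N := by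
    rw [hNdef, ← nuB_fst k, ← hν, Measure.map_map measurable_fst (by fun_prop)]; rfl
  set ζ := ρ.map (fun p : ℕ × ℕ × ℝ => p.2.2) with hζ
  have hζp : IsProbabilityMeasure ζ := Measure.isProbabilityMeasure_map (by fun_prop)
  have hXZ : ρ.map (fun p : ℕ × ℕ × ℝ => (p.1, p.2.2)) = (unifB N).prod ζ := by
    rw [← hX]
    exact (indepFun_iff_map_prod_eq_prod_map_map (by fun_prop) (by fun_prop)).1 hind
  have hT : Measurable (fun p : ℕ × ℝ => (p.1, (p.2, g p))) := by fun_prop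
  have hS : Measurable (fun p : ℕ × ℝ => (p.2, g p)) := by fun_prop
  have hP : ρ.map (fun p : ℕ × ℕ × ℝ => (p.1, (p.2.2, p.2.1)))
      = ((unifB N).prod ζ).map (fun p => (p.1, (p.2, g p))) := by
    rw [← hXZ, Measure.map_map hT (by fun_prop)]
    apply Measure.map_congr
    filter_upwards [hY] with p hp
    simp only [Function.comp, hp]
  have hQ : ρ.map (fun p : ℕ × ℕ × ℝ => (p.2.2, p.2.1))
      = ((unifB N).prod ζ).map (fun p => (p.2, g p)) := by
    rw [← hXZ, Measure.map_map hS (by fun_prop)]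
    apply Measure.map_congr
    filter_upwards [hY] with p hp
    simp only [Function.comp, hp]
  have hprobQ : IsProbabilityMeasure (((unifB N).prod ζ).map (fun p => (p.2, g p))) :=
    Measure.isProbabilityMeasure_map hS.aemeasurable
  unfold miBits
  rw [hP, hX, hQ]
  obtain ⟨k1, k2⟩ := klBits_withDensity _ _ _ (measurable_densB N g hg)
    (main_withDensity N hN ζ g hg)
  by_cases hi : Integrable (fun x => Real.logb 2 (densB N g x).toReal)
      (((unifB N).prod ζ).map (fun p => (p.1, (p.2, g p))))
  swap
  · rw [k2 hi]; exact le_top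
  rw [k1 hi]
  apply ENNReal.ofReal_le_ofReal
  rw [integral_map hT.aemeasurable hi.aestronglyMeasurable]
  have hi' : Integrable (fun p : ℕ × ℝ => Real.logb 2 (densB N g (p.1, (p.2, g p))).toReal)
      ((unifB N).prod ζ) := (integrable_map_measure hi.aestronglyMeasurable hT.aemeasurable).1 hi
  have hDm := measurable_delB_comp N g hg
  have hD : Integrable (fun p : ℕ × ℝ => delB ((g p + N - p.1) % N)) ((unifB N).prod ζ) := by
    apply Integrable.of_bound hDm.aestronglyMeasurable (|delB 0| + |delB N|)
    filter_upwards with p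
    have h1 := delB_mono (Nat.zero_le ((g p + N - p.1) % N))
    have h2 := delB_mono (Nat.mod_lt (g p + N - p.1) hN).le
    rw [Real.norm_eq_abs, abs_le]
    have := neg_abs_le (delB 0)
    have := le_abs_self (delB N)
    have := abs_nonneg (delB 0)
    have := abs_nonneg (delB N)
    constructor <;> linarith
  have hDval : ∫ p, delB ((g p + N - p.1) % N) ∂((unifB N).prod ζ)
      = k * (k + 3) / (2 * (k + 2)) := by
    rw [← pmfV_del, ← integral_nuB k delB, ← hν, ← hXZ,
      integral_map (by fun_prop) hDm.aestronglyMeasurable,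
      integral_map (by fun_prop) (measurable_of_countable _).aestronglyMeasurable]
    apply integral_congr_ae
    filter_upwards [hY] with p hp
    simp only [hp, ← hNdef]
  have key : (k : ℝ) ≤ ∫ p, (Real.logb 2 (densB N g (p.1, (p.2, g p))).toReal
      + delB ((g p + N - p.1) % N)) ∂((unifB N).prod ζ) := by
    have hsum := hi'.add hD
    have hsum' : Integrable (fun p : ℕ × ℝ => Real.logb 2 (densB N g (p.1, (p.2, g p))).toReal
      + delB ((g p + N - p.1) % N)) ((unifB N).prod ζ) := hsum
    rw [integral_prod_symm _ hsum']
    have hc : (k : ℝ) = ∫ z, (k : ℝ) ∂ζ := by simp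
    rw [hc]
    apply integral_mono (integrable_const _) hsum'.integral_prod_right
    intro z
    simp only
    rw [integral_unifB, Finset.sum_add_distrib]
    have hl : ∑ x ∈ Finset.range N, Real.logb 2 (densB N g (x, (z, g (x, z)))).toReal
        = N * k - ∑ x ∈ Finset.range N, Real.logb 2 (cntB N (fun x => g (x, z)) (g (x, z))) := by
      have : ∀ x ∈ Finset.range N, Real.logb 2 (densB N g (x, (z, g (x, z)))).toReal
          = k - Real.logb 2 (cntB N (fun x => g (x, z)) (g (x, z))) := by
        intro x hx
        have hc := cntB_pos N (fun x => g (x, z)) x (Finset.mem_range.1 hx)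
        unfold densB
        simp only [if_true]
        rw [ENNReal.toReal_div, ENNReal.toReal_natCast, ENNReal.toReal_natCast,
          Real.logb_div (by positivity) (by exact_mod_cast hc.ne'), hNdef]
        push_cast
        rw [Real.logb_pow, Real.logb_self_eq_one (by norm_num), mul_one]
      rw [Finset.sum_congr rfl this, Finset.sum_sub_distrib, Finset.sum_const, Finset.card_range,
        nsmul_eq_mul]
    have hle := sum_log_cnt_le N (fun x => g (x, z))
    rw [hl]
    have hNr : (0 : ℝ) < N := by exact_mod_cast hN
    rw [inv_mul_eq_div, le_div_iff₀ hNr]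
    linarith
  rw [integral_add hi' hD, hDval] at key
  linarith

lemma excess_lower (k : ℕ) :
    ENNReal.ofReal (k - k * (k + 3) / (2 * (k + 2))) - miOfJoint (nuB k) ≤ excessFI (nuB k) := by
  unfold excessFI
  apply le_sInf
  rintro r ⟨ρ, hρ, hν, hind, ⟨g, hg, hY⟩, rfl⟩
  unfold cmiBits
  have e : miBits ρ (fun p : ℕ × ℕ × ℝ => p.1) (fun p => p.2.1) = miOfJoint (nuB k) := by
    unfold miOfJoint miBits
    rw [← hν, Measure.map_map measurable_fst (by fun_prop),
      Measure.map_map measurable_snd (by fun_prop), Measure.map_map (by fun_prop) (by fun_prop)]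
    rfl
  rw [e]
  exact tsub_le_tsub_right (main_lower k ρ hν hind g hg hY) _

/-- **Near-tightness of the strong functional representation lemma** (Proposition 2).
For every `α ≥ 0` there exist jointly distributed discrete random variables `(X,Y)`
(realized here as a joint law on `ℕ × ℕ`) with `I(X;Y) ≥ α` and
`Ψ(X→Y) ≥ log₂(I(X;Y)+1) − 1`. -/
theorem excessFI_log_term_necessary (α : ℝ) (hα : 0 ≤ α) :
    ∃ ν : Measure (ℕ × ℕ), IsProbabilityMeasure ν ∧
      miOfJoint ν ≠ ⊤ ∧
      ENNReal.ofReal α ≤ miOfJoint ν ∧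
      ENNReal.ofReal (Real.logb 2 ((miOfJoint ν).toReal + 1) - 1) ≤ excessFI ν := by
  obtain ⟨t0, ht0⟩ := exists_nat_ge α
  set t := t0 + 1 with ht
  have htα : α ≤ t := by rw [ht]; push_cast; linarith
  have hB : (1 : ℝ) + t * 3 ≤ 4 ^ t := by
    have := one_add_mul_le_pow (a := (3 : ℝ)) (by norm_num) t
    norm_num at this
    exact this
  have ht1 : (1 : ℝ) ≤ t := by rw [ht]; push_cast; linarith [(Nat.cast_nonneg t0 : (0 : ℝ) ≤ t0)]
  obtain ⟨k, hk⟩ : ∃ k : ℕ, k + 2 = 2 ^ (2 * t + 1) := by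
    refine ⟨2 ^ (2 * t + 1) - 2, Nat.sub_add_cancel ?_⟩
    exact Nat.le_self_pow (by omega) 2
  have hkr : (k : ℝ) + 2 = 2 ^ (2 * t + 1) := by exact_mod_cast hk
  have hk4 : (k : ℝ) + 2 = 2 * 4 ^ t := by
    rw [hkr, pow_succ, pow_mul]; norm_num; ring
  have hlog : Real.logb 2 ((k : ℝ) + 2) = 2 * t + 1 := by
    rw [hkr, Real.logb_pow, Real.logb_self_eq_one (by norm_num)]; push_cast; ring
  have hk2 : (0 : ℝ) < k + 2 := by positivity
  have hI : miOfJoint (nuB k) = ENNReal.ofReal (k - 2 * t - k * (k + 1) / (2 * (k + 2))) := by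
    rw [miOfJoint_nuB, hlog]; congr 1; ring
  have hfr : (k : ℝ) * (k + 1) / (2 * (k + 2)) = (k - 1) / 2 + 1 / (k + 2) := by
    field_simp; ring
  have hfr2 : (k : ℝ) * (k + 3) / (2 * (k + 2)) = (k + 1) / 2 - 1 / (k + 2) := by
    field_simp; ring
  have hinv : 1 / ((k : ℝ) + 2) ≤ 1 / 2 :=
    one_div_le_one_div_of_le (by norm_num) (by linarith [(Nat.cast_nonneg k : (0 : ℝ) ≤ k)])
  have hinv0 : 0 < 1 / ((k : ℝ) + 2) := by positivity
  have hIα : α ≤ k - 2 * t - k * (k + 1) / (2 * (k + 2)) := by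
    rw [hfr]; linarith
  refine ⟨nuB k, isProb_nuB k, ?_, ?_, ?_⟩
  · rw [hI]; exact ENNReal.ofReal_ne_top
  · rw [hI]; exact ENNReal.ofReal_le_ofReal hIα
  · refine le_trans ?_ (excess_lower k)
    rw [hI, ENNReal.toReal_ofReal (hα.trans hIα), ← ENNReal.ofReal_sub _ (hα.trans hIα)]
    apply ENNReal.ofReal_le_ofReal
    have h1 : Real.logb 2 (k - 2 * t - k * (k + 1) / (2 * (k + 2)) + 1)
        ≤ Real.logb 2 ((k + 2) / 2) := by
      apply Real.logb_le_logb_of_le (by norm_num) (by linarith)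
      rw [hfr]; linarith
    rw [Real.logb_div hk2.ne' (by norm_num), hlog, Real.logb_self_eq_one (by norm_num)] at h1
    rw [hfr, hfr2] at *
    linarith
end
end

section
/- Upper bound of excess functional information by common entropy: for any jointly distributed X and Y, Ψ(X→Y) ≤ G(X;Y) − I(X;Y) ≤ min{ H(X|Y), H(Y|X) }, where G(X;Y) = min H(W) over all random variables W such that X and Y are conditionally independent given W. -/
open MeasureTheory ProbabilityTheory Real
open scoped ENNReal

noncomputable section
open MeasurableSpace in
/-- **Common entropy** `G(X;Y)` of a joint law `ν` on `𝒳 × 𝒴`: the infimum of `H(W)` over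
all random variables `W` such that `X ⫫ Y | W`, realized on the canonical extension
`𝒳 × 𝒴 × ℝ` of the joint law. -/
noncomputable def commonEntropy {𝒳 𝒴 : Type*}
    [TopologicalSpace 𝒳] [PolishSpace 𝒳] [MeasurableSpace 𝒳] [BorelSpace 𝒳] [Nonempty 𝒳]
    [TopologicalSpace 𝒴] [PolishSpace 𝒴] [MeasurableSpace 𝒴] [BorelSpace 𝒴] [Nonempty 𝒴]
    (ν : Measure (𝒳 × 𝒴)) : ℝ≥0∞ :=
  sInf { r : ℝ≥0∞ |
    ∃ (ρ : Measure (𝒳 × 𝒴 × ℝ)) (_ : IsProbabilityMeasure ρ),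
      ρ.map (fun p => (p.1, p.2.1)) = ν ∧
      CondIndepFun (MeasurableSpace.comap (fun p : 𝒳 × 𝒴 × ℝ => p.2.2) inferInstance)
        (measurable_snd.snd.comap_le)
        (fun p : 𝒳 × 𝒴 × ℝ => p.1) (fun p => p.2.1) ρ ∧
      r = entBits ρ (fun p : 𝒳 × 𝒴 × ℝ => p.2.2) }

lemma klBits_eq {α : Type*} [MeasurableSpace α] (P Q : Measure α) [IsProbabilityMeasure P]
    [IsProbabilityMeasure Q] :
    klBits P Q = ENNReal.ofReal (Real.log 2)⁻¹ * InformationTheory.klDiv P Q := by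
  have h2 : 0 < Real.log 2 := Real.log_pos (by norm_num)
  have hfun : (fun x => Real.logb 2 (P.rnDeriv Q x).toReal)
      = fun x => (Real.log 2)⁻¹ * llr P Q x := by
    funext x
    simp [Real.logb, llr, div_eq_inv_mul]
  unfold klBits
  rw [hfun]
  by_cases h : P ≪ Q ∧ Integrable (llr P Q) P
  · have h' : P ≪ Q ∧ Integrable (fun x => (Real.log 2)⁻¹ * llr P Q x) P :=
      ⟨h.1, h.2.const_mul _⟩
    rw [if_pos h', InformationTheory.klDiv_of_ac_of_integrable h.1 h.2, integral_const_mul,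
      ENNReal.ofReal_mul (by positivity)]
    simp
  · have h' : ¬ (P ≪ Q ∧ Integrable (fun x => (Real.log 2)⁻¹ * llr P Q x) P) := by
      rintro ⟨ha, hi⟩
      refine h ⟨ha, ?_⟩
      have := hi.const_mul (Real.log 2)
      simpa [← mul_assoc, h2.ne'] using this
    rw [if_neg h']
    have : InformationTheory.klDiv P Q = ⊤ := by
      by_contra hne
      exact h (InformationTheory.klDiv_ne_top_iff.1 hne)
    rw [this, ENNReal.mul_top]
    simpa using h2

lemma klBits_le_of {α β : Type*} [MeasurableSpace α] [MeasurableSpace β]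
    (P Q : Measure α) (P' Q' : Measure β) [IsProbabilityMeasure P]
    [IsProbabilityMeasure Q] [IsProbabilityMeasure P'] [IsProbabilityMeasure Q']
    (h : InformationTheory.klDiv P Q ≤ InformationTheory.klDiv P' Q') :
    klBits P Q ≤ klBits P' Q' := by
  rw [klBits_eq, klBits_eq]
  gcongr

/-- Data processing for mutual information and measurable maps. -/
lemma miBits_comp_le {Ω α β α' β' : Type*} [MeasurableSpace Ω] [MeasurableSpace α]
    [MeasurableSpace β] [MeasurableSpace α'] [MeasurableSpace β']
    (μ : Measure Ω) [IsProbabilityMeasure μ] {X : Ω → α} {Y : Ω → β}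
    (hX : Measurable X) (hY : Measurable Y) {f : α → α'} {g : β → β'}
    (hf : Measurable f) (hg : Measurable g) :
    miBits μ (fun ω => f (X ω)) (fun ω => g (Y ω)) ≤ miBits μ X Y := by
  have i1 := Measure.isProbabilityMeasure_map (μ := μ) hX.aemeasurable
  have i2 := Measure.isProbabilityMeasure_map (μ := μ) hY.aemeasurable
  have i3 := Measure.isProbabilityMeasure_map (μ := μ) (hX.prodMk hY).aemeasurable
  have i4 := Measure.isProbabilityMeasure_map (μ := μ) (hf.comp hX).aemeasurable
  have i5 := Measure.isProbabilityMeasure_map (μ := μ) (hg.comp hY).aemeasurable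
  have i6 := Measure.isProbabilityMeasure_map (μ := μ)
    ((hf.comp hX).prodMk (hg.comp hY)).aemeasurable
  have hle := InformationTheory.klDiv_map_le (μ.map fun ω => (X ω, Y ω))
    ((μ.map X).prod (μ.map Y)) (hf.prodMap hg)
  simp only [Function.comp_def] at i4 i5 i6
  rw [Measure.map_map (hf.prodMap hg) (hX.prodMk hY), ← Measure.map_prod_map _ _ hf hg,
    Measure.map_map hf hX, Measure.map_map hg hY] at hle
  exact klBits_le_of _ _ _ _ hle

lemma miBits_symm_le {Ω α β : Type*} [MeasurableSpace Ω] [MeasurableSpace α]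
    [MeasurableSpace β] (μ : Measure Ω) [IsProbabilityMeasure μ] {X : Ω → α} {Y : Ω → β}
    (hX : Measurable X) (hY : Measurable Y) : miBits μ X Y ≤ miBits μ Y X := by
  have i1 := Measure.isProbabilityMeasure_map (μ := μ) hX.aemeasurable
  have i2 := Measure.isProbabilityMeasure_map (μ := μ) hY.aemeasurable
  have i3 := Measure.isProbabilityMeasure_map (μ := μ) (hX.prodMk hY).aemeasurable
  have i4 := Measure.isProbabilityMeasure_map (μ := μ) (hY.prodMk hX).aemeasurable
  have hle := InformationTheory.klDiv_map_le (μ.map fun ω => (Y ω, X ω))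
    ((μ.map Y).prod (μ.map X)) measurable_swap
  rw [Measure.map_map measurable_swap (hY.prodMk hX), Measure.prod_swap] at hle
  exact klBits_le_of _ _ _ _ hle

/-- `I(T;W) ≤ H(W)`. -/
lemma miBits_le_ent {Ω τ ω : Type*} [MeasurableSpace Ω] [MeasurableSpace τ]
    [StandardBorelSpace τ] [Nonempty τ] [MeasurableSpace ω]
    (μ : Measure Ω) [IsProbabilityMeasure μ] {T : Ω → τ} {W : Ω → ω}
    (hT : Measurable T) (hW : Measurable W) : miBits μ T W ≤ miBits μ W W := by
  have i1 := Measure.isProbabilityMeasure_map (μ := μ) hT.aemeasurable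
  have i2 := Measure.isProbabilityMeasure_map (μ := μ) hW.aemeasurable
  have i3 := Measure.isProbabilityMeasure_map (μ := μ) (hT.prodMk hW).aemeasurable
  have i4 := Measure.isProbabilityMeasure_map (μ := μ) (hW.prodMk hW).aemeasurable
  have hle := InformationTheory.klDiv_comp_right_le (μ.map fun x => (W x, W x))
    ((μ.map W).prod (μ.map W)) (condDistrib T W μ ∥ₖ Kernel.id)
  have e1 : (condDistrib T W μ ∥ₖ Kernel.id) ∘ₘ (μ.map fun x => (W x, W x))
      = μ.map (fun x => (T x, W x)) := by
    have : (μ.map fun x => (W x, W x)) = Kernel.copy ω ∘ₘ (μ.map W) := by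
      rw [Kernel.copy, Measure.deterministic_comp_eq_map, Measure.map_map (by fun_prop) hW]
      rfl
    rw [this, Measure.comp_assoc, Kernel.parallelComp_comp_copy]
    have h2 : (μ.map W) ⊗ₘ condDistrib T W μ = μ.map (fun x => (W x, T x)) :=
      compProd_map_condDistrib hT.aemeasurable
    rw [Measure.compProd_eq_comp_prod] at h2
    rw [← Kernel.swap_prod, ← Measure.comp_assoc, h2, Kernel.swap,
      Measure.deterministic_comp_eq_map, Measure.map_map measurable_swap (hW.prodMk hT)]
    rfl
  have e2 : (condDistrib T W μ ∥ₖ Kernel.id) ∘ₘ ((μ.map W).prod (μ.map W))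
      = (μ.map T).prod (μ.map W) := by
    rw [← Measure.prod_comp_left, condDistrib_comp_map hW.aemeasurable hT.aemeasurable]
  rw [e1, e2] at hle
  exact klBits_le_of _ _ _ _ hle

/-- If `X ⫫ Z` then `I(X;(Z,W)) ≤ I((X,Z);W)`. -/
lemma miBits_indep_le {Ω α ζ ω : Type*} [MeasurableSpace Ω] [MeasurableSpace α]
    [StandardBorelSpace α] [Nonempty α] [MeasurableSpace ω] [MeasurableSpace ζ]
    (μ : Measure Ω) [IsProbabilityMeasure μ] {X : Ω → α} {Z : Ω → ζ} {W : Ω → ω}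
    (hX : Measurable X) (hZ : Measurable Z) (hW : Measurable W) (hind : IndepFun X Z μ) :
    miBits μ X (fun x => (Z x, W x)) ≤ miBits μ (fun x => (X x, Z x)) W := by
  refine (miBits_symm_le μ hX (hZ.prodMk hW)).trans ?_
  have i1 := Measure.isProbabilityMeasure_map (μ := μ) hX.aemeasurable
  have i2 := Measure.isProbabilityMeasure_map (μ := μ) hW.aemeasurable
  have i3 := Measure.isProbabilityMeasure_map (μ := μ) hZ.aemeasurable
  have i4 := Measure.isProbabilityMeasure_map (μ := μ) (hZ.prodMk hW).aemeasurable
  have i5 := Measure.isProbabilityMeasure_map (μ := μ) (hX.prodMk hZ).aemeasurable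
  have i6 := Measure.isProbabilityMeasure_map (μ := μ) ((hX.prodMk hZ).prodMk hW).aemeasurable
  have i7 := Measure.isProbabilityMeasure_map (μ := μ) ((hZ.prodMk hW).prodMk hX).aemeasurable
  have hr : Measurable (fun p : (α × ζ) × ω => ((p.1.2, p.2), p.1.1)) := by fun_prop
  have hle := InformationTheory.klDiv_map_le (μ.map fun x => ((X x, Z x), W x))
    ((μ.map fun x => (X x, Z x)).prod (μ.map W)) hr
  have e1 : (μ.map fun x => ((X x, Z x), W x)).map
      (fun p : (α × ζ) × ω => ((p.1.2, p.2), p.1.1))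
      = (μ.map fun x => (Z x, W x)) ⊗ₘ condDistrib X (fun x => (Z x, W x)) μ := by
    rw [compProd_map_condDistrib hX.aemeasurable,
      Measure.map_map hr ((hX.prodMk hZ).prodMk hW)]
    rfl
  have e2 : ((μ.map fun x => (X x, Z x)).prod (μ.map W)).map
      (fun p : (α × ζ) × ω => ((p.1.2, p.2), p.1.1))
      = ((μ.map Z).prod (μ.map W)) ⊗ₘ Kernel.const _ (μ.map X) := by
    rw [(indepFun_iff_map_prod_eq_prod_map_map hX.aemeasurable hZ.aemeasurable).1 hind,
      Measure.compProd_const]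
    have : (fun p : (α × ζ) × ω => ((p.1.2, p.2), p.1.1))
        = Prod.swap ∘ MeasurableEquiv.prodAssoc := rfl
    rw [this, ← Measure.map_map measurable_swap (MeasurableEquiv.measurable _),
      Measure.prodAssoc_prod, Measure.prod_swap]
  rw [e1, e2, InformationTheory.klDiv_compProd_eq_add] at hle
  have hle2 := le_trans le_add_self hle
  rw [compProd_map_condDistrib hX.aemeasurable, Measure.compProd_const] at hle2
  exact klBits_le_of _ _ _ _ hle2

lemma miBits_map {Ω Ω' α β : Type*} [MeasurableSpace Ω] [MeasurableSpace Ω']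
    [MeasurableSpace α] [MeasurableSpace β] (μ : Measure Ω) {T : Ω → Ω'} (hT : Measurable T)
    {X : Ω' → α} {Y : Ω' → β} (hX : Measurable X) (hY : Measurable Y) :
    miBits (μ.map T) X Y = miBits μ (fun ω => X (T ω)) (fun ω => Y (T ω)) := by
  unfold miBits
  rw [Measure.map_map (hX.prodMk hY) hT, Measure.map_map hX hT, Measure.map_map hY hT]
  rfl

lemma entBits_eq {Ω α : Type*} [MeasurableSpace Ω] [MeasurableSpace α] (μ : Measure Ω)
    {X : Ω → α} (hX : Measurable X) : entBits μ X = miBits (μ.map X) id id := by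
  rw [miBits_map μ hX measurable_id measurable_id]
  rfl

lemma map_prod_eq_compProd {α β γ : Type*} [MeasurableSpace α] [MeasurableSpace β]
    [MeasurableSpace γ] (P : Measure α) [IsProbabilityMeasure P] (Q : Measure γ)
    [IsProbabilityMeasure Q] (κ : Kernel α β) [IsMarkovKernel κ]
    {f : α → γ → β} (hf : Measurable (Function.uncurry f)) (h : ∀ a, Q.map (f a) = κ a) :
    (P.prod Q).map (fun p => (p.1, f p.1 p.2)) = P ⊗ₘ κ := by
  have hf' : Measurable (fun p : α × γ => (p.1, f p.1 p.2)) := measurable_fst.prodMk hf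
  ext s hs
  rw [Measure.map_apply hf' hs, Measure.prod_apply (hf' hs), Measure.compProd_apply hs]
  refine lintegral_congr fun a => ?_
  rw [← h a, Measure.map_apply (f := f a) (hf.comp measurable_prodMk_left) (measurable_prodMk_left hs)]
  rfl

/-- The functional representation giving the first inequality. -/
lemma excessFI_add_le {𝒳 𝒴 : Type*}
    [TopologicalSpace 𝒳] [PolishSpace 𝒳] [MeasurableSpace 𝒳] [BorelSpace 𝒳] [Nonempty 𝒳]
    [TopologicalSpace 𝒴] [PolishSpace 𝒴] [MeasurableSpace 𝒴] [BorelSpace 𝒴] [Nonempty 𝒴]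
    (ρ : Measure (𝒳 × 𝒴 × ℝ)) [IsProbabilityMeasure ρ]
    (hci : CondIndepFun (MeasurableSpace.comap (fun p : 𝒳 × 𝒴 × ℝ => p.2.2) inferInstance)
        (measurable_snd.snd.comap_le)
        (fun p : 𝒳 × 𝒴 × ℝ => p.1) (fun p => p.2.1) ρ) :
    excessFI (ρ.map (fun p => (p.1, p.2.1))) + miOfJoint (ρ.map (fun p => (p.1, p.2.1)))
      ≤ entBits ρ (fun p : 𝒳 × 𝒴 × ℝ => p.2.2) := by
  have mX : Measurable (fun p : 𝒳 × 𝒴 × ℝ => p.1) := by fun_prop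
  have mY : Measurable (fun p : 𝒳 × 𝒴 × ℝ => p.2.1) := by fun_prop
  have mW : Measurable (fun p : 𝒳 × 𝒴 × ℝ => p.2.2) := by fun_prop
  have iX := Measure.isProbabilityMeasure_map (μ := ρ) mX.aemeasurable
  have iWX := Measure.isProbabilityMeasure_map (μ := ρ) (mW.prodMk mX).aemeasurable
  obtain ⟨f, hf, hfκ⟩ := Kernel.exists_measurable_map_eq_unitInterval
    (condDistrib (fun p : 𝒳 × 𝒴 × ℝ => p.2.2) (fun p => p.1) ρ)
  obtain ⟨h, hh, hhκ⟩ := Kernel.exists_measurable_map_eq_unitInterval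
    (condDistrib (fun p : 𝒳 × 𝒴 × ℝ => p.2.1) (fun p => p.2.2) ρ)
  have hf' : ∀ {δ : Type _} [MeasurableSpace δ] {a : δ → 𝒳} {b : δ → unitInterval},
      Measurable a → Measurable b → Measurable (fun x => f (a x) (b x)) :=
    fun ha hb => hf.comp (ha.prodMk hb)
  have hh' : ∀ {δ : Type _} [MeasurableSpace δ] {a : δ → ℝ} {b : δ → unitInterval},
      Measurable a → Measurable b → Measurable (fun x => h (a x) (b x)) :=
    fun ha hb => hh.comp (ha.prodMk hb)
  set PX : Measure 𝒳 := ρ.map (fun p => p.1) with hPX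
  -- law of `(W, X)`
  have law1 : (PX.prod (volume : Measure unitInterval)).map (fun p => (f p.1 p.2, p.1))
      = ρ.map (fun p => (p.2.2, p.1)) := by
    have e := map_prod_eq_compProd PX (volume : Measure unitInterval) _ hf hfκ
    rw [compProd_map_condDistrib mW.aemeasurable] at e
    have e2 := congrArg (Measure.map Prod.swap) e
    rw [Measure.map_map measurable_swap
        (measurable_fst.prodMk (hf' (by fun_prop) (by fun_prop))), Measure.map_map measurable_swap (mX.prodMk mW)] at e2
    exact e2
  -- law of `((W, X), Y)`
  have law2 : ((ρ.map (fun p => (p.2.2, p.1))).prod (volume : Measure unitInterval)).map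
      (fun p => (p.1, h p.1.1 p.2)) = ρ.map (fun p => ((p.2.2, p.1), p.2.1)) := by
    rw [map_prod_eq_compProd (ρ.map (fun p => (p.2.2, p.1))) (volume : Measure unitInterval)
      ((condDistrib (fun p : 𝒳 × 𝒴 × ℝ => p.2.1) (fun p => p.2.2) ρ).prodMkRight 𝒳)
      (f := fun a u => h a.1 u) (hh' (by fun_prop) (by fun_prop)) (fun a => hhκ a.1)]
    rw [← compProd_map_condDistrib (μ := ρ) (X := fun p : 𝒳 × 𝒴 × ℝ => (p.2.2, p.1))
      mY.aemeasurable]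
    refine Measure.compProd_congr ?_
    exact ((condIndepFun_iff_condDistrib_prod_ae_eq_prodMkRight mY mX mW).1 hci).symm
  -- the new probability space
  set μ : Measure (𝒳 × unitInterval × unitInterval) :=
    PX.prod ((volume : Measure unitInterval).prod (volume : Measure unitInterval)) with hμ
  let W' : 𝒳 × unitInterval × unitInterval → ℝ := fun p => f p.1 p.2.1
  let Y' : 𝒳 × unitInterval × unitInterval → 𝒴 := fun p => h (W' p) p.2.2
  have mW' : Measurable W' := hf' (by fun_prop) (by fun_prop)
  have mY' : Measurable Y' := hh' mW' (by fun_prop)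
  have law3 : μ.map (fun p => ((W' p, p.1), Y' p)) = ρ.map (fun p => ((p.2.2, p.1), p.2.1)) := by
    have mA : Measurable (fun p : 𝒳 × unitInterval => (f p.1 p.2, p.1)) :=
      (hf' (by fun_prop) (by fun_prop)).prodMk (by fun_prop)
    rw [← law2, ← law1, hμ, ← Measure.prodAssoc_prod,
      Measure.map_map ((mW'.prodMk (by fun_prop)).prodMk mY') (MeasurableEquiv.measurable _)]
    have : (volume : Measure unitInterval) = (volume : Measure unitInterval).map id := by simp
    conv_rhs => rw [this]
    rw [Measure.map_prod_map _ _ mA measurable_id,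
      Measure.map_map (measurable_fst.prodMk (hh' (by fun_prop) (by fun_prop)))
        (mA.prodMap measurable_id)]
    simp only [Measure.map_id]
    rfl
  have lawW : μ.map W' = ρ.map (fun p => p.2.2) := by
    have e := congrArg (Measure.map (fun q : (ℝ × 𝒳) × 𝒴 => q.1.1)) law3
    rw [Measure.map_map (by fun_prop) (by fun_prop),
      Measure.map_map (by fun_prop) (by fun_prop)] at e
    exact e
  have lawXY : μ.map (fun p => (p.1, Y' p)) = ρ.map (fun p => (p.1, p.2.1)) := by
    have e := congrArg (Measure.map (fun q : (ℝ × 𝒳) × 𝒴 => (q.1.2, q.2))) law3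
    rw [Measure.map_map (by fun_prop) (by fun_prop),
      Measure.map_map (by fun_prop) (by fun_prop)] at e
    exact e
  -- encode the randomness in `ℝ`
  let e : unitInterval × unitInterval → ℝ := embeddingReal (unitInterval × unitInterval)
  have he : MeasurableEmbedding e := measurableEmbedding_embeddingReal _
  have me := he.measurable
  let T : 𝒳 × unitInterval × unitInterval → 𝒳 × 𝒴 × ℝ := fun p => (p.1, Y' p, e p.2)
  have mT : Measurable T := by fun_prop
  have hind : IndepFun (fun p : 𝒳 × unitInterval × unitInterval => p.1) (fun p => p.2) μ :=
    indepFun_prod measurable_id measurable_id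
  have bound : miBits μ (fun p => p.1) (fun p => (e p.2, Y' p)) ≤
      entBits ρ (fun p : 𝒳 × 𝒴 × ℝ => p.2.2) := by
    have mg : Measurable (fun q : (unitInterval × unitInterval) × ℝ => (e q.1, h q.2 q.1.2)) :=
      (me.comp measurable_fst).prodMk (hh.comp (by fun_prop : Measurable
        fun q : (unitInterval × unitInterval) × ℝ => (q.2, q.1.2)))
    calc miBits μ (fun p => p.1) (fun p => (e p.2, Y' p))
        ≤ miBits μ (fun p => p.1) (fun p => (p.2, W' p)) :=
          miBits_comp_le μ (X := fun p => p.1) (Y := fun p => (p.2, W' p)) (by fun_prop)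
            (by fun_prop) (f := id) (g := fun q => (e q.1, h q.2 q.1.2)) measurable_id mg
      _ ≤ miBits μ (fun p => (p.1, p.2)) W' :=
          miBits_indep_le μ (by fun_prop) (by fun_prop) mW' hind
      _ ≤ miBits μ W' W' := miBits_le_ent μ (by fun_prop) mW'
      _ = entBits ρ (fun p : 𝒳 × 𝒴 × ℝ => p.2.2) := by
          rw [entBits_eq ρ mW, ← lawW, ← entBits_eq μ mW']
          rfl
  have hmi : miOfJoint (ρ.map (fun p => (p.1, p.2.1))) = miBits μ (fun p => p.1) Y' := by
    rw [miOfJoint, ← lawXY, miBits_map μ (by fun_prop) measurable_fst measurable_snd]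
  have dpi : miBits μ (fun p => p.1) Y' ≤ miBits μ (fun p => p.1) (fun p => (e p.2, Y' p)) :=
    miBits_comp_le μ (X := fun p => p.1) (Y := fun p => (e p.2, Y' p)) (by fun_prop)
      (by fun_prop) (f := id) (g := Prod.snd) measurable_id measurable_snd
  have hle : excessFI (ρ.map (fun p => (p.1, p.2.1))) ≤
      miBits μ (fun p => p.1) (fun p => (e p.2, Y' p)) - miBits μ (fun p => p.1) Y' := by
    refine sInf_le ⟨μ.map T, Measure.isProbabilityMeasure_map mT.aemeasurable, ?_, ?_, ?_, ?_⟩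
    · rw [Measure.map_map (by fun_prop) mT, ← lawXY]
      rfl
    · have h3 : IndepFun (fun p : 𝒳 × unitInterval × unitInterval => p.1) (fun p => e p.2) μ :=
        hind.comp measurable_id me
      have iT := Measure.isProbabilityMeasure_map (μ := μ) mT.aemeasurable
      rw [indepFun_iff_map_prod_eq_prod_map_map (by fun_prop) (by fun_prop)] at h3 ⊢
      rw [Measure.map_map (by fun_prop) mT, Measure.map_map (by fun_prop) mT,
        Measure.map_map (by fun_prop) mT]
      exact h3
    · have minv : Measurable he.invFun := he.measurable_invFun
      have m1 : Measurable (fun q : 𝒳 × ℝ => f q.1 (he.invFun q.2).1) :=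
        hf.comp (by fun_prop : Measurable fun q : 𝒳 × ℝ => (q.1, (he.invFun q.2).1))
      have m2 : Measurable (fun q : 𝒳 × ℝ => h (f q.1 (he.invFun q.2).1) (he.invFun q.2).2) :=
        hh.comp (m1.prodMk (by fun_prop))
      refine ⟨fun q => h (f q.1 (he.invFun q.2).1) (he.invFun q.2).2, m2, ?_⟩
      refine (ae_map_iff mT.aemeasurable (measurableSet_eq_fun mY
        (m2.comp (mX.prodMk mW)))).2 ?_
      refine Filter.Eventually.of_forall fun p => ?_
      simp [T, Y', W', he.leftInverse_invFun p.2]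
    · unfold cmiBits
      rw [miBits_map μ mT (by fun_prop) (by fun_prop), miBits_map μ mT (by fun_prop) (by fun_prop)]
  calc _ ≤ (miBits μ (fun p => p.1) (fun p => (e p.2, Y' p)) - miBits μ (fun p => p.1) Y')
        + miBits μ (fun p => p.1) Y' := by rw [hmi]; gcongr
    _ = miBits μ (fun p => p.1) (fun p => (e p.2, Y' p)) := tsub_add_cancel_of_le dpi
    _ ≤ _ := bound

lemma condIndepFun_of_ae_eq {Ω α β γ : Type*} [MeasurableSpace Ω] [StandardBorelSpace Ω]
    [MeasurableSpace α] [StandardBorelSpace α] [Nonempty α]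
    [MeasurableSpace β] [StandardBorelSpace β] [Nonempty β] [MeasurableSpace γ]
    (ρ : Measure Ω) [IsProbabilityMeasure ρ] {X : Ω → α} {Y : Ω → β} {W : Ω → γ}
    (hX : Measurable X) (hY : Measurable Y) (hW : Measurable W) {k : γ → α} (hk : Measurable k)
    (h : X =ᵐ[ρ] fun ω => k (W ω)) :
    CondIndepFun (MeasurableSpace.comap W inferInstance) hW.comap_le X Y ρ := by
  have h0 : CondIndepFun (MeasurableSpace.comap W inferInstance) hW.comap_le
      (fun ω => k (W ω)) Y ρ :=
    condIndepFun_of_measurable_left (hk.comp (comap_measurable W)) hY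
  rw [condIndepFun_iff_map_prod_eq_prod_condDistrib_prod_condDistrib
    (f := fun ω => k (W ω)) (hk.comp hW) hY hW] at h0
  rw [condIndepFun_iff_map_prod_eq_prod_condDistrib_prod_condDistrib hX hY hW,
    condDistrib_congr_left h]
  have : (fun ω => (W ω, X ω, Y ω)) =ᵐ[ρ] fun ω => (W ω, k (W ω), Y ω) := by
    filter_upwards [h] with ω hω
    rw [hω]
  rw [Measure.map_congr this]
  exact h0

lemma commonEntropy_le_of {𝒳 𝒴 α : Type*}
    [TopologicalSpace 𝒳] [PolishSpace 𝒳] [MeasurableSpace 𝒳] [BorelSpace 𝒳] [Nonempty 𝒳]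
    [TopologicalSpace 𝒴] [PolishSpace 𝒴] [MeasurableSpace 𝒴] [BorelSpace 𝒴] [Nonempty 𝒴]
    [MeasurableSpace α] [StandardBorelSpace α] [Nonempty α]
    (ν : Measure (𝒳 × 𝒴)) [IsProbabilityMeasure ν] (V : 𝒳 × 𝒴 → α) (hV : Measurable V)
    (hV' : (∃ k : α → 𝒳, Measurable k ∧ ∀ p, k (V p) = p.1) ∨
      ∃ k : α → 𝒴, Measurable k ∧ ∀ p, k (V p) = p.2) :
    commonEntropy ν ≤ miBits ν V V := by
  let e : α → ℝ := embeddingReal α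
  have he : MeasurableEmbedding e := measurableEmbedding_embeddingReal _
  have me := he.measurable
  have minv : Measurable he.invFun := he.measurable_invFun
  let T : 𝒳 × 𝒴 → 𝒳 × 𝒴 × ℝ := fun p => (p.1, p.2, e (V p))
  have mT : Measurable T := by fun_prop
  have iT := Measure.isProbabilityMeasure_map (μ := ν) mT.aemeasurable
  have mX : Measurable (fun p : 𝒳 × 𝒴 × ℝ => p.1) := by fun_prop
  have mY : Measurable (fun p : 𝒳 × 𝒴 × ℝ => p.2.1) := by fun_prop
  have mW : Measurable (fun p : 𝒳 × 𝒴 × ℝ => p.2.2) := by fun_prop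
  have hle : entBits (ν.map T) (fun p : 𝒳 × 𝒴 × ℝ => p.2.2) ≤ miBits ν V V := by
    unfold entBits
    rw [miBits_map ν mT mW mW]
    exact miBits_comp_le ν hV hV me me
  refine le_trans (sInf_le ⟨ν.map T, iT, ?_, ?_, rfl⟩) hle
  · rw [Measure.map_map (by fun_prop) mT]
    exact Measure.map_id
  · rcases hV' with ⟨k, hk, hkV⟩ | ⟨k, hk, hkV⟩
    · refine condIndepFun_of_ae_eq (ν.map T) mX mY mW (hk.comp minv) ?_
      refine (ae_map_iff mT.aemeasurable (measurableSet_eq_fun mX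
        ((hk.comp minv).comp mW))).2 (Filter.Eventually.of_forall fun p => ?_)
      simp [T, he.leftInverse_invFun (V p), hkV]
    · refine (condIndepFun_of_ae_eq (ν.map T) mY mX mW (hk.comp minv) ?_).symm
      refine (ae_map_iff mT.aemeasurable (measurableSet_eq_fun mY
        ((hk.comp minv).comp mW))).2 (Filter.Eventually.of_forall fun p => ?_)
      simp [T, he.leftInverse_invFun (V p), hkV]

/-- **Upper bound of the excess functional information by the common entropy**
(Proposition 3.5): `Ψ(X→Y) ≤ G(X;Y) − I(X;Y) ≤ min{H(X|Y), H(Y|X)}`, stated additively in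
`ℝ≥0∞` as `Ψ(X→Y) + I(X;Y) ≤ G(X;Y)` and `G(X;Y) ≤ min{H(X|Y), H(Y|X)} + I(X;Y)`. -/
theorem excessFI_le_commonEntropy
    {𝒳 𝒴 : Type*}
    [TopologicalSpace 𝒳] [PolishSpace 𝒳] [MeasurableSpace 𝒳] [BorelSpace 𝒳] [Nonempty 𝒳]
    [TopologicalSpace 𝒴] [PolishSpace 𝒴] [MeasurableSpace 𝒴] [BorelSpace 𝒴] [Nonempty 𝒴]
    (ν : Measure (𝒳 × 𝒴)) [IsProbabilityMeasure ν] :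
    excessFI ν + miOfJoint ν ≤ commonEntropy ν ∧
    commonEntropy ν ≤
      min (condEntBits ν Prod.fst Prod.snd) (condEntBits ν Prod.snd Prod.fst) +
        miOfJoint ν := by
  constructor
  · refine le_sInf ?_
    rintro r ⟨ρ, hρ, rfl, hci, rfl⟩
    exact excessFI_add_le ρ hci
  · rw [← min_add_add_right]
    refine le_min ?_ ?_
    · calc commonEntropy ν ≤ miBits ν Prod.fst Prod.fst :=
            commonEntropy_le_of ν Prod.fst measurable_fst
              (Or.inl ⟨id, measurable_id, fun _ => rfl⟩)
        _ ≤ miBits ν Prod.fst (fun p => (p.1, p.2)) :=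
            miBits_comp_le ν (X := Prod.fst) (Y := fun p => (p.1, p.2)) measurable_fst
              (by fun_prop) (f := id) (g := Prod.fst) measurable_id measurable_fst
        _ ≤ _ := le_tsub_add
    · calc commonEntropy ν ≤ miBits ν Prod.snd Prod.snd :=
            commonEntropy_le_of ν Prod.snd measurable_snd
              (Or.inr ⟨id, measurable_id, fun _ => rfl⟩)
        _ ≤ miBits ν Prod.snd (fun p => (p.2, p.1)) :=
            miBits_comp_le ν (X := Prod.snd) (Y := fun p => (p.2, p.1)) measurable_snd
              (by fun_prop) (f := id) (g := Prod.fst) measurable_id measurable_fst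
        _ ≤ condEntBits ν Prod.snd Prod.fst + miBits ν Prod.snd Prod.fst := le_tsub_add
        _ ≤ _ := by
            gcongr
            exact miBits_symm_le ν measurable_snd measurable_fst
end
end
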